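/- Let D₁ ⊆ B(H₁) and D₂ ⊆ B(H₂) be masas on separable Hilbert spaces, let B₁, …, B_r ⊆ B(H₁,H₂) be masa-bimodules of finite width, let U, U₁, …, U_r ⊆ B(K₁,K₂) be weak* closed subspaces, and set W = B₁ ⊗̄ U₁ + ⋯ + B_r ⊗̄ U_r. Let M ⊆ B(H₁,H₂) be a ternary masa-bimodule and C ⊆ B(H₁,H₂) be a masa-bimodule of finite width. Then cl(M ⊗̄ U + W) ∩ cl(C ⊗̄ U + W) = cl((M ∩ C) ⊗̄ U + W), where cl denotes weak* closure. -/

import Mathlib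

open scoped ComplexInnerProductSpace Pointwise
open Set MeasureTheory

noncomputable section

namespace OpSynth

/-! ### The σ-weak (weak*) topology on `B(H,K)` -/

/-- The σ-weak (weak*) topology on the space of bounded operators between Hilbert
spaces: the initial topology with respect to the functionals
`T ↦ ∑' n, ⟪η n, T (ξ n)⟫` associated to square-summable sequences `ξ`, `η`.
This is the weak* topology arising from the identification of `B(H,K)` with the
dual of the trace class operators. -/
def sigmaWeak (H K : Type*) [NormedAddCommGroup H] [InnerProductSpace ℂ H]
    [NormedAddCommGroup K] [InnerProductSpace ℂ K] :
    TopologicalSpace (H →L[ℂ] K) :=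
  ⨅ (ξ : ℕ → H) (η : ℕ → K) (_ : Summable fun n => ‖ξ n‖ ^ 2)
    (_ : Summable fun n => ‖η n‖ ^ 2),
    TopologicalSpace.induced
      (fun T : H →L[ℂ] K => ∑' n, ⟪η n, T (ξ n)⟫) inferInstance

section Basic

variable {H K H₁ H₂ H₃ K₁ K₂ T₁ T₂ : Type*}
  [NormedAddCommGroup H] [InnerProductSpace ℂ H]
  [NormedAddCommGroup K] [InnerProductSpace ℂ K]
  [NormedAddCommGroup H₁] [InnerProductSpace ℂ H₁]
  [NormedAddCommGroup H₂] [InnerProductSpace ℂ H₂]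
  [NormedAddCommGroup H₃] [InnerProductSpace ℂ H₃]
  [NormedAddCommGroup K₁] [InnerProductSpace ℂ K₁]
  [NormedAddCommGroup K₂] [InnerProductSpace ℂ K₂]
  [NormedAddCommGroup T₁] [InnerProductSpace ℂ T₁]
  [NormedAddCommGroup T₂] [InnerProductSpace ℂ T₂]

/-- A set of operators is weak* closed if it is closed in the σ-weak topology. -/
def WkClosed (S : Set (H →L[ℂ] K)) : Prop :=
  @IsClosed _ (sigmaWeak H K) S

/-- The weak* closure of a set of operators. -/
def wkClosure (S : Set (H →L[ℂ] K)) : Set (H →L[ℂ] K) :=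
  @closure _ (sigmaWeak H K) S

/-- A weak* closed (linear) subspace of `B(H,K)`. -/
def IsWkClosedSubspace (S : Set (H →L[ℂ] K)) : Prop :=
  (∃ M : Submodule ℂ (H →L[ℂ] K), (M : Set (H →L[ℂ] K)) = S) ∧ WkClosed S

/-- A map between operator spaces is weak* continuous if it is continuous with
respect to the σ-weak topologies. -/
def WkContinuous (φ : (H₁ →L[ℂ] H₂) → (K₁ →L[ℂ] K₂)) : Prop :=
  @Continuous _ _ (sigmaWeak H₁ H₂) (sigmaWeak K₁ K₂) φ

/-- The norm of an `n × n` matrix of operators, viewed as an operator on the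
column Hilbert space `ℓ²(Fin n, H)`: the supremum over the unit ball of the
ℓ²-norm of the image. -/
def blockNorm {n : ℕ} (M : Matrix (Fin n) (Fin n) (H →L[ℂ] K)) : ℝ :=
  sSup { r | ∃ v : Fin n → H, (∑ j, ‖v j‖ ^ 2) ≤ 1 ∧
    r = Real.sqrt (∑ i, ‖∑ j, M i j (v j)‖ ^ 2) }

/-- A map `φ : B(H₁,H₂) → B(K₁,K₂)` is completely bounded if its matrix
amplifications are uniformly bounded. -/
def CompletelyBounded (φ : (H₁ →L[ℂ] H₂) → (K₁ →L[ℂ] K₂)) : Prop :=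
  ∃ C : ℝ, 0 ≤ C ∧ ∀ (n : ℕ) (M : Matrix (Fin n) (Fin n) (H₁ →L[ℂ] H₂)),
    blockNorm (M.map φ) ≤ C * blockNorm M

/-- `t : H → K → T₁` realizes `T₁` as the Hilbertian tensor product `H ⊗ K`:
`t` is bilinear, multiplicative for inner products, and has total range. -/
def IsTensorEmbedding (t : H → K → T₁) : Prop :=
  (∀ x x' y, t (x + x') y = t x y + t x' y) ∧
  (∀ x y y', t x (y + y') = t x y + t x y') ∧
  (∀ (c : ℂ) x y, t (c • x) y = c • t x y) ∧
  (∀ (c : ℂ) x y, t x (c • y) = c • t x y) ∧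
  (∀ x x' y y', ⟪t x y, t x' y'⟫ = ⟪x, x'⟫ * ⟪y, y'⟫) ∧
  (Submodule.span ℂ { z | ∃ x y, z = t x y }).topologicalClosure = ⊤

/-- `W` is the elementary tensor `S ⊗ R` of the operators `S` and `R`, relative
to the tensor product realizations `t₁`, `t₂`. -/
def IsElemTensor (t₁ : H₁ → K₁ → T₁) (t₂ : H₂ → K₂ → T₂)
    (W : T₁ →L[ℂ] T₂) (S : H₁ →L[ℂ] H₂) (R : K₁ →L[ℂ] K₂) : Prop :=
  ∀ x y, W (t₁ x y) = t₂ (S x) (R y)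

/-- The weak* closed tensor product `V ⊗̄ U`: the weak* closed subspace generated
by the elementary tensors `S ⊗ R` with `S ∈ V`, `R ∈ U`. -/
def wTensor (t₁ : H₁ → K₁ → T₁) (t₂ : H₂ → K₂ → T₂)
    (V : Set (H₁ →L[ℂ] H₂)) (U : Set (K₁ →L[ℂ] K₂)) : Set (T₁ →L[ℂ] T₂) :=
  wkClosure ↑(Submodule.span ℂ
    { W : T₁ →L[ℂ] T₂ | ∃ S ∈ V, ∃ R ∈ U, IsElemTensor t₁ t₂ W S R })

/-- The Fubini product `F(V,U) = (V ⊗̄ B(K₁,K₂)) ∩ (B(H₁,H₂) ⊗̄ U)`. -/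
def Fubini (t₁ : H₁ → K₁ → T₁) (t₂ : H₂ → K₂ → T₂)
    (V : Set (H₁ →L[ℂ] H₂)) (U : Set (K₁ →L[ℂ] K₂)) : Set (T₁ →L[ℂ] T₂) :=
  wTensor t₁ t₂ V univ ∩ wTensor t₁ t₂ univ U

/-- Sum of finitely many subsets of an additive monoid. -/
def setSum {α : Type*} [AddCommMonoid α] {n : ℕ} (S : Fin n → Set α) : Set α :=
  { x | ∃ f : Fin n → α, (∀ i, f i ∈ S i) ∧ x = ∑ i, f i }

/-- The reflexive hull `Ref W = {T : Tx ∈ closure (W x) for all x}`. -/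
def RefHull (W : Set (H →L[ℂ] K)) : Set (H →L[ℂ] K) :=
  { T | ∀ x : H, T x ∈ closure ((fun S : H →L[ℂ] K => S x) '' W) }

end Basic

/-- Property `S_σ`: `F(V,U) = V ⊗̄ U` for every weak* closed subspace `U` of
`B(K₁,K₂)`, all Hilbert spaces `K₁`, `K₂`, and all realizations of the
corresponding Hilbertian tensor products. -/
def HasSsigma {H₁ H₂ : Type*}
    [NormedAddCommGroup H₁] [InnerProductSpace ℂ H₁]
    [NormedAddCommGroup H₂] [InnerProductSpace ℂ H₂]
    (V : Set (H₁ →L[ℂ] H₂)) : Prop :=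
  ∀ (K₁ K₂ T₁ T₂ : Type)
    [NormedAddCommGroup K₁] [InnerProductSpace ℂ K₁] [CompleteSpace K₁]
    [NormedAddCommGroup K₂] [InnerProductSpace ℂ K₂] [CompleteSpace K₂]
    [NormedAddCommGroup T₁] [InnerProductSpace ℂ T₁] [CompleteSpace T₁]
    [NormedAddCommGroup T₂] [InnerProductSpace ℂ T₂] [CompleteSpace T₂]
    (t₁ : H₁ → K₁ → T₁) (t₂ : H₂ → K₂ → T₂),
    IsTensorEmbedding t₁ → IsTensorEmbedding t₂ →
    ∀ U : Set (K₁ →L[ℂ] K₂), IsWkClosedSubspace U →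
      Fubini t₁ t₂ V U = wTensor t₁ t₂ V U

section Masa

variable {H H₁ H₂ H₃ : Type*}
  [NormedAddCommGroup H] [InnerProductSpace ℂ H] [CompleteSpace H]
  [NormedAddCommGroup H₁] [InnerProductSpace ℂ H₁] [CompleteSpace H₁]
  [NormedAddCommGroup H₂] [InnerProductSpace ℂ H₂] [CompleteSpace H₂]
  [NormedAddCommGroup H₃] [InnerProductSpace ℂ H₃] [CompleteSpace H₃]

/-- A masa: a maximal abelian selfadjoint subalgebra of `B(H)`. -/
def IsMasa (D : StarSubalgebra ℂ (H →L[ℂ] H)) : Prop :=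
  (∀ a ∈ D, ∀ b ∈ D, a * b = b * a) ∧
  ∀ E : StarSubalgebra ℂ (H →L[ℂ] H),
    (∀ a ∈ E, ∀ b ∈ E, a * b = b * a) → D ≤ E → E = D

/-- A (weak* closed) `D₂,D₁`-masa-bimodule. -/
def IsMasaBimodule (D₁ : StarSubalgebra ℂ (H₁ →L[ℂ] H₁))
    (D₂ : StarSubalgebra ℂ (H₂ →L[ℂ] H₂)) (V : Set (H₁ →L[ℂ] H₂)) : Prop :=
  IsWkClosedSubspace V ∧
  ∀ X ∈ V, ∀ A ∈ D₁, ∀ B ∈ D₂, B ∘L X ∘L A ∈ V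

/-- A ternary set of operators: closed under the triple product `T S* R`. -/
def IsTernary (M : Set (H₁ →L[ℂ] H₂)) : Prop :=
  ∀ T ∈ M, ∀ S ∈ M, ∀ R ∈ M, T ∘L (ContinuousLinearMap.adjoint S) ∘L R ∈ M

/-- An orthogonal projection. -/
def IsProj (p : H →L[ℂ] H) : Prop := p ∘L p = p ∧ IsSelfAdjoint p

/-- A minimal non-zero projection of a masa. -/
def IsMinimalProjOf (D : StarSubalgebra ℂ (H →L[ℂ] H)) (p : H →L[ℂ] H) : Prop :=
  p ∈ D ∧ IsProj p ∧ p ≠ 0 ∧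
    ∀ q ∈ D, IsProj q → p ∘L q = q → q = 0 ∨ q = p

/-- A projection in a masa is non-atomic if it dominates no minimal non-zero
projection of the masa. -/
def IsNonAtomicProj (D : StarSubalgebra ℂ (H →L[ℂ] H)) (E : H →L[ℂ] H) : Prop :=
  ∀ p, IsMinimalProjOf D p → ¬ (E ∘L p = p)

/-- A `D₂,D₁`-masa-bimodule map. -/
def IsMasaBimoduleMap (D₁ : StarSubalgebra ℂ (H₁ →L[ℂ] H₁))
    (D₂ : StarSubalgebra ℂ (H₂ →L[ℂ] H₂))
    (φ : (H₁ →L[ℂ] H₂) → (H₁ →L[ℂ] H₂)) : Prop :=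
  ∀ (X : H₁ →L[ℂ] H₂), ∀ A ∈ D₁, ∀ B ∈ D₂,
    φ (B ∘L X ∘L A) = B ∘L (φ X) ∘L A

/-- A Schur idempotent: a weak* continuous completely bounded idempotent
masa-bimodule map. -/
def IsSchurIdempotent (D₁ : StarSubalgebra ℂ (H₁ →L[ℂ] H₁))
    (D₂ : StarSubalgebra ℂ (H₂ →L[ℂ] H₂))
    (φ : (H₁ →L[ℂ] H₂) → (H₁ →L[ℂ] H₂)) : Prop :=
  IsLinearMap ℂ φ ∧ WkContinuous φ ∧ CompletelyBounded φ ∧ φ ∘ φ = φ ∧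
    IsMasaBimoduleMap D₁ D₂ φ

/-- A nest: a totally ordered family of closed subspaces containing the
intersection and the closed linear span of any of its subsets. -/
def IsNest (N : Set (Submodule ℂ H)) : Prop :=
  (∀ p ∈ N, IsClosed (p : Set H)) ∧ IsChain (· ≤ ·) N ∧
  ∀ S : Set (Submodule ℂ H), S ⊆ N →
    sInf S ∈ N ∧ (sSup S).topologicalClosure ∈ N

/-- The nest algebra of a nest: all operators leaving each subspace invariant. -/
def nestAlg (N : Set (Submodule ℂ H)) : Set (H →L[ℂ] H) :=
  { T | ∀ p ∈ N, ∀ x ∈ p, T x ∈ p }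

/-- A (weak* closed) nest algebra bimodule. -/
def IsNestBimodule (V : Set (H₁ →L[ℂ] H₂)) : Prop :=
  IsWkClosedSubspace V ∧
  ∃ (N₁ : Set (Submodule ℂ H₁)) (N₂ : Set (Submodule ℂ H₂)),
    IsNest N₁ ∧ IsNest N₂ ∧
    ∀ X ∈ V, ∀ A ∈ nestAlg N₁, ∀ B ∈ nestAlg N₂, B ∘L X ∘L A ∈ V

/-- A masa-bimodule of finite width: a finite intersection of masa-bimodules
each of which is a nest algebra bimodule. -/
def HasFiniteWidth (D₁ : StarSubalgebra ℂ (H₁ →L[ℂ] H₁))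
    (D₂ : StarSubalgebra ℂ (H₂ →L[ℂ] H₂)) (V : Set (H₁ →L[ℂ] H₂)) : Prop :=
  ∃ (k : ℕ) (Vs : Fin k → Set (H₁ →L[ℂ] H₂)),
    (∀ j, IsMasaBimodule D₁ D₂ (Vs j) ∧ IsNestBimodule (Vs j)) ∧
    V = ⋂ j, Vs j

end Masa

section Algebras

variable {H H₁ H₂ H₃ K : Type*}
  [NormedAddCommGroup H] [InnerProductSpace ℂ H] [CompleteSpace H]
  [NormedAddCommGroup H₁] [InnerProductSpace ℂ H₁] [CompleteSpace H₁]
  [NormedAddCommGroup H₂] [InnerProductSpace ℂ H₂] [CompleteSpace H₂]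
  [NormedAddCommGroup H₃] [InnerProductSpace ℂ H₃] [CompleteSpace H₃]

/-- A weak* closed unital operator algebra in `B(H)`. -/
def IsWkClosedUnitalAlg (A : Set (H →L[ℂ] H)) : Prop :=
  IsWkClosedSubspace A ∧ (1 : H →L[ℂ] H) ∈ A ∧ ∀ a ∈ A, ∀ b ∈ A, a ∘L b ∈ A

/-- `[X Y]`: the weak* closed linear span of the products `x ∘ y`. -/
def mulSpan (X : Set (H₂ →L[ℂ] H₃)) (Y : Set (H₁ →L[ℂ] H₂)) :
    Set (H₁ →L[ℂ] H₃) :=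
  wkClosure ↑(Submodule.span ℂ { T : H₁ →L[ℂ] H₃ | ∃ x ∈ X, ∃ y ∈ Y, T = x ∘L y })

/-- The data witnessing a spatial embedding of `A` into `B`. -/
def SpatialPair (A : Set (H₁ →L[ℂ] H₁)) (B : Set (H₂ →L[ℂ] H₂))
    (X : Set (H₁ →L[ℂ] H₂)) (Y : Set (H₂ →L[ℂ] H₁)) : Prop :=
  IsWkClosedSubspace X ∧ IsWkClosedSubspace Y ∧
  (∀ x ∈ X, ∀ b ∈ B, ∀ a ∈ A, b ∘L x ∘L a ∈ X) ∧
  (∀ y ∈ Y, ∀ a ∈ A, ∀ b ∈ B, a ∘L y ∘L b ∈ Y) ∧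
  mulSpan X Y ⊆ B ∧ mulSpan Y X = A

/-- `A` is spatially embedded in `B`. -/
def SpatiallyEmbedded (A : Set (H₁ →L[ℂ] H₁)) (B : Set (H₂ →L[ℂ] H₂)) : Prop :=
  ∃ X Y, SpatialPair A B X Y

/-- `A` and `B` are spatially Morita equivalent. -/
def SpatiallyMorita (A : Set (H₁ →L[ℂ] H₁)) (B : Set (H₂ →L[ℂ] H₂)) : Prop :=
  ∃ X Y, SpatialPair A B X Y ∧ mulSpan X Y = B

/-- The strong operator topology on `B(H,K)`. -/
def sot (H K : Type*) [NormedAddCommGroup H] [InnerProductSpace ℂ H]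
    [NormedAddCommGroup K] [InnerProductSpace ℂ K] :
    TopologicalSpace (H →L[ℂ] K) :=
  TopologicalSpace.induced (fun T : H →L[ℂ] K => (T : H → K)) Pi.topologicalSpace

/-- A commutative subspace lattice (CSL): a strongly closed lattice of mutually
commuting orthogonal projections containing `0` and `1`. -/
def IsCSL (L : Set (H →L[ℂ] H)) : Prop :=
  (∀ P ∈ L, IsProj P) ∧
  (∀ P ∈ L, ∀ Q ∈ L, P ∘L Q = Q ∘L P) ∧
  (0 : H →L[ℂ] H) ∈ L ∧ (1 : H →L[ℂ] H) ∈ L ∧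
  (∀ P ∈ L, ∀ Q ∈ L, P ∘L Q ∈ L ∧ P + Q - P ∘L Q ∈ L) ∧
  @IsClosed _ (sot H H) L

/-- The CSL algebra `Alg L = {T : (1 - P) T P = 0 for all P ∈ L}`. -/
def cslAlg (L : Set (H →L[ℂ] H)) : Set (H →L[ℂ] H) :=
  { T | ∀ P ∈ L, (1 - P) ∘L T ∘L P = 0 }

/-- A lattice homomorphism between CSLs (preserving meets and joins). -/
def IsLatticeHom (L₁ : Set (H₁ →L[ℂ] H₁)) (L₂ : Set (H₂ →L[ℂ] H₂))
    (φ : (H₁ →L[ℂ] H₁) → (H₂ →L[ℂ] H₂)) : Prop :=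
  MapsTo φ L₁ L₂ ∧
  (∀ P ∈ L₁, ∀ Q ∈ L₁, φ (P ∘L Q) = φ P ∘L φ Q) ∧
  (∀ P ∈ L₁, ∀ Q ∈ L₁, φ (P + Q - P ∘L Q) = φ P + φ Q - φ P ∘L φ Q)

end Algebras

section MeasurePart

variable {X X₁ X₂ : Type*} [MeasurableSpace X] [MeasurableSpace X₁] [MeasurableSpace X₂]

/-- A subset of a product of measure spaces is marginally null if it is
contained in `(M₁ × X₂) ∪ (X₁ × M₂)` with `μ₁ M₁ = μ₂ M₂ = 0`. -/
def MargNull (μ₁ : Measure X₁) (μ₂ : Measure X₂) (E : Set (X₁ × X₂)) : Prop :=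
  ∃ (M₁ : Set X₁) (M₂ : Set X₂), MeasurableSet M₁ ∧ MeasurableSet M₂ ∧
    μ₁ M₁ = 0 ∧ μ₂ M₂ = 0 ∧
    E ⊆ (M₁ ×ˢ (univ : Set X₂)) ∪ ((univ : Set X₁) ×ˢ M₂)

/-- Marginal equivalence: the symmetric difference is marginally null. -/
def MargEquiv (μ₁ : Measure X₁) (μ₂ : Measure X₂) (E F : Set (X₁ × X₂)) : Prop :=
  MargNull μ₁ μ₂ ((E \ F) ∪ (F \ E))

/-- ω-open sets: marginally equivalent to a countable union of measurable
rectangles. -/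
def OmegaOpen (μ₁ : Measure X₁) (μ₂ : Measure X₂) (E : Set (X₁ × X₂)) : Prop :=
  ∃ (α : ℕ → Set X₁) (β : ℕ → Set X₂),
    (∀ n, MeasurableSet (α n)) ∧ (∀ n, MeasurableSet (β n)) ∧
    MargEquiv μ₁ μ₂ E (⋃ n, (α n) ×ˢ (β n))

/-- ω-closed sets: complements of ω-open sets. -/
def OmegaClosed (μ₁ : Measure X₁) (μ₂ : Measure X₂) (E : Set (X₁ × X₂)) : Prop :=
  OmegaOpen μ₁ μ₂ Eᶜ

/-- `A` is a multiplication operator on `L²(X,μ)`: `A f = φ · f` for some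
essentially bounded function `φ`.  The collection `{A | IsMultOp μ A}` is the
multiplication masa of `L^∞(X,μ)`. -/
def IsMultOp (μ : Measure X) (A : Lp ℂ 2 μ →L[ℂ] Lp ℂ 2 μ) : Prop :=
  ∃ φ : X → ℂ, AEStronglyMeasurable φ μ ∧ (∃ C, ∀ᵐ x ∂μ, ‖φ x‖ ≤ C) ∧
    ∀ f : Lp ℂ 2 μ, ⇑(A f) =ᵐ[μ] fun x => φ x * f x

/-- A (weak* closed) masa-bimodule over the multiplication masas. -/
def IsMultBimodule (μ₁ : Measure X₁) (μ₂ : Measure X₂)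
    (V : Set (Lp ℂ 2 μ₁ →L[ℂ] Lp ℂ 2 μ₂)) : Prop :=
  IsWkClosedSubspace V ∧
  ∀ X ∈ V, ∀ (A : Lp ℂ 2 μ₁ →L[ℂ] Lp ℂ 2 μ₁) (B : Lp ℂ 2 μ₂ →L[ℂ] Lp ℂ 2 μ₂),
    IsMultOp μ₁ A → IsMultOp μ₂ B → B ∘L X ∘L A ∈ V

/-- `T` is supported on `κ`: `M_{χ_β} T M_{χ_α} = 0` (equivalently,
`⟪T f, g⟫ = 0` whenever `f` vanishes off `α` and `g` vanishes off `β`)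
whenever the rectangle `α × β` intersects `κ` marginally nullly. -/
def SupportedOn (μ₁ : Measure X₁) (μ₂ : Measure X₂) (κ : Set (X₁ × X₂))
    (T : Lp ℂ 2 μ₁ →L[ℂ] Lp ℂ 2 μ₂) : Prop :=
  ∀ (α : Set X₁) (β : Set X₂), MeasurableSet α → MeasurableSet β →
    MargNull μ₁ μ₂ ((α ×ˢ β) ∩ κ) →
    ∀ (f : Lp ℂ 2 μ₁) (g : Lp ℂ 2 μ₂),
      (∀ᵐ x ∂μ₁, x ∉ α → f x = 0) → (∀ᵐ y ∂μ₂, y ∉ β → g y = 0) →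
      ⟪T f, g⟫ = (0 : ℂ)

/-- `M_max κ`: the space of all operators supported on `κ` — the largest
masa-bimodule with support `κ`. -/
def Mmax (μ₁ : Measure X₁) (μ₂ : Measure X₂) (κ : Set (X₁ × X₂)) :
    Set (Lp ℂ 2 μ₁ →L[ℂ] Lp ℂ 2 μ₂) :=
  { T | SupportedOn μ₁ μ₂ κ T }

/-- `U` has support `κ`: `κ` is ω-closed and `Ref U = M_max κ`. -/
def HasSupport (μ₁ : Measure X₁) (μ₂ : Measure X₂)
    (U : Set (Lp ℂ 2 μ₁ →L[ℂ] Lp ℂ 2 μ₂)) (κ : Set (X₁ × X₂)) : Prop :=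
  OmegaClosed μ₁ μ₂ κ ∧ RefHull U = Mmax μ₁ μ₂ κ

/-- `M_min κ`: the smallest weak* closed masa-bimodule with support `κ`,
realized as the intersection of all weak* closed masa-bimodules with support `κ`. -/
def Mmin (μ₁ : Measure X₁) (μ₂ : Measure X₂) (κ : Set (X₁ × X₂)) :
    Set (Lp ℂ 2 μ₁ →L[ℂ] Lp ℂ 2 μ₂) :=
  ⋂₀ { U | IsMultBimodule μ₁ μ₂ U ∧ HasSupport μ₁ μ₂ U κ }

/-- `κ` is operator synthetic if it is ω-closed and `M_min κ = M_max κ`. -/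
def OperatorSynthetic (μ₁ : Measure X₁) (μ₂ : Measure X₂)
    (κ : Set (X₁ × X₂)) : Prop :=
  OmegaClosed μ₁ μ₂ κ ∧ Mmin μ₁ μ₂ κ = Mmax μ₁ μ₂ κ

/-- A masa-bimodule of finite width over the multiplication masas. -/
def MultFiniteWidth (μ₁ : Measure X₁) (μ₂ : Measure X₂)
    (V : Set (Lp ℂ 2 μ₁ →L[ℂ] Lp ℂ 2 μ₂)) : Prop :=
  ∃ (k : ℕ) (Vs : Fin k → Set (Lp ℂ 2 μ₁ →L[ℂ] Lp ℂ 2 μ₂)),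
    (∀ j, IsMultBimodule μ₁ μ₂ (Vs j) ∧ IsNestBimodule (Vs j)) ∧
    V = ⋂ j, Vs j

/-- A set of finite width: the support of a masa-bimodule of finite width. -/
def FiniteWidthSet (μ₁ : Measure X₁) (μ₂ : Measure X₂)
    (κ : Set (X₁ × X₂)) : Prop :=
  ∃ V, MultFiniteWidth μ₁ μ₂ V ∧ HasSupport μ₁ μ₂ V κ

end MeasurePart

/-- The flip `ρ : (X₁ × X₂) × (Y₁ × Y₂) → (X₁ × Y₁) × (X₂ × Y₂)`. -/
def flipProd {X₁ X₂ Y₁ Y₂ : Type*} :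
    (X₁ × X₂) × (Y₁ × Y₂) → (X₁ × Y₁) × (X₂ × Y₂) :=
  fun q => ((q.1.1, q.2.1), (q.1.2, q.2.2))

end OpSynth


open scoped ComplexInnerProductSpace Pointwise
open Set OpSynth

set_option linter.all false

namespace OSX
section Shortcuts
variable {H K : Type*} [NormedAddCommGroup H] [InnerProductSpace ℂ H] [NormedAddCommGroup K] [InnerProductSpace ℂ K]
scoped instance (priority := 2000) sc1 : Module ℂ H := NormedSpace.toModule
scoped instance (priority := 2000) sc2 : Module ℂ (H →L[ℂ] K) := ContinuousLinearMap.module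
scoped instance (priority := 2000) sc3 : Algebra ℂ (H →L[ℂ] H) := ContinuousLinearMap.algebra
scoped instance (priority := 2000) sc4 : AddCommMonoid (H →L[ℂ] K) := ContinuousLinearMap.addCommMonoid
scoped instance (priority := 2000) sc5 : AddCommGroup (H →L[ℂ] K) := ContinuousLinearMap.addCommGroup
scoped instance (priority := 2000) sc6 : NormedAddCommGroup (H →L[ℂ] K) := ContinuousLinearMap.toNormedAddCommGroup
scoped instance (priority := 2000) sc7 : Ring (H →L[ℂ] H) := ContinuousLinearMap.ring
scoped instance (priority := 2000) sc8 : Semiring (H →L[ℂ] H) := ContinuousLinearMap.semiring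
scoped instance (priority := 2000) sc9 : ContinuousConstSMul ℂ H := inferInstance
end Shortcuts
end OSX

namespace OSX
open Filter Topology
section A
variable {ι H K H' K' : Type*}
  [NormedAddCommGroup H] [InnerProductSpace ℂ H]
  [NormedAddCommGroup K] [InnerProductSpace ℂ K]
  [NormedAddCommGroup H'] [InnerProductSpace ℂ H']
  [NormedAddCommGroup K'] [InnerProductSpace ℂ K']

def SqS (ξ : ℕ → H) : Prop := Summable fun n => ‖ξ n‖ ^ 2

def fl (ξ : ℕ → H) (η : ℕ → K) (T : H →L[ℂ] K) : ℂ := ∑' n, ⟪η n, T (ξ n)⟫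

theorem term_bound (x : H) (y : K) (T : H →L[ℂ] K) {C : ℝ} (hC : ‖T‖ ≤ C) :
    ‖(⟪y, T x⟫ : ℂ)‖ ≤ C * (‖x‖ ^ 2 + ‖y‖ ^ 2) := by
  have h1 := norm_inner_le_norm (𝕜 := ℂ) y (T x)
  have h2 := T.le_opNorm x
  have h0 : 0 ≤ ‖T‖ := norm_nonneg _
  have h3 : ‖y‖ * ‖T x‖ ≤ ‖y‖ * (C * ‖x‖) := by
    apply mul_le_mul_of_nonneg_left _ (norm_nonneg _)
    exact h2.trans (mul_le_mul_of_nonneg_right hC (norm_nonneg _))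
  have h4 : 0 ≤ C := h0.trans hC
  nlinarith [sq_nonneg (‖x‖ - ‖y‖), sq_nonneg (‖x‖), sq_nonneg ‖y‖,
    mul_nonneg h4 (sq_nonneg (‖x‖ - ‖y‖)), mul_nonneg h4 (sq_nonneg (‖x‖)),
    mul_nonneg h4 (sq_nonneg (‖y‖))]

theorem fl_summable {ξ : ℕ → H} {η : ℕ → K} (hξ : SqS ξ) (hη : SqS η) (T : H →L[ℂ] K) :
    Summable fun n => (⟪η n, T (ξ n)⟫ : ℂ) := by
  refine Summable.of_norm_bounded (g := fun n => ‖T‖ * (‖ξ n‖ ^ 2 + ‖η n‖ ^ 2))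
    ((hξ.add hη).mul_left _) fun n => term_bound _ _ _ le_rfl

theorem fl_add {ξ : ℕ → H} {η : ℕ → K} (hξ : SqS ξ) (hη : SqS η) (S T : H →L[ℂ] K) :
    fl ξ η (S + T) = fl ξ η S + fl ξ η T := by
  unfold fl
  rw [← (fl_summable hξ hη S).tsum_add (fl_summable hξ hη T)]
  simp [inner_add_right]

theorem fl_smul (ξ : ℕ → H) (η : ℕ → K) (c : ℂ) (T : H →L[ℂ] K) :
    fl ξ η (c • T) = c * fl ξ η T := by
  unfold fl
  rw [← tsum_mul_left]
  simp [inner_smul_right]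

def WkT (l : Filter ι) (f : ι → H →L[ℂ] K) (X : H →L[ℂ] K) : Prop :=
  ∀ (ξ : ℕ → H) (η : ℕ → K), SqS ξ → SqS η →
    Tendsto (fun i => fl ξ η (f i)) l (𝓝 (fl ξ η X))

theorem wkT_iff (l : Filter ι) (f : ι → H →L[ℂ] K) (X : H →L[ℂ] K) :
    WkT l f X ↔ Tendsto f l (@nhds _ (sigmaWeak H K) X) := by
  unfold sigmaWeak WkT
  simp only [nhds_iInf, nhds_induced, tendsto_iInf, tendsto_comap_iff]
  rfl

theorem mem_wkClosure {S : Set (H →L[ℂ] K)} {X : H →L[ℂ] K} :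
    X ∈ wkClosure S ↔ ∃ F : Filter (H →L[ℂ] K), F.NeBot ∧ S ∈ F ∧ WkT F id X := by
  unfold wkClosure
  rw [@mem_closure_iff_clusterPt _ (sigmaWeak H K)]
  constructor
  · intro h
    refine ⟨@nhds _ (sigmaWeak H K) X ⊓ 𝓟 S, h, ?_, ?_⟩
    · exact mem_inf_of_right (mem_principal_self S)
    · rw [wkT_iff]
      exact inf_le_left
  · rintro ⟨F, hF, hS, h⟩
    rw [wkT_iff, tendsto_id'] at h
    have : F ≤ @nhds _ (sigmaWeak H K) X ⊓ 𝓟 S := le_inf h (le_principal_iff.2 hS)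
    exact hF.mono this

theorem mem_wkClosure_of {S : Set (H →L[ℂ] K)} {X : H →L[ℂ] K} {l : Filter ι} [l.NeBot]
    {f : ι → H →L[ℂ] K} (h : WkT l f X) (hf : ∀ᶠ i in l, f i ∈ S) : X ∈ wkClosure S := by
  rw [mem_wkClosure]
  refine ⟨l.map f, inferInstance, hf, ?_⟩
  rw [wkT_iff] at *
  exact h

theorem subset_wkClosure (S : Set (H →L[ℂ] K)) : S ⊆ wkClosure S :=
  @subset_closure _ (sigmaWeak H K) S

theorem wkClosed_wkClosure (S : Set (H →L[ℂ] K)) : WkClosed (wkClosure S) :=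
  @isClosed_closure _ (sigmaWeak H K) S

theorem wkClosure_min {S Z : Set (H →L[ℂ] K)} (h : S ⊆ Z) (hZ : WkClosed Z) :
    wkClosure S ⊆ Z := @closure_minimal _ (sigmaWeak H K) S Z h hZ

theorem wkClosure_mono {S Z : Set (H →L[ℂ] K)} (h : S ⊆ Z) :
    wkClosure S ⊆ wkClosure Z := @closure_mono _ (sigmaWeak H K) S Z h

theorem _root_.OpSynth.WkClosed.wkClosure_eq {Z : Set (H →L[ℂ] K)} (hZ : WkClosed Z) : wkClosure Z = Z :=
  @IsClosed.closure_eq _ (sigmaWeak H K) Z hZ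

theorem _root_.OpSynth.WkClosed.mem_of {Z : Set (H →L[ℂ] K)} (hZ : WkClosed Z) {X : H →L[ℂ] K} {l : Filter ι}
    [l.NeBot] {f : ι → H →L[ℂ] K} (h : WkT l f X) (hf : ∀ᶠ i in l, f i ∈ Z) : X ∈ Z := by
  rw [← hZ.wkClosure_eq]
  exact mem_wkClosure_of h hf

theorem wkClosed_of {Z : Set (H →L[ℂ] K)} (h : ∀ (F : Filter (H →L[ℂ] K)) X, F.NeBot → Z ∈ F →
    WkT F id X → X ∈ Z) : WkClosed Z := by
  have : wkClosure Z = Z := by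
    apply subset_antisymm _ (subset_wkClosure Z)
    intro X hX
    obtain ⟨F, h1, h2, h3⟩ := mem_wkClosure.1 hX
    exact h F X h1 h2 h3
  rw [← this]
  exact wkClosed_wkClosure _

theorem _root_.OpSynth.WkClosed.iInter {α : Sort*} {Z : α → Set (H →L[ℂ] K)} (h : ∀ a, WkClosed (Z a)) :
    WkClosed (⋂ a, Z a) := @isClosed_iInter _ _ (sigmaWeak H K) _ h

theorem _root_.OpSynth.WkClosed.inter {Z Z' : Set (H →L[ℂ] K)} (h : WkClosed Z) (h' : WkClosed Z') :
    WkClosed (Z ∩ Z') := @IsClosed.inter _ _ _ (sigmaWeak H K) h h'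

theorem WkT.const (l : Filter ι) (X : H →L[ℂ] K) : WkT l (fun _ => X) X :=
  fun _ _ _ _ => tendsto_const_nhds

theorem WkT.comp' {κ : Type*} {l : Filter ι} {f : ι → H →L[ℂ] K} {X : H →L[ℂ] K} (h : WkT l f X)
    {l' : Filter κ} {g : κ → ι} (hg : Tendsto g l' l) : WkT l' (fun k => f (g k)) X :=
  fun ξ η hξ hη => (h ξ η hξ hη).comp hg

theorem WkT.mono {l l' : Filter ι} {f : ι → H →L[ℂ] K} {X : H →L[ℂ] K} (h : WkT l f X)
    (hl : l' ≤ l) : WkT l' f X := fun ξ η hξ hη => (h ξ η hξ hη).mono_left hl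

theorem WkT.add {l : Filter ι} {f g : ι → H →L[ℂ] K} {X Y : H →L[ℂ] K} (h : WkT l f X)
    (h' : WkT l g Y) : WkT l (fun i => f i + g i) (X + Y) := by
  intro ξ η hξ hη
  simp only [fl_add hξ hη]
  exact (h ξ η hξ hη).add (h' ξ η hξ hη)

theorem WkT.smul {l : Filter ι} {f : ι → H →L[ℂ] K} {X : H →L[ℂ] K} (c : ℂ) (h : WkT l f X) :
    WkT l (fun i => c • f i) (c • X) := by
  intro ξ η hξ hη
  simp only [fl_smul]
  exact (h ξ η hξ hη).const_mul c

theorem WkT.neg {l : Filter ι} {f : ι → H →L[ℂ] K} {X : H →L[ℂ] K} (h : WkT l f X) :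
    WkT l (fun i => - f i) (-X) := by
  simpa using h.smul (-1)

theorem WkT.sub {l : Filter ι} {f g : ι → H →L[ℂ] K} {X Y : H →L[ℂ] K} (h : WkT l f X)
    (h' : WkT l g Y) : WkT l (fun i => f i - g i) (X - Y) := by
  simpa [sub_eq_add_neg] using h.add h'.neg

theorem SqS.map {ξ : ℕ → H} (hξ : SqS ξ) (A : H →L[ℂ] K) : SqS (fun n => A (ξ n)) := by
  unfold SqS at *
  refine Summable.of_nonneg_of_le (fun n => by positivity) (fun n => ?_) (hξ.mul_left (‖A‖ ^ 2))
  rw [← mul_pow]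
  exact pow_le_pow_left₀ (norm_nonneg _) (A.le_opNorm _) 2

theorem WkT.comp [CompleteSpace K] [CompleteSpace K'] {l : Filter ι} {f : ι → H →L[ℂ] K}
    {X : H →L[ℂ] K} (h : WkT l f X) (B : K →L[ℂ] K') (A : H' →L[ℂ] H) :
    WkT l (fun i => B ∘L f i ∘L A) (B ∘L X ∘L A) := by
  intro ξ η hξ hη
  have := h (fun n => A (ξ n)) (fun n => ContinuousLinearMap.adjoint B (η n)) (hξ.map A)
    (hη.map _)
  simpa [fl, ContinuousLinearMap.adjoint_inner_left] using this

theorem SqS_single (x : H) : SqS (Pi.single 0 x : ℕ → H) := by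
  unfold SqS
  apply summable_of_ne_finset_zero (s := {0})
  intro b hb
  have : b ≠ 0 := by simpa using hb
  simp [this]

theorem fl_single (x : H) (y : K) (T : H →L[ℂ] K) :
    fl (Pi.single 0 x) (Pi.single 0 y) T = ⟪y, T x⟫ := by
  unfold fl
  rw [tsum_eq_single 0]
  · simp
  · intro b hb
    simp [hb]

theorem WkT.wot {l : Filter ι} {f : ι → H →L[ℂ] K} {X : H →L[ℂ] K} (h : WkT l f X) (x : H) (y : K) :
    Tendsto (fun i => (⟪y, f i x⟫ : ℂ)) l (𝓝 ⟪y, X x⟫) := by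
  simpa only [fl_single] using h _ _ (SqS_single x) (SqS_single y)

theorem WkT.unique {l : Filter ι} [l.NeBot] {f : ι → H →L[ℂ] K} {X Y : H →L[ℂ] K} (h : WkT l f X)
    (h' : WkT l f Y) : X = Y := by
  ext x
  refine ext_inner_left ℂ fun y => ?_
  exact tendsto_nhds_unique (h.wot x y) (h'.wot x y)

theorem wkT_of_bdd_wot {l : Filter ι} {f : ι → H →L[ℂ] K} {X : H →L[ℂ] K} {C : ℝ}
    (hb : ∀ᶠ i in l, ‖f i‖ ≤ C)
    (h : ∀ x y, Tendsto (fun i => (⟪y, f i x⟫ : ℂ)) l (𝓝 ⟪y, X x⟫)) : WkT l f X := by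
  intro ξ η hξ hη
  unfold fl
  refine tendsto_tsum_of_dominated_convergence (bound := fun n => C * (‖ξ n‖ ^ 2 + ‖η n‖ ^ 2))
    ((hξ.add hη).mul_left _) (fun n => h _ _) ?_
  filter_upwards [hb] with i hi n
  exact term_bound _ _ _ hi

theorem tendsto_wot_of_dense {l : Filter ι} {f : ι → H →L[ℂ] K} {X : H →L[ℂ] K} {C : ℝ}
    (hb : ∀ᶠ i in l, ‖f i‖ ≤ C) {s : Set H} {t : Set K}
    (hs : (Submodule.span ℂ s).topologicalClosure = ⊤)
    (ht : (Submodule.span ℂ t).topologicalClosure = ⊤)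
    (h : ∀ x ∈ s, ∀ y ∈ t, Tendsto (fun i => (⟪y, f i x⟫ : ℂ)) l (𝓝 ⟪y, X x⟫)) :
    WkT l f X := by
  apply wkT_of_bdd_wot hb
  have h1 : ∀ x ∈ Submodule.span ℂ s, ∀ y ∈ Submodule.span ℂ t,
      Tendsto (fun i => (⟪y, f i x⟫ : ℂ)) l (𝓝 ⟪y, X x⟫) := by
    intro x hx y hy
    induction hx, hy using Submodule.span_induction₂ with
    | mem_mem x y hx hy => exact h x hx y hy
    | zero_left y hy => simpa using tendsto_const_nhds
    | zero_right x hx => simpa using tendsto_const_nhds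
    | add_left x y z _ _ _ h1 h2 => simpa [inner_add_right] using h1.add h2
    | add_right x y z _ _ _ h1 h2 => simpa [inner_add_left] using h1.add h2
    | smul_left r x y _ _ h => simpa [inner_smul_right] using h.const_mul r
    | smul_right r x y _ _ h =>
      simpa [inner_smul_left, mul_comm] using h.const_mul ((starRingEnd ℂ) r)
  intro x y
  rcases l.eq_or_neBot with rfl | hl
  · exact tendsto_bot
  have hC : 0 ≤ C := by
    obtain ⟨i, hi⟩ := hb.exists
    exact (norm_nonneg _).trans hi
  rw [Metric.tendsto_nhds]
  intro ε hε
  set D := C + ‖X‖ + 1 with hD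
  have hD0 : 0 < D := by positivity
  obtain ⟨δ, hδ, hδ'⟩ : ∃ δ > 0, δ * (2 * D * (‖x‖ + ‖y‖ + 1)) < ε / 2 := by
    refine ⟨ε / 4 / (2 * D * (‖x‖ + ‖y‖ + 1)), by positivity, ?_⟩
    rw [div_mul_cancel₀ _ (by positivity)]
    linarith
  obtain ⟨x', hx', hxx⟩ : ∃ x' ∈ Submodule.span ℂ s, dist x x' < min δ 1 := by
    have : x ∈ (Submodule.span ℂ s).topologicalClosure := by rw [hs]; trivial
    exact Metric.mem_closure_iff.1 this _ (by positivity)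
  obtain ⟨y', hy', hyy⟩ : ∃ y' ∈ Submodule.span ℂ t, dist y y' < min δ 1 := by
    have : y ∈ (Submodule.span ℂ t).topologicalClosure := by rw [ht]; trivial
    exact Metric.mem_closure_iff.1 this _ (by positivity)
  rw [dist_eq_norm] at hxx hyy
  have key : ∀ T : H →L[ℂ] K, ‖T‖ ≤ D → ‖(⟪y, T x⟫ : ℂ) - ⟪y', T x'⟫‖ ≤ δ * (D * (‖x‖ + ‖y‖ + 1)) := by
    intro T hT
    have e : (⟪y, T x⟫ : ℂ) - ⟪y', T x'⟫ = ⟪y - y', T x⟫ + ⟪y', T (x - x')⟫ := by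
      simp [inner_sub_left, inner_sub_right]
    have hy'' : ‖y'‖ ≤ ‖y‖ + 1 := by
      have := norm_sub_norm_le y' y
      rw [norm_sub_rev] at this
      linarith [hyy.le, min_le_right δ 1]
    rw [e]
    have a1 : ‖(⟪y - y', T x⟫ : ℂ)‖ ≤ δ * (D * ‖x‖) := by
      refine (norm_inner_le_norm _ _).trans ?_
      gcongr
      · exact hyy.le.trans (min_le_left _ _)
      · exact T.le_of_opNorm_le hT x
    have a2 : ‖(⟪y', T (x - x')⟫ : ℂ)‖ ≤ (‖y‖ + 1) * (D * δ) := by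
      refine (norm_inner_le_norm _ _).trans ?_
      gcongr
      refine (T.le_of_opNorm_le hT _).trans ?_
      gcongr
      exact hxx.le.trans (min_le_left _ _)
    refine (norm_add_le _ _).trans ((add_le_add a1 a2).trans (le_of_eq ?_))
    ring
  filter_upwards [hb, Metric.tendsto_nhds.1 (h1 x' hx' y' hy') (ε / 2) (by positivity)] with i hi hi'
  rw [dist_eq_norm] at *
  have k1 := key (f i) (by linarith [norm_nonneg X])
  have k2 := key X (by linarith)
  have e : (⟪y, f i x⟫ : ℂ) - ⟪y, X x⟫ = (⟪y, f i x⟫ - ⟪y', f i x'⟫) - (⟪y, X x⟫ - ⟪y', X x'⟫)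
      + (⟪y', f i x'⟫ - ⟪y', X x'⟫) := by ring
  rw [e]
  refine (norm_add_le _ _).trans_lt ?_
  have := norm_sub_le ((⟪y, f i x⟫ : ℂ) - ⟪y', f i x'⟫) (⟪y, X x⟫ - ⟪y', X x'⟫)
  linarith

theorem exists_ultra_lim [CompleteSpace K] (F : Ultrafilter ι) (f : ι → H →L[ℂ] K) {C : ℝ}
    (hC : 0 ≤ C) (hb : ∀ i, ‖f i‖ ≤ C) : ∃ X : H →L[ℂ] K, ‖X‖ ≤ C ∧ WkT (F : Filter ι) f X := by
  have hlim : ∀ x y, ∃ z : ℂ, Tendsto (fun i => (⟪f i x, y⟫ : ℂ)) F (𝓝 z) ∧ ‖z‖ ≤ C * ‖x‖ * ‖y‖ := by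
    intro x y
    have hc : IsCompact (Metric.closedBall (0 : ℂ) (C * ‖x‖ * ‖y‖)) := isCompact_closedBall _ _
    have hm : ∀ i, (⟪f i x, y⟫ : ℂ) ∈ Metric.closedBall (0 : ℂ) (C * ‖x‖ * ‖y‖) := by
      intro i
      rw [mem_closedBall_zero_iff]
      refine (norm_inner_le_norm _ _).trans ?_
      gcongr
      exact (f i).le_of_opNorm_le (hb i) x
    rw [isCompact_iff_ultrafilter_le_nhds] at hc
    obtain ⟨z, hz, hz'⟩ := hc (F.map fun i => (⟪f i x, y⟫ : ℂ)) (by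
      rw [le_principal_iff]
      exact Filter.mem_map.2 (Filter.Eventually.of_forall hm))
    exact ⟨z, hz', by simpa using hz⟩
  choose b hb1 hb2 using hlim
  have hadd1 : ∀ x x' y, b (x + x') y = b x y + b x' y := by
    intro x x' y
    refine tendsto_nhds_unique (hb1 _ _) ?_
    simpa [inner_add_left] using (hb1 x y).add (hb1 x' y)
  have hadd2 : ∀ x y y', b x (y + y') = b x y + b x y' := by
    intro x x' y
    refine tendsto_nhds_unique (hb1 _ _) ?_
    simpa [inner_add_right] using (hb1 x x').add (hb1 x y)
  have hsm1 : ∀ (c : ℂ) x y, b (c • x) y = (starRingEnd ℂ) c * b x y := by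
    intro c x y
    refine tendsto_nhds_unique (hb1 _ _) ?_
    simpa [inner_smul_left, mul_comm] using (hb1 x y).const_mul ((starRingEnd ℂ) c)
  have hsm2 : ∀ (c : ℂ) x y, b x (c • y) = c * b x y := by
    intro c x y
    refine tendsto_nhds_unique (hb1 _ _) ?_
    simpa [inner_smul_right] using (hb1 x y).const_mul c
  let L : H → (K →L[ℂ] ℂ) := fun x => LinearMap.mkContinuous
    { toFun := b x, map_add' := hadd2 x, map_smul' := fun c y => hsm2 c x y } (C * ‖x‖) (hb2 x)
  let X : H →L[ℂ] K := LinearMap.mkContinuous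
    { toFun := fun x => (InnerProductSpace.toDual ℂ K).symm (L x)
      map_add' := by
        intro x x'
        rw [← map_add]
        congr 1
        ext y
        exact hadd1 x x' y
      map_smul' := by
        intro c x
        rw [LinearIsometryEquiv.symm_apply_eq, RingHom.id_apply, map_smulₛₗ,
          LinearIsometryEquiv.apply_symm_apply]
        ext y
        exact hsm1 c x y } C (by
      intro x
      simp only [LinearMap.coe_mk, AddHom.coe_mk, LinearIsometryEquiv.norm_map]
      exact LinearMap.mkContinuous_norm_le _ (by positivity) _)
  refine ⟨X, LinearMap.mkContinuous_norm_le _ hC _, ?_⟩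
  apply wkT_of_bdd_wot (Filter.Eventually.of_forall hb)
  intro x y
  have hX : (⟪X x, y⟫ : ℂ) = b x y := by
    exact InnerProductSpace.toDual_symm_apply
  have := hb1 x y
  rw [← hX] at this
  have := (Complex.continuous_conj.tendsto _).comp this
  simpa [Function.comp_def, inner_conj_symm] using this

def wkcl (S : Submodule ℂ (H →L[ℂ] K)) : Submodule ℂ (H →L[ℂ] K) where
  carrier := wkClosure S
  zero_mem' := subset_wkClosure _ S.zero_mem
  add_mem' := by
    intro X Y hX hY
    obtain ⟨F, h1, h2, h3⟩ := mem_wkClosure.1 hX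
    obtain ⟨G, g1, g2, g3⟩ := mem_wkClosure.1 hY
    have := (h3.comp' (tendsto_fst (f := F) (g := G))).add (g3.comp' (tendsto_snd (f := F) (g := G)))
    refine mem_wkClosure_of this ?_
    filter_upwards [prod_mem_prod h2 g2] with p hp
    exact S.add_mem hp.1 hp.2
  smul_mem' := by
    intro c X hX
    obtain ⟨F, h1, h2, h3⟩ := mem_wkClosure.1 hX
    refine mem_wkClosure_of (h3.smul c) ?_
    filter_upwards [h2] with p hp
    exact S.smul_mem c hp

@[simp] theorem coe_wkcl (S : Submodule ℂ (H →L[ℂ] K)) : (wkcl S : Set (H →L[ℂ] K)) = wkClosure S := rfl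

theorem mem_wkcl {S : Submodule ℂ (H →L[ℂ] K)} {X} : X ∈ wkcl S ↔ X ∈ wkClosure (S : Set (H →L[ℂ] K)) :=
  Iff.rfl

theorem le_wkcl (S : Submodule ℂ (H →L[ℂ] K)) : S ≤ wkcl S := subset_wkClosure _

theorem wkcl_closed (S : Submodule ℂ (H →L[ℂ] K)) : WkClosed (wkcl S : Set (H →L[ℂ] K)) :=
  wkClosed_wkClosure _

theorem wkcl_mono {S S' : Submodule ℂ (H →L[ℂ] K)} (h : S ≤ S') : wkcl S ≤ wkcl S' :=
  wkClosure_mono h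

theorem wkcl_min {S S' : Submodule ℂ (H →L[ℂ] K)} (h : S ≤ S') (h' : WkClosed (S' : Set (H →L[ℂ] K))) :
    wkcl S ≤ S' := wkClosure_min h h'

theorem wkcl_idem (S : Submodule ℂ (H →L[ℂ] K)) : wkcl (wkcl S) = wkcl S :=
  le_antisymm (wkcl_min le_rfl (wkcl_closed S)) (le_wkcl _)

/-- weak-* continuity expressed with filters -/
def WkC (Φ : (H →L[ℂ] K) → (H' →L[ℂ] K')) : Prop :=
  ∀ (F : Filter (H →L[ℂ] K)) X, WkT F id X → WkT F Φ (Φ X)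

theorem WkC.mem_closure {Φ : (H →L[ℂ] K) → (H' →L[ℂ] K')} (h : WkC Φ) {S : Set (H →L[ℂ] K)}
    {Z : Set (H' →L[ℂ] K')} (hS : ∀ X ∈ S, Φ X ∈ Z) (hZ : WkClosed Z) {X : H →L[ℂ] K}
    (hX : X ∈ wkClosure S) : Φ X ∈ Z := by
  obtain ⟨F, h1, h2, h3⟩ := mem_wkClosure.1 hX
  refine hZ.mem_of (h F X h3) ?_
  filter_upwards [h2] with X hX using hS X hX

theorem WkC.preimage_closed {Φ : (H →L[ℂ] K) → (H' →L[ℂ] K')} (h : WkC Φ)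
    {Z : Set (H' →L[ℂ] K')} (hZ : WkClosed Z) : WkClosed (Φ ⁻¹' Z) := by
  apply wkClosed_of
  intro F X h1 h2 h3
  exact hZ.mem_of (h F X h3) h2

theorem WkC.comp_tendsto {Φ : (H →L[ℂ] K) → (H' →L[ℂ] K')} (h : WkC Φ) {l : Filter ι} {f : ι → H →L[ℂ] K}
    {X : H →L[ℂ] K} (hf : WkT l f X) : WkT l (fun i => Φ (f i)) (Φ X) := by
  have : WkT (l.map f) id X := by
    rw [wkT_iff] at *
    exact hf
  have := h _ _ this
  rw [wkT_iff] at *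
  exact this

theorem wkC_comp [CompleteSpace K] [CompleteSpace K'] (B : K →L[ℂ] K') (A : H' →L[ℂ] H) :
    WkC (fun X : H →L[ℂ] K => B ∘L X ∘L A) := fun _ _ h => h.comp B A

theorem wkClosed_singleton_zero : WkClosed ({0} : Set (H →L[ℂ] K)) := by
  apply wkClosed_of
  intro F X h1 h2 h3
  refine (WkT.unique (X := X) (l := F) (f := fun _ => 0) ?_ (WkT.const _ 0))
  intro ξ η hξ hη
  refine (h3 ξ η hξ hη).congr' ?_
  filter_upwards [h2] with Y hY
  simp at hY
  simp [hY]

theorem wkT_of_norm {l : Filter ι} {f : ι → H →L[ℂ] K} {X : H →L[ℂ] K} (h : Tendsto f l (𝓝 X)) :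
    WkT l f X := by
  have hb : ∀ᶠ i in l, ‖f i‖ ≤ ‖X‖ + 1 := by
    filter_upwards [h.norm.eventually (gt_mem_nhds (lt_add_one ‖X‖))] with i hi using hi.le
  apply wkT_of_bdd_wot hb
  intro x y
  have h2 : Tendsto (fun i => f i x) l (𝓝 (X x)) :=
    ((ContinuousLinearMap.apply ℂ K x).continuous.tendsto X).comp h
  exact tendsto_const_nhds.inner h2

end A
end OSX

namespace OSX
open Filter Topology
open scoped TensorProduct InnerProduct
section B0
variable {ι H H' K K' : Type*}
  [NormedAddCommGroup H] [InnerProductSpace ℂ H]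
  [NormedAddCommGroup H'] [InnerProductSpace ℂ H']
  [NormedAddCommGroup K] [InnerProductSpace ℂ K]
  [NormedAddCommGroup K'] [InnerProductSpace ℂ K']

theorem norm_eq_of_inner {z : H} {w : K} (h : (⟪z, z⟫ : ℂ) = ⟪w, w⟫) : ‖z‖ = ‖w‖ := by
  simp only [inner_self_eq_norm_sq_to_K] at h
  have h' : ‖z‖ ^ 2 = ‖w‖ ^ 2 := by exact_mod_cast h
  exact (sq_eq_sq₀ (norm_nonneg _) (norm_nonneg _)).1 h'

theorem norm_sq_of_inner {z : H} {w : K} {u : H'} {r : ℝ}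
    (h : (⟪z, z⟫ : ℂ) + ⟪w, w⟫ = r * ⟪u, u⟫) : ‖z‖ ^ 2 + ‖w‖ ^ 2 = r * ‖u‖ ^ 2 := by
  simp only [inner_self_eq_norm_sq_to_K] at h
  have h2 : ((‖z‖ ^ 2 + ‖w‖ ^ 2 : ℝ) : ℂ) = ((r * ‖u‖ ^ 2 : ℝ) : ℂ) := by
    push_cast
    exact h
  exact Complex.ofReal_injective h2

theorem exists_defect [CompleteSpace H] [CompleteSpace H'] (S : H →L[ℂ] H') :
    ∃ c : H →L[ℂ] H, ∀ x x', (⟪S x, S x'⟫ : ℂ) + ⟪c x, c x'⟫ = (‖S‖ ^ 2 : ℝ) * ⟪x, x'⟫ := by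
  have hpos : (0 : H →L[ℂ] H) ≤ ((‖S‖ ^ 2 : ℝ) : ℂ) • (1 : H →L[ℂ] H) - S† ∘L S := by
    rw [ContinuousLinearMap.nonneg_iff_isPositive]
    refine ⟨?_, ?_⟩
    · intro x y
      simp only [ContinuousLinearMap.coe_coe, ContinuousLinearMap.sub_apply, ContinuousLinearMap.smul_apply, ContinuousLinearMap.one_apply,
        ContinuousLinearMap.comp_apply, inner_sub_left, inner_sub_right, inner_smul_left,
        inner_smul_right, Complex.conj_ofReal, ContinuousLinearMap.adjoint_inner_left,
        ContinuousLinearMap.adjoint_inner_right]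
    · intro x
      simp only [ContinuousLinearMap.reApplyInnerSelf_apply, ContinuousLinearMap.sub_apply, ContinuousLinearMap.smul_apply, ContinuousLinearMap.one_apply,
        ContinuousLinearMap.comp_apply, inner_sub_left, inner_smul_left, Complex.conj_ofReal, ContinuousLinearMap.adjoint_inner_left, inner_self_eq_norm_sq_to_K]
      have := S.le_opNorm x
      have h2 := pow_le_pow_left₀ (norm_nonneg _) this 2
      rw [mul_pow] at h2
      have e : RCLike.re (((‖S‖ ^ 2 : ℝ) : ℂ) * (‖x‖ : ℂ) ^ 2 - (‖S x‖ : ℂ) ^ 2) = ‖S‖ ^ 2 * ‖x‖ ^ 2 - ‖S x‖ ^ 2 := by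
        have : ((‖S‖ ^ 2 : ℝ) : ℂ) * (‖x‖ : ℂ) ^ 2 - (‖S x‖ : ℂ) ^ 2 = ((‖S‖ ^ 2 * ‖x‖ ^ 2 - ‖S x‖ ^ 2 : ℝ) : ℂ) := by
          push_cast; ring
        rw [this]; exact Complex.ofReal_re _
      refine le_of_le_of_eq ?_ e.symm
      linarith
  obtain ⟨c, hc⟩ := CStarAlgebra.nonneg_iff_eq_star_mul_self.1 hpos
  refine ⟨c, fun x x' => ?_⟩
  have : (⟪c x, c x'⟫ : ℂ) = ⟪x, (star c * c) x'⟫ := by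
    rw [ContinuousLinearMap.mul_apply, ContinuousLinearMap.star_eq_adjoint,
      ContinuousLinearMap.adjoint_inner_right]
  rw [this, ← hc]
  simp [inner_sub_right, inner_smul_right, ContinuousLinearMap.adjoint_inner_right]

theorem map_bound_left [CompleteSpace H] [CompleteSpace H'] (S : H →L[ℂ] H') (z : H ⊗[ℂ] K) :
    ‖TensorProduct.map (S : H →ₗ[ℂ] H') (LinearMap.id : K →ₗ[ℂ] K) z‖ ≤ ‖S‖ * ‖z‖ := by
  obtain ⟨c, hc⟩ := exists_defect S
  have key : ∀ z w : H ⊗[ℂ] K,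
      (⟪TensorProduct.map (S : H →ₗ[ℂ] H') (LinearMap.id : K →ₗ[ℂ] K) z,
        TensorProduct.map (S : H →ₗ[ℂ] H') (LinearMap.id : K →ₗ[ℂ] K) w⟫ : ℂ) +
      ⟪TensorProduct.map (c : H →ₗ[ℂ] H) (LinearMap.id : K →ₗ[ℂ] K) z,
        TensorProduct.map (c : H →ₗ[ℂ] H) (LinearMap.id : K →ₗ[ℂ] K) w⟫ = (‖S‖ ^ 2 : ℝ) * ⟪z, w⟫ := by
    intro z w
    induction z using TensorProduct.induction_on with
    | zero => simp
    | add z z' h h' =>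
      simp only [map_add, inner_add_left, mul_add]
      rw [← h, ← h']; ring
    | tmul x y =>
      induction w using TensorProduct.induction_on with
      | zero => simp
      | add z z' h h' =>
        simp only [map_add, inner_add_right, mul_add]
        rw [← h, ← h']; ring
      | tmul x' y' =>
        simp only [TensorProduct.map_tmul, TensorProduct.inner_tmul, LinearMap.id_apply, ContinuousLinearMap.coe_coe]
        rw [← mul_assoc, ← hc, add_mul]
  have h := key z z
  have h' : ‖TensorProduct.map (S : H →ₗ[ℂ] H') (LinearMap.id : K →ₗ[ℂ] K) z‖ ^ 2 + ‖TensorProduct.map (c : H →ₗ[ℂ] H) (LinearMap.id : K →ₗ[ℂ] K) z‖ ^ 2 = ‖S‖ ^ 2 * ‖z‖ ^ 2 :=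
    norm_sq_of_inner h
  apply abs_le_of_sq_le_sq' _ (by positivity) |>.2
  rw [mul_pow]
  nlinarith [sq_nonneg ‖TensorProduct.map (c : H →ₗ[ℂ] H) (LinearMap.id : K →ₗ[ℂ] K) z‖]

theorem norm_comm' (z : H ⊗[ℂ] K) : ‖TensorProduct.comm ℂ H K z‖ = ‖z‖ := by
  have key : ∀ z w : H ⊗[ℂ] K, (⟪TensorProduct.comm ℂ H K z, TensorProduct.comm ℂ H K w⟫ : ℂ) = ⟪z, w⟫ := by
    intro z w
    induction z using TensorProduct.induction_on with
    | zero => simp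
    | add z z' h h' => simp only [map_add, inner_add_left, h, h']
    | tmul x y =>
      induction w using TensorProduct.induction_on with
      | zero => simp
      | add z z' h h' => simp only [map_add, inner_add_right, h, h']
      | tmul x' y' => simp [mul_comm]
  exact norm_eq_of_inner (key z z)

theorem map_bound [CompleteSpace H] [CompleteSpace H'] [CompleteSpace K] [CompleteSpace K']
    (S : H →L[ℂ] H') (R : K →L[ℂ] K') (z : H ⊗[ℂ] K) :
    ‖TensorProduct.map (S : H →ₗ[ℂ] H') (R : K →ₗ[ℂ] K') z‖ ≤ ‖S‖ * ‖R‖ * ‖z‖ := by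
  have e : TensorProduct.map (S : H →ₗ[ℂ] H') (R : K →ₗ[ℂ] K') z =
      TensorProduct.map (S : H →ₗ[ℂ] H') (LinearMap.id : K' →ₗ[ℂ] K')
        ((TensorProduct.comm ℂ H K').symm (TensorProduct.map (R : K →ₗ[ℂ] K') (LinearMap.id : H →ₗ[ℂ] H)
          (TensorProduct.comm ℂ H K z))) := by
    induction z using TensorProduct.induction_on with
    | zero => simp
    | add z z' h h' => simp only [map_add, h, h']
    | tmul x y => simp
  rw [e]
  refine (map_bound_left S _).trans ?_
  rw [mul_assoc]
  gcongr
  rw [← norm_comm', LinearEquiv.apply_symm_apply]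
  refine (map_bound_left R _).trans ?_
  rw [norm_comm']

theorem WkT.gen {l : Filter ι} {f : ι → H →L[ℂ] K} {X : H →L[ℂ] K} (h : WkT l f X)
    {I : Type*} (ξ : I → H) (η : I → K) (hξ : Summable fun i => ‖ξ i‖ ^ 2)
    (hη : Summable fun i => ‖η i‖ ^ 2) :
    Tendsto (fun i => ∑' n, (⟪η n, f i (ξ n)⟫ : ℂ)) l (𝓝 (∑' n, (⟪η n, X (ξ n)⟫ : ℂ))) := by
  have hc : (Function.support fun i => ‖ξ i‖ ^ 2).Countable := hξ.countable_support
  set s := Function.support fun i => ‖ξ i‖ ^ 2 with hs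
  haveI : Countable s := hc
  obtain ⟨g, hg⟩ := exists_injective_nat s
  have key : ∀ T : H →L[ℂ] K, ∑' n, (⟪η n, T (ξ n)⟫ : ℂ) =
      fl (Function.extend g (fun i : s => ξ i) 0) (Function.extend g (fun i : s => η i) 0) T := by
    intro T
    unfold fl
    have e1 : ∑' n, (⟪η n, T (ξ n)⟫ : ℂ) = ∑' n : s, (⟪η n, T (ξ n)⟫ : ℂ) := by
      symm
      apply tsum_subtype_eq_of_support_subset (f := fun n => (⟪η n, T (ξ n)⟫ : ℂ))
      intro i hi
      simp only [Function.mem_support] at hi ⊢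
      intro h0
      apply hi
      have : ξ i = 0 := by simpa using h0
      simp [this]
    rw [e1, ← hg.tsum_eq]
    · apply tsum_congr
      intro i
      rw [hg.extend_apply, hg.extend_apply]
    · intro n hn
      by_contra hne
      apply hn
      simp only []
      rw [Function.extend_apply' _ _ _ (by simpa using hne)]
      simp
  simp only [key]
  have aux : ∀ {E : Type _} [NormedAddCommGroup E] (u : I → E), (Summable fun i => ‖u i‖ ^ 2) →
      Summable fun n => ‖Function.extend g (fun i : s => u i) 0 n‖ ^ 2 := by
    intro E _ u hu
    have : (fun n => ‖Function.extend g (fun i : s => u i) 0 n‖ ^ 2) =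
        Function.extend g (fun i : s => ‖u i‖ ^ 2) 0 := by
      ext n
      by_cases hn : ∃ a, g a = n
      · obtain ⟨a, rfl⟩ := hn
        rw [hg.extend_apply, hg.extend_apply]
      · rw [Function.extend_apply' _ _ _ hn, Function.extend_apply' _ _ _ hn]
        simp
    rw [this]
    rw [summable_extend_zero hg]
    exact hu.subtype s
  have aux2 : ∀ {E : Type _} [NormedAddCommGroup E] (u : I → E), (Summable fun i => ‖u i‖ ^ 2) →
      Summable fun n => ‖Function.extend g (fun i : s => u i) 0 n‖ ^ 2 := by
    intro E _ u hu
    have : (fun n => ‖Function.extend g (fun i : s => u i) 0 n‖ ^ 2) =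
        Function.extend g (fun i : s => ‖u i‖ ^ 2) 0 := by
      ext n
      by_cases hn : ∃ a, g a = n
      · obtain ⟨a, rfl⟩ := hn
        rw [hg.extend_apply, hg.extend_apply]
      · rw [Function.extend_apply' _ _ _ hn, Function.extend_apply' _ _ _ hn]
        simp
    rw [this]
    rw [summable_extend_zero hg]
    exact hu.subtype s
  exact h _ _ (aux ξ hξ) (aux2 η hη)

end B0

section B1
variable {H K T : Type*}
  [NormedAddCommGroup H] [InnerProductSpace ℂ H]
  [NormedAddCommGroup K] [InnerProductSpace ℂ K]
  [NormedAddCommGroup T] [InnerProductSpace ℂ T]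
  {t : H → K → T} (ht : IsTensorEmbedding t)
include ht

theorem t_inner (x x' : H) (y y' : K) : (⟪t x y, t x' y'⟫ : ℂ) = ⟪x, x'⟫ * ⟪y, y'⟫ := ht.2.2.2.2.1 _ _ _ _

theorem t_norm (x : H) (y : K) : ‖t x y‖ = ‖x‖ * ‖y‖ := by
  have h := t_inner ht x x y y
  simp only [inner_self_eq_norm_sq_to_K] at h
  have h' : ‖t x y‖ ^ 2 = (‖x‖ * ‖y‖) ^ 2 := by rw [mul_pow]; exact_mod_cast h
  exact (sq_eq_sq₀ (norm_nonneg _) (by positivity)).1 h'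

omit ht in
def tauL (ht : IsTensorEmbedding t) (x : H) : K →L[ℂ] T :=
  LinearMap.mkContinuous
    { toFun := fun y => t x y, map_add' := ht.2.1 x, map_smul' := fun c y => ht.2.2.2.1 c x y }
    ‖x‖ (fun y => (t_norm ht x y).le)

omit ht in
def tauR (ht : IsTensorEmbedding t) (y : K) : H →L[ℂ] T :=
  LinearMap.mkContinuous
    { toFun := fun x => t x y, map_add' := fun x x' => ht.1 x x' y,
      map_smul' := fun c x => ht.2.2.1 c x y }
    ‖y‖ (fun x => (t_norm ht x y).le.trans (by rw [mul_comm]))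

@[simp] theorem tauL_apply (x : H) (y : K) : tauL ht x y = t x y := rfl
@[simp] theorem tauR_apply (x : H) (y : K) : tauR ht y x = t x y := rfl

omit ht in
def tJ (ht : IsTensorEmbedding t) : H ⊗[ℂ] K →ₗ[ℂ] T :=
  TensorProduct.lift (LinearMap.mk₂ ℂ t ht.1 ht.2.2.1 ht.2.1 ht.2.2.2.1)

@[simp] theorem tJ_tmul (x : H) (y : K) : tJ ht (x ⊗ₜ y) = t x y := by simp [tJ]

theorem tJ_norm (z : H ⊗[ℂ] K) : ‖tJ ht z‖ = ‖z‖ := by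
  have key : ∀ z w : H ⊗[ℂ] K, (⟪tJ ht z, tJ ht w⟫ : ℂ) = ⟪z, w⟫ := by
    intro z w
    induction z using TensorProduct.induction_on with
    | zero => simp
    | add z z' h h' => simp only [map_add, inner_add_left, h, h']
    | tmul x y =>
      induction w using TensorProduct.induction_on with
      | zero => simp
      | add z z' h h' => simp only [map_add, inner_add_right, h, h']
      | tmul x' y' => simp [t_inner ht]
  exact norm_eq_of_inner (key z z)

theorem tJ_dense : DenseRange (tJ ht) := by
  intro z
  have : z ∈ (Submodule.span ℂ { z | ∃ x y, z = t x y }).topologicalClosure := by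
    rw [ht.2.2.2.2.2]; trivial
  refine closure_mono ?_ this
  intro w hw
  have : Submodule.span ℂ { z | ∃ x y, z = t x y } ≤ LinearMap.range (tJ ht) := by
    rw [Submodule.span_le]
    rintro _ ⟨x, y, rfl⟩
    exact ⟨x ⊗ₜ y, by simp⟩
  exact this hw

theorem ext_t {E : Type*} [NormedAddCommGroup E] [NormedSpace ℂ E] {A B : T →L[ℂ] E}
    (h : ∀ x y, A (t x y) = B (t x y)) : A = B := by
  apply ContinuousLinearMap.ext_on (s := { z | ∃ x y, z = t x y })
  · rw [dense_iff_closure_eq]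
    have := ht.2.2.2.2.2
    rw [← Submodule.topologicalClosure_coe, this]; rfl
  · rintro _ ⟨x, y, rfl⟩
    exact h x y

theorem ext_t_inner {z w : T} (h : ∀ x y, (⟪t x y, z⟫ : ℂ) = ⟪t x y, w⟫) : z = w := by
  have : innerSL ℂ z = innerSL ℂ w := by
    apply ext_t ht
    intro x y
    simp only [innerSL_apply_apply]
    rw [← inner_conj_symm, h, inner_conj_symm]
  refine ext_inner_right ℂ fun v => ?_
  exact congrArg (fun φ => φ v) this

end B1

section B2
variable {H₁ H₂ H₃ K₁ K₂ K₃ T₁ T₂ T₃ : Type*}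
  [NormedAddCommGroup H₁] [InnerProductSpace ℂ H₁] [CompleteSpace H₁]
  [NormedAddCommGroup H₂] [InnerProductSpace ℂ H₂] [CompleteSpace H₂]
  [NormedAddCommGroup H₃] [InnerProductSpace ℂ H₃] [CompleteSpace H₃]
  [NormedAddCommGroup K₁] [InnerProductSpace ℂ K₁] [CompleteSpace K₁]
  [NormedAddCommGroup K₂] [InnerProductSpace ℂ K₂] [CompleteSpace K₂]
  [NormedAddCommGroup K₃] [InnerProductSpace ℂ K₃] [CompleteSpace K₃]
  [NormedAddCommGroup T₁] [InnerProductSpace ℂ T₁] [CompleteSpace T₁]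
  [NormedAddCommGroup T₂] [InnerProductSpace ℂ T₂] [CompleteSpace T₂]
  [NormedAddCommGroup T₃] [InnerProductSpace ℂ T₃] [CompleteSpace T₃]
  {t₁ : H₁ → K₁ → T₁} {t₂ : H₂ → K₂ → T₂} {t₃ : H₃ → K₃ → T₃}
  (ht₁ : IsTensorEmbedding t₁) (ht₂ : IsTensorEmbedding t₂) (ht₃ : IsTensorEmbedding t₃)

theorem tens_bd (S : H₁ →L[ℂ] H₂) (R : K₁ →L[ℂ] K₂) (z : H₁ ⊗[ℂ] K₁) :
    ‖(tJ ht₂ ∘ₗ TensorProduct.map (S : H₁ →ₗ[ℂ] H₂) (R : K₁ →ₗ[ℂ] K₂)) z‖ ≤ (‖S‖ * ‖R‖) * ‖tJ ht₁ z‖ := by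
  rw [LinearMap.comp_apply, tJ_norm, tJ_norm]; exact map_bound S R z

def tens (S : H₁ →L[ℂ] H₂) (R : K₁ →L[ℂ] K₂) : T₁ →L[ℂ] T₂ :=
  (tJ ht₂ ∘ₗ TensorProduct.map (S : H₁ →ₗ[ℂ] H₂) (R : K₁ →ₗ[ℂ] K₂)).extendOfNorm (tJ ht₁)

theorem tens_apply (S : H₁ →L[ℂ] H₂) (R : K₁ →L[ℂ] K₂) (x : H₁) (y : K₁) :
    tens ht₁ ht₂ S R (t₁ x y) = t₂ (S x) (R y) := by
  unfold tens
  rw [← tJ_tmul ht₁, LinearMap.extendOfNorm_eq (tJ_dense ht₁) ⟨_, tens_bd ht₁ ht₂ S R⟩]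
  simp

theorem tens_norm_le (S : H₁ →L[ℂ] H₂) (R : K₁ →L[ℂ] K₂) : ‖tens ht₁ ht₂ S R‖ ≤ ‖S‖ * ‖R‖ :=
  LinearMap.opNorm_extendOfNorm_le (tJ_dense ht₁) (by positivity) (tens_bd ht₁ ht₂ S R)

theorem tens_elem (S : H₁ →L[ℂ] H₂) (R : K₁ →L[ℂ] K₂) : IsElemTensor t₁ t₂ (tens ht₁ ht₂ S R) S R :=
  tens_apply ht₁ ht₂ S R

theorem elem_unique {S : H₁ →L[ℂ] H₂} {R : K₁ →L[ℂ] K₂} {W : T₁ →L[ℂ] T₂}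
    (h : IsElemTensor t₁ t₂ W S R) : W = tens ht₁ ht₂ S R :=
  ext_t ht₁ fun x y => by rw [h, tens_apply]

theorem tens_add_left (S S' : H₁ →L[ℂ] H₂) (R : K₁ →L[ℂ] K₂) :
    tens ht₁ ht₂ (S + S') R = tens ht₁ ht₂ S R + tens ht₁ ht₂ S' R :=
  ext_t ht₁ fun x y => by simp [tens_apply, ht₂.1]

theorem tens_add_right (S : H₁ →L[ℂ] H₂) (R R' : K₁ →L[ℂ] K₂) :
    tens ht₁ ht₂ S (R + R') = tens ht₁ ht₂ S R + tens ht₁ ht₂ S R' :=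
  ext_t ht₁ fun x y => by simp [tens_apply, ht₂.2.1]

theorem tens_smul_left (c : ℂ) (S : H₁ →L[ℂ] H₂) (R : K₁ →L[ℂ] K₂) :
    tens ht₁ ht₂ (c • S) R = c • tens ht₁ ht₂ S R :=
  ext_t ht₁ fun x y => by simp [tens_apply, ht₂.2.2.1]

theorem tens_smul_right (c : ℂ) (S : H₁ →L[ℂ] H₂) (R : K₁ →L[ℂ] K₂) :
    tens ht₁ ht₂ S (c • R) = c • tens ht₁ ht₂ S R :=
  ext_t ht₁ fun x y => by simp [tens_apply, ht₂.2.2.2.1]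

theorem tens_comp (S : H₁ →L[ℂ] H₂) (R : K₁ →L[ℂ] K₂) (S' : H₂ →L[ℂ] H₃) (R' : K₂ →L[ℂ] K₃) :
    tens ht₂ ht₃ S' R' ∘L tens ht₁ ht₂ S R = tens ht₁ ht₃ (S' ∘L S) (R' ∘L R) :=
  ext_t ht₁ fun x y => by simp [tens_apply]

theorem tens_adjoint (S : H₁ →L[ℂ] H₂) (R : K₁ →L[ℂ] K₂) :
    (tens ht₁ ht₂ S R)† = tens ht₂ ht₁ (S†) (R†) := by
  apply ext_t ht₂
  intro x y
  apply ext_t_inner ht₁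
  intro x' y'
  rw [ContinuousLinearMap.adjoint_inner_right, tens_apply, tens_apply, t_inner ht₂, t_inner ht₁,
    ContinuousLinearMap.adjoint_inner_right, ContinuousLinearMap.adjoint_inner_right]

def amp (S : H₁ →L[ℂ] H₁) : T₁ →L[ℂ] T₁ := tens ht₁ ht₁ S 1

theorem amp_apply (S : H₁ →L[ℂ] H₁) (x y) : amp ht₁ S (t₁ x y) = t₁ (S x) y := tens_apply ht₁ ht₁ S 1 x y

theorem amp_norm_le (S : H₁ →L[ℂ] H₁) : ‖amp ht₁ S‖ ≤ ‖S‖ := by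
  refine (tens_norm_le _ _ _ _).trans ?_
  calc ‖S‖ * ‖(1 : K₁ →L[ℂ] K₁)‖ ≤ ‖S‖ * 1 := by
        gcongr
        exact ContinuousLinearMap.norm_id_le
    _ = ‖S‖ := mul_one _

theorem amp_mul (S S' : H₁ →L[ℂ] H₁) : amp ht₁ (S * S') = amp ht₁ S * amp ht₁ S' :=
  ext_t ht₁ fun x y => by simp [amp_apply]

@[simp] theorem amp_one : amp ht₁ 1 = 1 := ext_t ht₁ fun x y => by simp [amp_apply]

@[simp] theorem amp_zero : amp ht₁ 0 = 0 := ext_t ht₁ fun x y => by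
  rw [amp_apply]; exact (tauR ht₁ y).map_zero

theorem amp_add (S S' : H₁ →L[ℂ] H₁) : amp ht₁ (S + S') = amp ht₁ S + amp ht₁ S' :=
  tens_add_left _ _ _ _ _

theorem amp_smul (c : ℂ) (S : H₁ →L[ℂ] H₁) : amp ht₁ (c • S) = c • amp ht₁ S :=
  tens_smul_left _ _ _ _ _

theorem amp_sub (S S' : H₁ →L[ℂ] H₁) : amp ht₁ (S - S') = amp ht₁ S - amp ht₁ S' := by
  rw [eq_sub_iff_add_eq, ← amp_add, sub_add_cancel]

theorem amp_star (S : H₁ →L[ℂ] H₁) : (amp ht₁ S)† = amp ht₁ (S†) := by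
  unfold amp
  rw [tens_adjoint]
  congr 1
  exact star_one (K₁ →L[ℂ] K₁)

def sl (x : H₁) (y : H₂) (X : T₁ →L[ℂ] T₂) : K₁ →L[ℂ] K₂ := (tauL ht₂ y)† ∘L X ∘L tauL ht₁ x
def sr (k : K₁) (k' : K₂) (X : T₁ →L[ℂ] T₂) : H₁ →L[ℂ] H₂ := (tauR ht₂ k')† ∘L X ∘L tauR ht₁ k

theorem sl_inner (x : H₁) (y : H₂) (X : T₁ →L[ℂ] T₂) (k k') :
    (⟪k', sl ht₁ ht₂ x y X k⟫ : ℂ) = ⟪t₂ y k', X (t₁ x k)⟫ := by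
  simp [sl, ContinuousLinearMap.adjoint_inner_right]

theorem sr_inner (k : K₁) (k' : K₂) (X : T₁ →L[ℂ] T₂) (x y) :
    (⟪y, sr ht₁ ht₂ k k' X x⟫ : ℂ) = ⟪t₂ y k', X (t₁ x k)⟫ := by
  simp [sr, ContinuousLinearMap.adjoint_inner_right]

theorem sl_wkC (x : H₁) (y : H₂) : WkC (sl ht₁ ht₂ x y) := wkC_comp _ _
theorem sr_wkC (k : K₁) (k' : K₂) : WkC (sr ht₁ ht₂ k k') := wkC_comp _ _

theorem ext_sr {X Y : T₁ →L[ℂ] T₂} (h : ∀ k k', sr ht₁ ht₂ k k' X = sr ht₁ ht₂ k k' Y) : X = Y := by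
  apply ext_t ht₁
  intro x k
  apply ext_t_inner ht₂
  intro y k'
  rw [← sr_inner ht₁ ht₂, h, sr_inner]

theorem sl_tens (x : H₁) (y : H₂) (S : H₁ →L[ℂ] H₂) (R : K₁ →L[ℂ] K₂) :
    sl ht₁ ht₂ x y (tens ht₁ ht₂ S R) = (⟪y, S x⟫ : ℂ) • R := by
  ext k
  refine ext_inner_left ℂ fun k' => ?_
  rw [sl_inner, tens_apply, t_inner ht₂, ContinuousLinearMap.smul_apply, inner_smul_right]

theorem sr_amp (k : K₁) (k' : K₂) (X : T₁ →L[ℂ] T₂) (P : H₁ →L[ℂ] H₁) (Q : H₂ →L[ℂ] H₂) :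
    sr ht₁ ht₂ k k' (amp ht₂ Q ∘L X ∘L amp ht₁ P) = Q ∘L sr ht₁ ht₂ k k' X ∘L P := by
  ext x
  refine ext_inner_left ℂ fun y => ?_
  rw [sr_inner]
  simp only [ContinuousLinearMap.comp_apply, amp_apply]
  rw [← ContinuousLinearMap.adjoint_inner_left, amp_star, amp_apply,
    ← sr_inner ht₁ ht₂, ContinuousLinearMap.adjoint_inner_left]

def wT (V : Set (H₁ →L[ℂ] H₂)) (U : Set (K₁ →L[ℂ] K₂)) : Submodule ℂ (T₁ →L[ℂ] T₂) :=
  wkcl (Submodule.span ℂ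
    { W : T₁ →L[ℂ] T₂ | ∃ S ∈ V, ∃ R ∈ U, IsElemTensor t₁ t₂ W S R })

theorem tens_mem_wT {V : Set (H₁ →L[ℂ] H₂)} {U : Set (K₁ →L[ℂ] K₂)} {S R} (hS : S ∈ V) (hR : R ∈ U) :
    tens ht₁ ht₂ S R ∈ wT (t₁ := t₁) (t₂ := t₂) V U :=
  le_wkcl _ (Submodule.subset_span ⟨S, hS, R, hR, tens_elem ht₁ ht₂ S R⟩)

include ht₁ ht₂ in
theorem wT_le {V : Set (H₁ →L[ℂ] H₂)} {U : Set (K₁ →L[ℂ] K₂)} {Z : Submodule ℂ (T₁ →L[ℂ] T₂)}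
    (hZ : WkClosed (Z : Set (T₁ →L[ℂ] T₂))) (h : ∀ S ∈ V, ∀ R ∈ U, tens ht₁ ht₂ S R ∈ Z) :
    wT (t₁ := t₁) (t₂ := t₂) V U ≤ Z := by
  refine wkcl_min ?_ hZ
  rw [Submodule.span_le]
  rintro W ⟨S, hS, R, hR, hW⟩
  rw [elem_unique ht₁ ht₂ hW]
  exact h S hS R hR

omit [CompleteSpace H₁] [CompleteSpace H₂] [CompleteSpace K₁] [CompleteSpace K₂]
  [CompleteSpace T₁] [CompleteSpace T₂] in
theorem wT_mono {V V' : Set (H₁ →L[ℂ] H₂)} {U U' : Set (K₁ →L[ℂ] K₂)} (hV : V ⊆ V') (hU : U ⊆ U') :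
    wT (t₁ := t₁) (t₂ := t₂) V U ≤ wT (t₁ := t₁) (t₂ := t₂) V' U' := by
  apply wkcl_mono
  apply Submodule.span_mono
  rintro W ⟨S, hS, R, hR, hW⟩
  exact ⟨S, hV hS, R, hU hR, hW⟩

theorem sl_mem {V : Set (H₁ →L[ℂ] H₂)} {U : Submodule ℂ (K₁ →L[ℂ] K₂)}
    (hU : WkClosed (U : Set (K₁ →L[ℂ] K₂))) {X : T₁ →L[ℂ] T₂} (hX : X ∈ wT (t₁ := t₁) (t₂ := t₂) V U) (x y) :
    sl ht₁ ht₂ x y X ∈ U := by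
  let Φ : (T₁ →L[ℂ] T₂) →ₗ[ℂ] (K₁ →L[ℂ] K₂) :=
    { toFun := sl ht₁ ht₂ x y
      map_add' := fun X Y => by simp [sl]
      map_smul' := fun c X => by simp [sl] }
  have : wT (t₁ := t₁) (t₂ := t₂) V U ≤ U.comap Φ := by
    apply wT_le ht₁ ht₂
    · exact (sl_wkC ht₁ ht₂ x y).preimage_closed hU
    · intro S hS R hR
      change sl ht₁ ht₂ x y (tens ht₁ ht₂ S R) ∈ U
      rw [sl_tens]
      exact U.smul_mem _ hR
  exact this hX

theorem amp_mem {V : Set (H₁ →L[ℂ] H₂)} {U : Set (K₁ →L[ℂ] K₂)} {P : H₁ →L[ℂ] H₁} {Q : H₂ →L[ℂ] H₂}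
    {V' : Set (H₁ →L[ℂ] H₂)}
    (h : ∀ S ∈ V, Q ∘L S ∘L P ∈ V') {X : T₁ →L[ℂ] T₂} (hX : X ∈ wT (t₁ := t₁) (t₂ := t₂) V U) :
    amp ht₂ Q ∘L X ∘L amp ht₁ P ∈ wT (t₁ := t₁) (t₂ := t₂) V' U := by
  let Φ : (T₁ →L[ℂ] T₂) →ₗ[ℂ] (T₁ →L[ℂ] T₂) :=
    { toFun := fun X => amp ht₂ Q ∘L X ∘L amp ht₁ P
      map_add' := fun X Y => by simp
      map_smul' := fun c X => by simp }
  have : wT (t₁ := t₁) (t₂ := t₂) V U ≤ (wT (t₁ := t₁) (t₂ := t₂) V' U).comap Φ := by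
    apply wT_le ht₁ ht₂
    · exact (wkC_comp _ _).preimage_closed (wkcl_closed _)
    · intro S hS R hR
      have : Φ (tens ht₁ ht₂ S R) = tens ht₁ ht₂ (Q ∘L S ∘L P) R := by
        apply ext_t ht₁
        intro x y
        simp [Φ, tens_apply, amp_apply]
      rw [Submodule.mem_comap, this]
      exact tens_mem_wT ht₁ ht₂ (h S hS) hR
  exact this hX

end B2
end OSX

namespace OSX
open Filter Topology
open scoped TensorProduct InnerProduct
section B3
variable {H₁ H₂ K₁ K₂ T₁ T₂ : Type*}
  [NormedAddCommGroup H₁] [InnerProductSpace ℂ H₁] [CompleteSpace H₁]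
  [NormedAddCommGroup H₂] [InnerProductSpace ℂ H₂] [CompleteSpace H₂]
  [NormedAddCommGroup K₁] [InnerProductSpace ℂ K₁] [CompleteSpace K₁]
  [NormedAddCommGroup K₂] [InnerProductSpace ℂ K₂] [CompleteSpace K₂]
  [NormedAddCommGroup T₁] [InnerProductSpace ℂ T₁] [CompleteSpace T₁]
  [NormedAddCommGroup T₂] [InnerProductSpace ℂ T₂] [CompleteSpace T₂]
  {t₁ : H₁ → K₁ → T₁} {t₂ : H₂ → K₂ → T₂}
  (ht₁ : IsTensorEmbedding t₁) (ht₂ : IsTensorEmbedding t₂)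

omit [CompleteSpace H₁] [CompleteSpace K₁] in
theorem norm_sum_on {I : Type*} {b : I → H₁} (hb : Orthonormal ℂ b) (F : Finset I) (k : I → K₁) :
    ‖∑ i ∈ F, b i ⊗ₜ[ℂ] k i‖ ^ 2 = ∑ i ∈ F, ‖k i‖ ^ 2 := by
  classical
  have h : (⟪∑ i ∈ F, b i ⊗ₜ[ℂ] k i, ∑ i ∈ F, b i ⊗ₜ[ℂ] k i⟫ : ℂ) = ((∑ i ∈ F, ‖k i‖ ^ 2 : ℝ) : ℂ) := by
    rw [sum_inner]
    push_cast
    refine Finset.sum_congr rfl fun i hi => ?_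
    rw [inner_sum]
    rw [Finset.sum_eq_single i]
    · rw [TensorProduct.inner_tmul, inner_self_eq_norm_sq_to_K (k i), (orthonormal_iff_ite.1 hb i i)]
      simp
    · intro j _ hj
      rw [TensorProduct.inner_tmul, (orthonormal_iff_ite.1 hb i j), if_neg (Ne.symm hj), zero_mul]
    · intro h; exact absurd hi h
  have h2 := inner_self_eq_norm_sq (𝕜 := ℂ) (∑ i ∈ F, b i ⊗ₜ[ℂ] k i)
  rw [← h2, h]
  exact Complex.ofReal_re _

include ht₂ in
theorem bessel {I : Type*} {b : I → H₁} (hb : Orthonormal ℂ b) (S : H₁ →L[ℂ] H₂) (η : T₂) (F : Finset I) :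
    ∑ i ∈ F, ‖((tauL ht₂ (S (b i)))† : T₂ →L[ℂ] K₂) η‖ ^ 2 ≤ ‖S‖ ^ 2 * ‖η‖ ^ 2 := by
  set k : I → K₂ := fun i => ((tauL ht₂ (S (b i)))† : T₂ →L[ℂ] K₂) η with hk
  set s := ∑ i ∈ F, ‖k i‖ ^ 2 with hs
  change s ≤ _
  have hs0 : 0 ≤ s := Finset.sum_nonneg fun i _ => by positivity
  set v := ∑ i ∈ F, b i ⊗ₜ[ℂ] k i with hv
  have hv1 : ‖v‖ ^ 2 = s := norm_sum_on hb F k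
  set w := tJ ht₂ (TensorProduct.map (S : H₁ →ₗ[ℂ] H₂) (LinearMap.id : K₂ →ₗ[ℂ] K₂) v) with hw
  have hw1 : ‖w‖ ≤ ‖S‖ * ‖v‖ := by rw [hw, tJ_norm]; exact map_bound_left S v
  have e : (⟪w, η⟫ : ℂ) = (s : ℂ) := by
    rw [hw, hv, map_sum, map_sum, sum_inner, hs]
    push_cast
    refine Finset.sum_congr rfl fun i _ => ?_
    rw [TensorProduct.map_tmul, tJ_tmul]
    refine Eq.trans ?_ (inner_self_eq_norm_sq_to_K (𝕜 := ℂ) (k i))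
    simp only [LinearMap.id_apply, ContinuousLinearMap.coe_coe]
    rw [← tauL_apply ht₂, ← ContinuousLinearMap.adjoint_inner_right]
  have h1 : s ≤ ‖S‖ * ‖v‖ * ‖η‖ := by
    have : ‖(⟪w, η⟫ : ℂ)‖ = s := by rw [e, Complex.norm_real, Real.norm_of_nonneg hs0]
    rw [← this]
    exact (norm_inner_le_norm _ _).trans (mul_le_mul_of_nonneg_right hw1 (norm_nonneg _))
  rcases hs0.eq_or_lt with h0 | h0
  · rw [← h0]; positivity
  · have h2 : s * s ≤ s * (‖S‖ ^ 2 * ‖η‖ ^ 2) := by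
      calc s * s ≤ (‖S‖ * ‖v‖ * ‖η‖) * (‖S‖ * ‖v‖ * ‖η‖) := by gcongr
        _ = ‖v‖ ^ 2 * (‖S‖ ^ 2 * ‖η‖ ^ 2) := by ring
        _ = _ := by rw [hv1]
    exact le_of_mul_le_mul_left h2 h0

theorem hasSum_slice {I : Type*} (b : HilbertBasis I ℂ H₁) (S : H₁ →L[ℂ] H₂) (R : K₁ →L[ℂ] K₂)
    (ξ : T₁) (η : T₂) :
    HasSum (fun i => (⟪((tauL ht₂ (S (b i)))† : T₂ →L[ℂ] K₂) η,
      R (((tauL ht₁ (b i))† : T₁ →L[ℂ] K₁) ξ)⟫ : ℂ)) ⟪η, tens ht₁ ht₂ S R ξ⟫ := by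
  have hA : WkT (atTop : Filter (Finset I))
      (fun F => ∑ i ∈ F, tauL ht₁ (b i) ∘L (tauL ht₁ (b i))†) (1 : T₁ →L[ℂ] T₁) := by
    refine tendsto_wot_of_dense (C := 1) (Filter.Eventually.of_forall fun F => ?_)
      ht₁.2.2.2.2.2 ht₁.2.2.2.2.2 ?_
    · refine ContinuousLinearMap.opNorm_le_bound _ zero_le_one fun z => ?_
      have hb := bessel ht₁ b.orthonormal (1 : H₁ →L[ℂ] H₁) z F
      have h1 : (∑ i ∈ F, tauL ht₁ (b i) ∘L (tauL ht₁ (b i))†) z =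
          tJ ht₁ (∑ i ∈ F, b i ⊗ₜ[ℂ] (((tauL ht₁ (b i))† : T₁ →L[ℂ] K₁) z)) := by
        simp [ContinuousLinearMap.sum_apply, map_sum]
      rw [h1, tJ_norm, one_mul]
      apply abs_le_of_sq_le_sq' _ (norm_nonneg _) |>.2
      rw [norm_sum_on b.orthonormal]
      simp only [ContinuousLinearMap.one_apply] at hb
      refine hb.trans ?_
      have : ‖(1 : H₁ →L[ℂ] H₁)‖ ≤ 1 := ContinuousLinearMap.norm_id_le
      have : ‖(1 : H₁ →L[ℂ] H₁)‖ ^ 2 ≤ 1 := pow_le_one₀ (norm_nonneg _) this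
      nlinarith [sq_nonneg ‖z‖]
    · rintro _ ⟨x, y, rfl⟩ _ ⟨x', y', rfl⟩
      have h := (b.hasSum_inner_mul_inner x' x).mul_right (⟪y', y⟫ : ℂ)
      rw [ContinuousLinearMap.one_apply, t_inner ht₁]
      refine h.congr fun F => ?_
      simp only [ContinuousLinearMap.sum_apply, inner_sum]
      refine Finset.sum_congr rfl fun i _ => ?_
      have : (((tauL ht₁ (b i))† : T₁ →L[ℂ] K₁) (t₁ x y)) = (⟪b i, x⟫ : ℂ) • y := by
        refine ext_inner_left ℂ fun k => ?_
        rw [ContinuousLinearMap.adjoint_inner_right, tauL_apply, t_inner ht₁, inner_smul_right]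
      rw [ContinuousLinearMap.comp_apply, this, map_smul, inner_smul_right, tauL_apply, t_inner ht₁]
      ring
  have h2 := (hA.comp (tens ht₁ ht₂ S R) (1 : T₁ →L[ℂ] T₁)).wot ξ η
  refine (Filter.Tendsto.congr (fun F => ?_) h2)
  simp only [ContinuousLinearMap.comp_apply, ContinuousLinearMap.one_apply,
    ContinuousLinearMap.sum_apply, map_sum, inner_sum]
  refine Finset.sum_congr rfl fun i _ => ?_
  rw [ContinuousLinearMap.adjoint_inner_left, tauL_apply, tauL_apply, tens_apply]

theorem summable_slice {I : Type*} (b : HilbertBasis I ℂ H₁) (S : H₁ →L[ℂ] H₂) {η : ℕ → T₂} (hη : SqS η) :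
    Summable fun p : ℕ × I => ‖((tauL ht₂ (S (b p.2)))† : T₂ →L[ℂ] K₂) (η p.1)‖ ^ 2 := by
  rw [summable_prod_of_nonneg (fun p => by positivity)]
  have hbd := fun n => bessel ht₂ b.orthonormal S (η n)
  refine ⟨fun n => summable_of_sum_le (fun i => by positivity) (hbd n), ?_⟩
  refine Summable.of_nonneg_of_le (fun n => tsum_nonneg fun i => by positivity) (fun n => ?_)
    (hη.mul_left (‖S‖ ^ 2))
  exact Real.tsum_le_of_sum_le (fun i => by positivity) (hbd n)

theorem tens_right_wkC (S : H₁ →L[ℂ] H₂) : WkC (tens ht₁ ht₂ S) := by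
  intro F X hX ξ η hξ hη
  obtain ⟨w, b, -⟩ := exists_hilbertBasis ℂ H₁
  have s1 := summable_slice ht₂ b S hη
  have s2 := summable_slice ht₁ b (1 : H₁ →L[ℂ] H₁) hξ
  simp only [ContinuousLinearMap.one_apply] at s2
  have key : ∀ R : K₁ →L[ℂ] K₂, fl ξ η (tens ht₁ ht₂ S R) =
      ∑' p : ℕ × w, (⟪((tauL ht₂ (S (b p.2)))† : T₂ →L[ℂ] K₂) (η p.1),
      R (((tauL ht₁ (b p.2))† : T₁ →L[ℂ] K₁) (ξ p.1))⟫ : ℂ) := by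
    intro R
    have hs : Summable fun p : ℕ × w => (⟪((tauL ht₂ (S (b p.2)))† : T₂ →L[ℂ] K₂) (η p.1),
      R (((tauL ht₁ (b p.2))† : T₁ →L[ℂ] K₁) (ξ p.1))⟫ : ℂ) := by
      refine Summable.of_norm_bounded ((s2.add s1).mul_left ‖R‖) fun n => term_bound _ _ _ le_rfl
    rw [hs.tsum_prod' (fun n => (hasSum_slice ht₁ ht₂ b S R (ξ n) (η n)).summable)]
    unfold fl
    exact tsum_congr fun n => (hasSum_slice ht₁ ht₂ b S R (ξ n) (η n)).tsum_eq.symm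
  simp only [key]
  exact WkT.gen (f := id) hX _ _ s2 s1

theorem wT_wkcl {V : Set (H₁ →L[ℂ] H₂)} {L : Submodule ℂ (K₁ →L[ℂ] K₂)} {Z : Submodule ℂ (T₁ →L[ℂ] T₂)}
    (hZ : WkClosed (Z : Set (T₁ →L[ℂ] T₂)))
    (h : ∀ S ∈ V, ∀ R ∈ L, tens ht₁ ht₂ S R ∈ Z) : ∀ S ∈ V, ∀ R ∈ wkcl L, tens ht₁ ht₂ S R ∈ Z := by
  intro S hS R hR
  exact (tens_right_wkC ht₁ ht₂ S).mem_closure (S := L) (fun X hX => h S hS X hX) hZ hR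

end B3
end OSX

namespace OSX
open Filter Topology
open scoped TensorProduct InnerProduct
section B4
variable {H : Type*} [NormedAddCommGroup H] [InnerProductSpace ℂ H] [CompleteSpace H]

theorem ergU (O : H →L[ℂ] H) (n : ℕ) : ∃ u : H →L[ℂ] H, (∀ d, Commute O d → Commute u d) ∧
    u * O = 1 - ((n + 1 : ℕ) : ℂ)⁻¹ • ∑ i ∈ Finset.range (n + 1), (1 - O) ^ i := by
  refine ⟨((n + 1 : ℕ) : ℂ)⁻¹ • ∑ i ∈ Finset.range (n + 1), ∑ j ∈ Finset.range i, (1 - O) ^ j, ?_, ?_⟩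
  · intro d hd
    apply Commute.smul_left
    apply Commute.sum_left
    intro i _
    apply Commute.sum_left
    intro j _
    apply Commute.pow_left
    exact (Commute.one_left d).sub_left hd
  · rw [smul_mul_assoc, Finset.sum_mul]
    have : ∀ i ∈ Finset.range (n + 1), (∑ j ∈ Finset.range i, (1 - O) ^ j) * O = 1 - (1 - O) ^ i := by
      intro i _
      have := geom_sum_mul_neg (1 - O) i
      rwa [sub_sub_cancel] at this
    rw [Finset.sum_congr rfl this, Finset.sum_sub_distrib, smul_sub]
    congr 1
    rw [Finset.sum_const, Finset.card_range, ← Nat.cast_smul_eq_nsmul ℂ, smul_smul,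
      inv_mul_cancel₀ (by exact_mod_cast Nat.succ_ne_zero n), one_smul]

theorem erg_lim {O p : H →L[ℂ] H} (hO : ‖1 - O‖ ≤ 1) (hp : IsSelfAdjoint p) (hpp : p * p = p)
    (hk : ∀ z, p z = 0 ↔ O z = 0) (x : H) :
    Tendsto (fun n : ℕ => (1 - ((n + 1 : ℕ) : ℂ)⁻¹ • ∑ i ∈ Finset.range (n + 1), (1 - O) ^ i : H →L[ℂ] H) x)
      atTop (𝓝 (p x)) := by
  have h1 := (ContinuousLinearMap.tendsto_birkhoffAverage_orthogonalProjection (1 - O) hO x)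
  have h2 : ((1 - O).eqLocus (1 : H →L[ℂ] H)).starProjection x = x - p x := by
    apply Submodule.eq_starProjection_of_mem_of_inner_eq_zero
    · change (1 - O) (x - p x) = x - p x
      have : O (x - p x) = 0 := by
        rw [← hk, map_sub, ← ContinuousLinearMap.mul_apply, hpp, sub_self]
      simp [ContinuousLinearMap.sub_apply, this]
    · intro w hw
      have hw' : (1 - O) w = w := hw
      have : O w = 0 := by simpa [ContinuousLinearMap.sub_apply] using hw'
      rw [sub_sub_cancel, ← ContinuousLinearMap.adjoint_inner_right,
        ContinuousLinearMap.isSelfAdjoint_iff'.1 hp, (hk w).2 this, inner_zero_right]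
  have h3 := (tendsto_const_nhds (x := x)).sub (h1.comp (tendsto_add_atTop_nat 1))
  have h4 : x - ((((1 - O).eqLocus (1 : H →L[ℂ] H)).orthogonalProjectionOnto x : _) : H) = p x := by
    have := h2
    rw [Submodule.starProjection_apply] at this
    rw [this, sub_sub_cancel]
  rw [h4] at h3
  refine h3.congr fun n => ?_
  simp only [Function.comp, birkhoffAverage, birkhoffSum, ContinuousLinearMap.sub_apply,
    ContinuousLinearMap.one_apply, ContinuousLinearMap.smul_apply, ContinuousLinearMap.sum_apply]
  congr 2
  refine Finset.sum_congr rfl fun i _ => ?_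
  rw [ContinuousLinearMap.coe_pow']
  rfl

theorem erg_bd {O : H →L[ℂ] H} (hO : ‖1 - O‖ ≤ 1) (n : ℕ) :
    ‖(1 - ((n + 1 : ℕ) : ℂ)⁻¹ • ∑ i ∈ Finset.range (n + 1), (1 - O) ^ i : H →L[ℂ] H)‖ ≤ 2 := by
  have h1 : ‖(1 : H →L[ℂ] H)‖ ≤ 1 := ContinuousLinearMap.norm_id_le
  have hpow : ∀ i : ℕ, ‖(1 - O) ^ i‖ ≤ 1 := by
    intro i
    induction i with
    | zero => simpa using h1
    | succ i ih => rw [pow_succ]; exact (norm_mul_le _ _).trans (mul_le_one₀ ih (norm_nonneg _) hO)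
  have h2 : ‖((n + 1 : ℕ) : ℂ)⁻¹ • ∑ i ∈ Finset.range (n + 1), (1 - O) ^ i‖ ≤ 1 := by
    rw [norm_smul, norm_inv, Complex.norm_natCast]
    have : ‖∑ i ∈ Finset.range (n + 1), (1 - O) ^ i‖ ≤ (n + 1 : ℕ) := by
      refine (norm_sum_le_of_le _ fun i _ => hpow i).trans ?_
      simp
    have hn : (0 : ℝ) < (n + 1 : ℕ) := by positivity
    rw [inv_mul_le_iff₀ hn, mul_one]
    exact this
  refine (norm_sub_le _ _).trans ?_
  linarith

theorem ergS (I : Submodule ℂ (H →L[ℂ] H))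
    (hlim : ∀ (f : ℕ → H →L[ℂ] H) (F : H →L[ℂ] H) (C : ℝ), (∀ n, ‖f n‖ ≤ C) →
      (∀ x, Tendsto (fun n => f n x) atTop (𝓝 (F x))) → (∀ n, f n ∈ I) → F ∈ I)
    (h : ℕ → H →L[ℂ] H) (hI : ∀ k, h k ∈ I) (hn : ∀ k, ‖1 - h k‖ ≤ 1)
    (hpos : ∀ k z, 0 ≤ (⟪z, h k z⟫ : ℂ).re) (hker : ∀ k z, (⟪z, h k z⟫ : ℂ).re = 0 → h k z = 0)
    (hmul : ∀ u s, s ∈ I → (∀ d, (∀ k, Commute (h k) d) → Commute u d) → Commute u s → u * s ∈ I)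
    {p : H →L[ℂ] H} (hp : IsSelfAdjoint p) (hpp : p * p = p) (hk : ∀ z, p z = 0 ↔ ∀ k, h k z = 0) :
    p ∈ I := by
  have h1 : ‖(1 : H →L[ℂ] H)‖ ≤ 1 := ContinuousLinearMap.norm_id_le
  have hb : ∀ k, ‖h k‖ ≤ 2 := fun k => by
    have := norm_sub_le (1 : H →L[ℂ] H) (1 - h k)
    rw [sub_sub_cancel] at this
    linarith [hn k]
  set c : ℕ → ℝ := fun k => 1 / 2 / 2 ^ k with hc
  have hc0 : ∀ k, 0 < c k := fun k => by positivity
  have hcs : HasSum c 1 := by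
    have := (summable_geometric_two' 1).hasSum
    rwa [tsum_geometric_two'] at this
  have hsum : Summable fun k => ((c k : ℝ) : ℂ) • h k := by
    refine Summable.of_norm_bounded (hcs.summable.mul_right 2) fun k => ?_
    rw [norm_smul, Complex.norm_real, Real.norm_of_nonneg (hc0 k).le]
    exact mul_le_mul_of_nonneg_left (hb k) (hc0 k).le
  set O := ∑' k, ((c k : ℝ) : ℂ) • h k with hOdef
  have hOs : HasSum (fun k => ((c k : ℝ) : ℂ) • h k) O := hsum.hasSum
  have hOI : O ∈ I := by
    refine hlim (fun n => ∑ k ∈ Finset.range n, ((c k : ℝ) : ℂ) • h k) O 2 ?_ ?_ ?_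
    · intro n
      refine (norm_sum_le _ _).trans ?_
      have : ∑ k ∈ Finset.range n, c k ≤ 1 := sum_le_hasSum _ (fun k _ => (hc0 k).le) hcs
      calc ∑ k ∈ Finset.range n, ‖((c k : ℝ) : ℂ) • h k‖ ≤ ∑ k ∈ Finset.range n, c k * 2 := by
            refine Finset.sum_le_sum fun k _ => ?_
            rw [norm_smul, Complex.norm_real, Real.norm_of_nonneg (hc0 k).le]
            exact mul_le_mul_of_nonneg_left (hb k) (hc0 k).le
        _ ≤ 2 := by rw [← Finset.sum_mul]; linarith
    · intro x
      exact ((ContinuousLinearMap.apply ℂ H x).continuous.tendsto O).comp hOs.tendsto_sum_nat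
    · intro n
      exact I.sum_mem fun k _ => I.smul_mem _ (hI k)
  have hO1 : ‖1 - O‖ ≤ 1 := by
    have h2 : HasSum (fun k => ((c k : ℝ) : ℂ) • (1 - h k)) (1 - O) := by
      have h3 : HasSum (fun k => ((c k : ℝ) : ℂ) • (1 : H →L[ℂ] H)) (1 : H →L[ℂ] H) := by
        have h4 : HasSum (fun k => ((c k : ℝ) : ℂ)) 1 := by exact_mod_cast hcs.mapL Complex.ofRealCLM
        simpa using h4.smul_const (1 : H →L[ℂ] H)
      simpa [smul_sub] using h3.sub hOs
    rw [← h2.tsum_eq]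
    refine tsum_of_norm_bounded hcs fun k => ?_
    rw [norm_smul, Complex.norm_real, Real.norm_of_nonneg (hc0 k).le]
    exact mul_le_of_le_one_right (hc0 k).le (hn k)
  have hOk : ∀ z, p z = 0 ↔ O z = 0 := by
    intro z
    have hz : HasSum (fun k => ((c k : ℝ) : ℂ) • h k z) (O z) := by
      simpa using hOs.mapL (ContinuousLinearMap.apply ℂ H z)
    rw [hk]
    constructor
    · intro h0
      rw [← hz.tsum_eq]
      simp [h0]
    · intro h0 k
      have hz2 : HasSum (fun k => c k * (⟪z, h k z⟫ : ℂ).re) 0 := by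
        have := (hz.mapL (innerSL ℂ z)).mapL Complex.reCLM
        simpa [h0, inner_smul_right] using this
      have := (hasSum_zero_iff_of_nonneg (fun k => mul_nonneg (hc0 k).le (hpos k z))).1 hz2
      have := congrFun this k
      simp only [Pi.zero_apply, mul_eq_zero, (hc0 k).ne', false_or] at this
      exact hker k z this
  refine hlim _ p 2 (erg_bd hO1) (erg_lim hO1 hp hpp hOk) fun n => ?_
  obtain ⟨u, hu, hu2⟩ := ergU O n
  rw [← hu2]
  refine hmul u O hOI (fun d hd => hu d ?_) (hu O (Commute.refl O))
  refine Commute.symm (Commute.tsum_right _ fun k => ?_)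
  exact ((hd k).smul_left _).symm

end B4
end OSX

namespace OSX
open Filter Topology
open scoped TensorProduct InnerProduct
section B5
variable {H H' E H₁ H₂ : Type*}
  [NormedAddCommGroup H] [InnerProductSpace ℂ H] [CompleteSpace H]
  [NormedAddCommGroup H'] [InnerProductSpace ℂ H'] [CompleteSpace H']
  [NormedAddCommGroup E] [InnerProductSpace ℂ E] [CompleteSpace E]
  [NormedAddCommGroup H₁] [InnerProductSpace ℂ H₁] [CompleteSpace H₁]
  [NormedAddCommGroup H₂] [InnerProductSpace ℂ H₂] [CompleteSpace H₂]

theorem proj_intertw {K : Submodule ℂ H} {K' : Submodule ℂ H'} [K.HasOrthogonalProjection]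
    [K'.HasOrthogonalProjection] (A : H →L[ℂ] H') (h1 : ∀ x ∈ K, A x ∈ K')
    (h2 : ∀ y ∈ K', (A†) y ∈ K) : K'.starProjection ∘L A = A ∘L K.starProjection := by
  ext x
  rw [ContinuousLinearMap.comp_apply, ContinuousLinearMap.comp_apply]
  apply Submodule.eq_starProjection_of_mem_of_inner_eq_zero
  · exact h1 _ (Submodule.starProjection_apply_mem _ _)
  · intro w hw
    rw [← map_sub, ← ContinuousLinearMap.adjoint_inner_right]
    exact Submodule.starProjection_inner_eq_zero _ _ (h2 w hw)

theorem sum_sq_proj {J : Type*} [Fintype J] {p : J → H →L[ℂ] H} (hs : ∑ j, p j = 1)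
    (hp : ∀ j, (p j)† = p j) (hpp : ∀ j, p j ∘L p j = p j) (z : H) :
    ∑ j, ‖p j z‖ ^ 2 = ‖z‖ ^ 2 := by
  have h1 : ∀ j, ‖p j z‖ ^ 2 = (⟪z, p j z⟫ : ℂ).re := by
    intro j
    have : (⟪z, p j z⟫ : ℂ) = ⟪p j z, p j z⟫ := by
      conv_rhs => rw [← ContinuousLinearMap.adjoint_inner_right, hp, ← ContinuousLinearMap.comp_apply, hpp]
    rw [this, ← inner_self_eq_norm_sq (𝕜 := ℂ)]
    rfl
  simp_rw [h1]
  rw [← Complex.re_sum, ← inner_sum, ← ContinuousLinearMap.sum_apply, hs, ContinuousLinearMap.one_apply,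
    ← inner_self_eq_norm_sq (𝕜 := ℂ)]
  rfl

theorem block_bd {J : Type*} [Fintype J] {p : J → H →L[ℂ] H} {q : J → H' →L[ℂ] H'} {c : J → H →L[ℂ] H'}
    {C : ℝ} (hC : 0 ≤ C)
    (hs : ∑ j, p j = 1) (hp : ∀ j, (p j)† = p j) (hpp : ∀ j, p j ∘L p j = p j)
    (hs' : ∑ j, q j = 1) (hq : ∀ j, (q j)† = q j) (hqq : ∀ j, q j ∘L q j = q j)
    (hc : ∀ j, ‖c j‖ ≤ C) : ‖∑ j, q j ∘L c j ∘L p j‖ ≤ C := by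
  refine ContinuousLinearMap.opNorm_le_bound _ hC fun z => ?_
  set w := (∑ j, q j ∘L c j ∘L p j) z with hw
  have key : ∀ w' : H', ‖(⟪w', w⟫ : ℂ)‖ ≤ C * (‖w'‖ * ‖z‖) := by
    intro w'
    rw [hw, ContinuousLinearMap.sum_apply, inner_sum]
    calc ‖∑ j, (⟪w', (q j ∘L c j ∘L p j) z⟫ : ℂ)‖ ≤ ∑ j, C * (‖q j w'‖ * ‖p j z‖) := by
          refine norm_sum_le_of_le _ fun j _ => ?_
          rw [ContinuousLinearMap.comp_apply, ← ContinuousLinearMap.adjoint_inner_left, hq]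
          refine (norm_inner_le_norm _ _).trans ?_
          rw [ContinuousLinearMap.comp_apply]
          have := (c j).le_of_opNorm_le (hc j) (p j z)
          calc ‖q j w'‖ * ‖c j (p j z)‖ ≤ ‖q j w'‖ * (C * ‖p j z‖) := by gcongr
            _ = _ := by ring
      _ = C * ∑ j, (‖q j w'‖ * ‖p j z‖) := by rw [Finset.mul_sum]
      _ ≤ C * (‖w'‖ * ‖z‖) := by
          refine mul_le_mul_of_nonneg_left ?_ hC
          apply abs_le_of_sq_le_sq' _ (by positivity) |>.2
          refine (Finset.sum_mul_sq_le_sq_mul_sq _ _ _).trans ?_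
          rw [sum_sq_proj hs hp hpp, sum_sq_proj hs' hq hqq, mul_pow]
  have h2 := key w
  rw [inner_self_eq_norm_sq_to_K] at h2
  rw [norm_pow, RCLike.norm_ofReal, abs_norm] at h2
  rcases (norm_nonneg w).eq_or_lt with h0 | h0
  · rw [← h0]; positivity
  · refine le_of_mul_le_mul_left ?_ h0
    calc ‖w‖ * ‖w‖ = ‖w‖ ^ 2 := by ring
      _ ≤ _ := h2
      _ = _ := by ring

structure BoolFam (B : Set ((H₁ →L[ℂ] H₁) × (H₂ →L[ℂ] H₂))) : Prop where
  one : 1 ∈ B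
  compl : ∀ c ∈ B, 1 - c ∈ B
  mul : ∀ c ∈ B, ∀ d ∈ B, c * d ∈ B
  comm : ∀ c ∈ B, ∀ d ∈ B, c * d = d * c
  idem : ∀ c ∈ B, c * c = c
  sa₁ : ∀ c ∈ B, (c.1)† = c.1
  sa₂ : ∀ c ∈ B, (c.2)† = c.2

omit [CompleteSpace H₁] [CompleteSpace H₂] in
/-- intertwiners -/
def Nn (B : Set ((H₁ →L[ℂ] H₁) × (H₂ →L[ℂ] H₂))) : Set (H₁ →L[ℂ] H₂) :=
  {T | ∀ c ∈ B, c.2 ∘L T = T ∘L c.1}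

variable {B : Set ((H₁ →L[ℂ] H₁) × (H₂ →L[ℂ] H₂))}

theorem BoolFam.part (hB : BoolFam B) (s : Finset ((H₁ →L[ℂ] H₁) × (H₂ →L[ℂ] H₂))) (hs : ∀ c ∈ s, c ∈ B) :
    ∃ (J : Type) (_ : Fintype J) (a : J → (H₁ →L[ℂ] H₁) × (H₂ →L[ℂ] H₂)), (∀ j, a j ∈ B) ∧
      ∑ j, a j = 1 ∧ ∀ c ∈ s, ∀ j, c * a j = a j ∨ c * a j = 0 := by
  classical
  induction s using Finset.induction_on with
  | empty => exact ⟨Unit, inferInstance, fun _ => 1, fun _ => hB.one, by simp, by simp⟩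
  | insert c s _ ih =>
    obtain ⟨J, _, a, h1, h2, h3⟩ := ih fun d hd => hs d (Finset.mem_insert_of_mem hd)
    have hc : c ∈ B := hs c (Finset.mem_insert_self _ _)
    refine ⟨J × Bool, inferInstance, fun j => if j.2 then c * a j.1 else (1 - c) * a j.1, ?_, ?_, ?_⟩
    · rintro ⟨j, b⟩
      cases b
      · simpa using hB.mul _ (hB.compl c hc) _ (h1 j)
      · simpa using hB.mul _ hc _ (h1 j)
    · rw [Fintype.sum_prod_type]
      simp only [Fintype.sum_bool, if_true, Bool.false_eq_true, if_false]
      refine Eq.trans ?_ h2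
      refine Finset.sum_congr rfl fun j _ => ?_
      rw [← add_mul]; simp
    · intro d hd
      rw [Finset.mem_insert] at hd
      rintro ⟨j, b⟩
      rcases hd with rfl | hd
      · cases b
        · right
          simp only [Bool.false_eq_true, if_false]
          rw [← mul_assoc, mul_sub, mul_one, hB.idem d hc, sub_self, zero_mul]
        · left
          simp only [if_true]
          rw [← mul_assoc, hB.idem d hc]
      · have hdB := hs d (Finset.mem_insert_of_mem hd)
        have key : ∀ f ∈ B, d * (f * a j) = f * a j ∨ d * (f * a j) = 0 := by
          intro f hf
          rw [← mul_assoc, hB.comm d hdB f hf, mul_assoc]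
          rcases h3 d hd j with h | h
          · left; rw [h]
          · right; rw [h, mul_zero]
        cases b
        · simpa using key _ (hB.compl c hc)
        · simpa using key _ hc

structure EmbPair (i₁ : H₁ →L[ℂ] E) (i₂ : H₂ →L[ℂ] E) : Prop where
  h11 : i₁† ∘L i₁ = 1
  h22 : i₂† ∘L i₂ = 1
  h12 : i₁† ∘L i₂ = 0
  sum : i₁ ∘L i₁† + i₂ ∘L i₂† = 1

variable {i₁ : H₁ →L[ℂ] E} {i₂ : H₂ →L[ℂ] E}

def eE (i₁ : H₁ →L[ℂ] E) (i₂ : H₂ →L[ℂ] E) (c : (H₁ →L[ℂ] H₁) × (H₂ →L[ℂ] H₂)) : E →L[ℂ] E :=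
  i₁ ∘L c.1 ∘L i₁† + i₂ ∘L c.2 ∘L i₂†

theorem EmbPair.h21 (hi : EmbPair i₁ i₂) : i₂† ∘L i₁ = 0 := by
  have := congrArg ContinuousLinearMap.adjoint hi.h12
  simpa [ContinuousLinearMap.adjoint_comp] using this

theorem EmbPair.a11 (hi : EmbPair i₁ i₂) (x : H₁) : (i₁†) (i₁ x) = x := DFunLike.congr_fun hi.h11 x
theorem EmbPair.a22 (hi : EmbPair i₁ i₂) (x : H₂) : (i₂†) (i₂ x) = x := DFunLike.congr_fun hi.h22 x
theorem EmbPair.a12 (hi : EmbPair i₁ i₂) (x : H₂) : (i₁†) (i₂ x) = 0 := DFunLike.congr_fun hi.h12 x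
theorem EmbPair.a21 (hi : EmbPair i₁ i₂) (x : H₁) : (i₂†) (i₁ x) = 0 := DFunLike.congr_fun hi.h21 x

theorem eE_mul (hi : EmbPair i₁ i₂) (c d) : eE i₁ i₂ (c * d) = eE i₁ i₂ c ∘L eE i₁ i₂ d := by
  ext z
  simp [eE, hi.a11, hi.a22, hi.a12, hi.a21]

theorem eE_one (hi : EmbPair i₁ i₂) : eE i₁ i₂ 1 = 1 := by
  rw [← hi.sum]; rfl

theorem eE_zero : eE i₁ i₂ 0 = 0 := by
  simp [eE]

theorem eE_sum {J : Type*} [Fintype J] (a : J → (H₁ →L[ℂ] H₁) × (H₂ →L[ℂ] H₂)) :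
    eE i₁ i₂ (∑ j, a j) = ∑ j, eE i₁ i₂ (a j) := by
  have : ∀ c d, eE i₁ i₂ (c + d) = eE i₁ i₂ c + eE i₁ i₂ d := by
    intro c d; ext z; simp [eE]; abel
  exact map_sum (AddMonoidHom.mk' (eE i₁ i₂) this) _ _

theorem eE_sa {c : (H₁ →L[ℂ] H₁) × (H₂ →L[ℂ] H₂)} (h1 : (c.1)† = c.1) (h2 : (c.2)† = c.2) :
    (eE i₁ i₂ c)† = eE i₁ i₂ c := by
  simp [eE, ContinuousLinearMap.adjoint_comp, h1, h2, ContinuousLinearMap.comp_assoc]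

theorem eE_i₁ (hi : EmbPair i₁ i₂) (c) (z : E) : (i₁†) (eE i₁ i₂ c z) = c.1 ((i₁†) z) := by
  simp [eE, hi.a11, hi.a12]
theorem eE_i₂ (hi : EmbPair i₁ i₂) (c) (z : E) : (i₂†) (eE i₁ i₂ c z) = c.2 ((i₂†) z) := by
  simp [eE, hi.a22, hi.a21]

def cyc (B : Set ((H₁ →L[ℂ] H₁) × (H₂ →L[ℂ] H₂))) (i₁ : H₁ →L[ℂ] E) (i₂ : H₂ →L[ℂ] E)
    (x : H₁) (y : H₂) : Submodule ℂ E :=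
  (Submodule.span ℂ ((fun c => eE i₁ i₂ c (i₁ x + i₂ y)) '' B)).topologicalClosure

instance (x : H₁) (y : H₂) : CompleteSpace (cyc B i₁ i₂ x y) :=
  (Submodule.isClosed_topologicalClosure _).completeSpace_coe

theorem cyc_mem (x : H₁) (y : H₂) {c} (hc : c ∈ B) : eE i₁ i₂ c (i₁ x + i₂ y) ∈ cyc B i₁ i₂ x y :=
  Submodule.le_topologicalClosure _ (Submodule.subset_span ⟨c, hc, rfl⟩)

theorem cyc_comm (hi : EmbPair i₁ i₂) (hB : BoolFam B) (x : H₁) (y : H₂) {c} (hc : c ∈ B) :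
    (cyc B i₁ i₂ x y).starProjection ∘L eE i₁ i₂ c = eE i₁ i₂ c ∘L (cyc B i₁ i₂ x y).starProjection := by
  have : ∀ z ∈ cyc B i₁ i₂ x y, eE i₁ i₂ c z ∈ cyc B i₁ i₂ x y := by
    intro z hz
    have h2 : cyc B i₁ i₂ x y ≤ (cyc B i₁ i₂ x y).comap (eE i₁ i₂ c : E →ₗ[ℂ] E) := by
      apply Submodule.topologicalClosure_minimal
      · rw [Submodule.span_le]
        rintro _ ⟨d, hd, rfl⟩
        change eE i₁ i₂ c (eE i₁ i₂ d _) ∈ cyc B i₁ i₂ x y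
        rw [← ContinuousLinearMap.comp_apply, ← eE_mul hi]
        exact cyc_mem x y (hB.mul _ hc _ hd)
      · exact (Submodule.isClosed_topologicalClosure _).preimage (eE i₁ i₂ c).continuous
    exact h2 hz
  apply proj_intertw _ this
  rw [eE_sa (hB.sa₁ c hc) (hB.sa₂ c hc)]
  exact this

theorem dense_cyc (K : Submodule ℂ E) [CompleteSpace K] {s : Set E}
    (hs : K = (Submodule.span ℂ s).topologicalClosure) :
    (Submodule.span ℂ (s ∪ (Kᗮ : Submodule ℂ E))).topologicalClosure = ⊤ := by
  rw [eq_top_iff, ← Submodule.sup_orthogonal_of_hasOrthogonalProjection (K := K)]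
  apply sup_le
  · conv_lhs => rw [hs]
    exact Submodule.topologicalClosure_mono (Submodule.span_mono subset_union_left)
  · refine le_trans ?_ (Submodule.le_topologicalClosure _)
    exact fun z hz => Submodule.subset_span (Or.inr hz)

end B5
end OSX

namespace OSX
open Filter Topology
open scoped TensorProduct InnerProduct
section B6
variable {E H₁ H₂ K₁ K₂ T₁ T₂ : Type*}
  [NormedAddCommGroup E] [InnerProductSpace ℂ E] [CompleteSpace E]
  [NormedAddCommGroup H₁] [InnerProductSpace ℂ H₁] [CompleteSpace H₁]
  [NormedAddCommGroup H₂] [InnerProductSpace ℂ H₂] [CompleteSpace H₂]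
  [NormedAddCommGroup K₁] [InnerProductSpace ℂ K₁] [CompleteSpace K₁]
  [NormedAddCommGroup K₂] [InnerProductSpace ℂ K₂] [CompleteSpace K₂]
  [NormedAddCommGroup T₁] [InnerProductSpace ℂ T₁] [CompleteSpace T₁]
  [NormedAddCommGroup T₂] [InnerProductSpace ℂ T₂] [CompleteSpace T₂]
  {t₁ : H₁ → K₁ → T₁} {t₂ : H₂ → K₂ → T₂}
  (ht₁ : IsTensorEmbedding t₁) (ht₂ : IsTensorEmbedding t₂)
  {B : Set ((H₁ →L[ℂ] H₁) × (H₂ →L[ℂ] H₂))}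
  {i₁ : H₁ →L[ℂ] E} {i₂ : H₂ →L[ℂ] E}

def rho (a : (H₁ →L[ℂ] H₁) × (H₂ →L[ℂ] H₂)) (x : H₁) (y : H₂) : ℝ := ‖a.1 x‖ ^ 2 + ‖a.2 y‖ ^ 2

theorem rho_bd {a : (H₁ →L[ℂ] H₁) × (H₂ →L[ℂ] H₂)} {x : H₁} {y : H₂} {r C : ℝ} (hC : 0 ≤ C)
    (hr : r ≤ ‖a.2 y‖ * (C * ‖a.1 x‖)) : (rho a x y)⁻¹ * r ≤ C := by
  have h0 : 0 ≤ rho a x y := by unfold rho; positivity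
  rcases h0.eq_or_lt with h | h
  · rw [← h]; simpa using hC
  · rw [inv_mul_le_iff₀ h]
    refine hr.trans ?_
    unfold rho
    nlinarith [sq_nonneg (‖a.1 x‖ - ‖a.2 y‖), sq_nonneg ‖a.1 x‖, sq_nonneg ‖a.2 y‖,
      mul_nonneg hC (sq_nonneg (‖a.1 x‖ - ‖a.2 y‖)), mul_nonneg hC (sq_nonneg ‖a.1 x‖),
      mul_nonneg hC (sq_nonneg ‖a.2 y‖)]

def alp (S : H₁ →L[ℂ] H₂) (x : H₁) (y : H₂) (a : (H₁ →L[ℂ] H₁) × (H₂ →L[ℂ] H₂)) : ℂ :=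
  ((rho a x y)⁻¹ : ℝ) * ⟪a.2 y, S (a.1 x)⟫

theorem alp_bd (S : H₁ →L[ℂ] H₂) (x : H₁) (y : H₂) (a : (H₁ →L[ℂ] H₁) × (H₂ →L[ℂ] H₂)) :
    ‖alp S x y a‖ ≤ ‖S‖ := by
  have h0 : 0 ≤ rho a x y := by unfold rho; positivity
  unfold alp
  rw [norm_mul, Complex.norm_real, Real.norm_of_nonneg (inv_nonneg.2 h0)]
  apply rho_bd (norm_nonneg _)
  refine (norm_inner_le_norm _ _).trans ?_
  gcongr
  exact S.le_opNorm _

/-- the operators on `E` -/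
def OE (i₁ : H₁ →L[ℂ] E) (i₂ : H₂ →L[ℂ] E) {J : Type} [Fintype J]
    (a : J → (H₁ →L[ℂ] H₁) × (H₂ →L[ℂ] H₂)) (S : H₁ →L[ℂ] H₂) (x : H₁) (y : H₂) : E →L[ℂ] E :=
  ∑ j, alp S x y (a j) • eE i₁ i₂ (a j)

theorem OE_bd (hi : EmbPair i₁ i₂) (hB : BoolFam B) {J : Type} [Fintype J]
    {a : J → (H₁ →L[ℂ] H₁) × (H₂ →L[ℂ] H₂)} (ha : ∀ j, a j ∈ B) (hs : ∑ j, a j = 1)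
    (S : H₁ →L[ℂ] H₂) (x : H₁) (y : H₂) : ‖OE i₁ i₂ a S x y‖ ≤ ‖S‖ := by
  have h1 : ∑ j, eE i₁ i₂ (a j) = 1 := by rw [← eE_sum, hs, eE_one hi]
  have h2 : ∀ j, (eE i₁ i₂ (a j))† = eE i₁ i₂ (a j) := fun j => eE_sa (hB.sa₁ _ (ha j)) (hB.sa₂ _ (ha j))
  have h3 : ∀ j, eE i₁ i₂ (a j) ∘L eE i₁ i₂ (a j) = eE i₁ i₂ (a j) := fun j => by
    rw [← eE_mul hi, hB.idem _ (ha j)]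
  have := block_bd (c := fun j => alp S x y (a j) • (1 : E →L[ℂ] E)) (norm_nonneg S) h1 h2 h3 h1 h2 h3
    (fun j => by
      rw [norm_smul]
      exact (mul_le_of_le_one_right (norm_nonneg _) ContinuousLinearMap.norm_id_le).trans (alp_bd _ _ _ _))
  refine le_trans (le_of_eq ?_) this
  congr 1
  unfold OE
  refine Finset.sum_congr rfl fun j _ => ?_
  ext z
  simp only [ContinuousLinearMap.smul_apply, ContinuousLinearMap.comp_apply, map_smul, ContinuousLinearMap.one_apply]
  rw [← ContinuousLinearMap.comp_apply, h3]

theorem OE_eq (hi : EmbPair i₁ i₂) (hB : BoolFam B) {J : Type} [Fintype J]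
    {a : J → (H₁ →L[ℂ] H₁) × (H₂ →L[ℂ] H₂)} (ha : ∀ j, a j ∈ B) (hs : ∑ j, a j = 1)
    {S : H₁ →L[ℂ] H₂} (hS : S ∈ Nn B) (x : H₁) (y : H₂) {c d} (hc : c ∈ B) (hd : d ∈ B)
    (hcj : ∀ j, c * a j = a j ∨ c * a j = 0) (hdj : ∀ j, d * a j = a j ∨ d * a j = 0) :
    (⟪eE i₁ i₂ d (i₁ x + i₂ y), OE i₁ i₂ a S x y (eE i₁ i₂ c (i₁ x + i₂ y))⟫ : ℂ) =
      ⟪eE i₁ i₂ d (i₁ x + i₂ y), (i₂ ∘L S ∘L i₁†) (eE i₁ i₂ c (i₁ x + i₂ y))⟫ := by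
  have hz1 : (i₁†) (i₁ x + i₂ y) = x := by rw [map_add, hi.a11, hi.a12, add_zero]
  have hz2 : (i₂†) (i₁ x + i₂ y) = y := by rw [map_add, hi.a22, hi.a21, zero_add]
  have hR : (⟪eE i₁ i₂ d (i₁ x + i₂ y), (i₂ ∘L S ∘L i₁†) (eE i₁ i₂ c (i₁ x + i₂ y))⟫ : ℂ) =
      ⟪y, (d * c).2 (S x)⟫ := by
    rw [ContinuousLinearMap.comp_apply, ContinuousLinearMap.comp_apply, eE_i₁ hi, hz1,
      ← ContinuousLinearMap.adjoint_inner_left, eE_i₂ hi, hz2,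
      ← ContinuousLinearMap.comp_apply S, ← hS c hc, ← ContinuousLinearMap.adjoint_inner_right,
      hB.sa₂ d hd]
    rfl
  have hsum : d * c = ∑ j, d * (c * a j) := by
    rw [← Finset.mul_sum, ← Finset.mul_sum, hs, mul_one]
  rw [hR, hsum, Prod.snd_sum, ContinuousLinearMap.sum_apply, inner_sum, OE, ContinuousLinearMap.sum_apply, inner_sum]
  refine Finset.sum_congr rfl fun j _ => ?_
  rw [ContinuousLinearMap.smul_apply, inner_smul_right, ← ContinuousLinearMap.comp_apply, ← eE_mul hi,
    ← ContinuousLinearMap.adjoint_inner_right, eE_sa (hB.sa₁ d hd) (hB.sa₂ d hd),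
    ← ContinuousLinearMap.comp_apply, ← eE_mul hi, hB.comm _ (ha j) _ hc]
  have : d * (c * a j) = a j ∨ d * (c * a j) = 0 := by
    rcases hcj j with h | h
    · rw [h]; exact hdj j
    · right; rw [h, mul_zero]
  rcases this with h | h
  · rw [h]
    have h1 : ∀ u : H₁, (a j).1 ((a j).1 u) = (a j).1 u := fun u =>
      DFunLike.congr_fun (congrArg Prod.fst (hB.idem _ (ha j))) u
    have h2 : ∀ u : H₂, (a j).2 ((a j).2 u) = (a j).2 u := fun u =>
      DFunLike.congr_fun (congrArg Prod.snd (hB.idem _ (ha j))) u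
    have e1 : (⟪x, (a j).1 x⟫ : ℂ) = ((‖(a j).1 x‖ ^ 2 : ℝ) : ℂ) := by
      rw [← h1, ← ContinuousLinearMap.adjoint_inner_left, hB.sa₁ _ (ha j)]
      refine (inner_self_eq_norm_sq_to_K (𝕜 := ℂ) _).trans ?_
      rw [h1]; push_cast; rfl
    have e2 : (⟪y, (a j).2 y⟫ : ℂ) = ((‖(a j).2 y‖ ^ 2 : ℝ) : ℂ) := by
      rw [← h2, ← ContinuousLinearMap.adjoint_inner_left, hB.sa₂ _ (ha j)]
      refine (inner_self_eq_norm_sq_to_K (𝕜 := ℂ) _).trans ?_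
      rw [h2]; push_cast; rfl
    have e3 : (⟪i₁ x + i₂ y, eE i₁ i₂ (a j) (i₁ x + i₂ y)⟫ : ℂ) = ((rho (a j) x y : ℝ) : ℂ) := by
      rw [inner_add_left, ← ContinuousLinearMap.adjoint_inner_right, ← ContinuousLinearMap.adjoint_inner_right,
        eE_i₁ hi, eE_i₂ hi, hz1, hz2, e1, e2, rho]
      push_cast; rfl
    have e4 : (⟪y, (a j).2 (S x)⟫ : ℂ) = ⟪(a j).2 y, S ((a j).1 x)⟫ := by
      rw [← ContinuousLinearMap.comp_apply S, ← hS _ (ha j), ← hB.sa₂ _ (ha j),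
        ContinuousLinearMap.adjoint_inner_left, hB.sa₂ _ (ha j), ContinuousLinearMap.comp_apply, h2]
    rw [e3, e4, alp]
    by_cases h0 : rho (a j) x y = 0
    · have : (a j).2 y = 0 := by
        unfold rho at h0
        have : ‖(a j).2 y‖ ^ 2 = 0 := by nlinarith [sq_nonneg ‖(a j).1 x‖, sq_nonneg ‖(a j).2 y‖]
        simpa using this
      rw [this, inner_zero_left]; simp
    · have h0' : ((rho (a j) x y : ℝ) : ℂ) ≠ 0 := by exact_mod_cast h0
      push_cast
      field_simp
  · rw [h, eE_zero]; simp

/-- the approximants -/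
def ZZ {J : Type} [Fintype J] (a : J → (H₁ →L[ℂ] H₁) × (H₂ →L[ℂ] H₂)) (S : H₁ →L[ℂ] H₂)
    (Y : T₁ →L[ℂ] T₂) (x : H₁) (y : H₂) : T₁ →L[ℂ] T₂ :=
  ∑ j, tens ht₁ ht₂ ((a j).2 ∘L S) ((((rho (a j) x y)⁻¹ : ℝ) : ℂ) • sl ht₁ ht₂ ((a j).1 x) ((a j).2 y) Y)

theorem sl_norm (x : H₁) (y : H₂) (Y : T₁ →L[ℂ] T₂) : ‖sl ht₁ ht₂ x y Y‖ ≤ ‖y‖ * (‖Y‖ * ‖x‖) := by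
  have h1 : ‖tauL ht₁ x‖ ≤ ‖x‖ :=
    ContinuousLinearMap.opNorm_le_bound _ (norm_nonneg _) fun k => by rw [tauL_apply, t_norm ht₁]
  have h2 : ‖tauL ht₂ y‖ ≤ ‖y‖ :=
    ContinuousLinearMap.opNorm_le_bound _ (norm_nonneg _) fun k => by rw [tauL_apply, t_norm ht₂]
  unfold sl
  refine (ContinuousLinearMap.opNorm_comp_le _ _).trans ?_
  have h3 : ‖(tauL ht₂ y)†‖ ≤ ‖y‖ := by rw [LinearIsometryEquiv.norm_map]; exact h2
  gcongr
  refine (ContinuousLinearMap.opNorm_comp_le _ _).trans ?_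
  gcongr

theorem amp_sum {J : Type*} [Fintype J] (p : J → H₁ →L[ℂ] H₁) :
    amp ht₁ (∑ j, p j) = ∑ j, amp ht₁ (p j) :=
  map_sum (AddMonoidHom.mk' (amp ht₁) (amp_add ht₁)) _ _

theorem ZZ_bd (hB : BoolFam B) {J : Type} [Fintype J]
    {a : J → (H₁ →L[ℂ] H₁) × (H₂ →L[ℂ] H₂)} (ha : ∀ j, a j ∈ B) (hs : ∑ j, a j = 1)
    {S : H₁ →L[ℂ] H₂} (hS : S ∈ Nn B) (hS1 : ‖S‖ ≤ 1) (Y : T₁ →L[ℂ] T₂) (x : H₁) (y : H₂) :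
    ‖ZZ ht₁ ht₂ a S Y x y‖ ≤ ‖Y‖ := by
  have s1 : ∑ j, amp ht₁ (a j).1 = 1 := by
    rw [← amp_sum, ← Prod.fst_sum, hs, Prod.fst_one, amp_one]
  have s2 : ∑ j, amp ht₂ (a j).2 = 1 := by
    rw [← amp_sum, ← Prod.snd_sum, hs, Prod.snd_one, amp_one]
  have := block_bd (p := fun j => amp ht₁ (a j).1) (q := fun j => amp ht₂ (a j).2)
    (c := fun j => tens ht₁ ht₂ S ((((rho (a j) x y)⁻¹ : ℝ) : ℂ) • sl ht₁ ht₂ ((a j).1 x) ((a j).2 y) Y))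
    (norm_nonneg Y) s1 (fun j => by rw [amp_star, hB.sa₁ _ (ha j)])
    (fun j => by
      change amp ht₁ (a j).1 * amp ht₁ (a j).1 = _
      rw [← amp_mul, ← Prod.fst_mul, hB.idem _ (ha j)])
    s2 (fun j => by rw [amp_star, hB.sa₂ _ (ha j)])
    (fun j => by
      change amp ht₂ (a j).2 * amp ht₂ (a j).2 = _
      rw [← amp_mul, ← Prod.snd_mul, hB.idem _ (ha j)])
    (fun j => by
      refine (tens_norm_le _ _ _ _).trans ((mul_le_of_le_one_left (norm_nonneg _) hS1).trans ?_)
      have h0 : 0 ≤ rho (a j) x y := by unfold rho; positivity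
      rw [norm_smul, Complex.norm_real, Real.norm_of_nonneg (inv_nonneg.2 h0)]
      exact rho_bd (norm_nonneg _) (sl_norm _ _ _ _ _))
  refine le_trans (le_of_eq ?_) this
  congr 1
  unfold ZZ
  refine Finset.sum_congr rfl fun j _ => ?_
  apply ext_t ht₁
  intro u k
  simp only [ContinuousLinearMap.comp_apply, amp_apply, tens_apply]
  have h1 : (a j).2 (S ((a j).1 u)) = (a j).2 (S u) := by
    rw [← ContinuousLinearMap.comp_apply S, ← hS _ (ha j)]
    exact DFunLike.congr_fun (congrArg Prod.snd (hB.idem _ (ha j))) _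
  rw [h1]

theorem ZZ_inner {J : Type} [Fintype J] (a : J → (H₁ →L[ℂ] H₁) × (H₂ →L[ℂ] H₂)) (S : H₁ →L[ℂ] H₂)
    (Y : T₁ →L[ℂ] T₂) (x : H₁) (y : H₂) (w k w' k') :
    (⟪t₂ w' k', ZZ ht₁ ht₂ a S Y x y (t₁ w k)⟫ : ℂ) =
      ∑ j, alp (sr ht₁ ht₂ k k' Y) x y (a j) * ⟪w', (a j).2 (S w)⟫ := by
  unfold ZZ
  rw [ContinuousLinearMap.sum_apply, inner_sum]
  refine Finset.sum_congr rfl fun j _ => ?_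
  rw [tens_apply, t_inner ht₂, ContinuousLinearMap.smul_apply, inner_smul_right, sl_inner, alp,
    sr_inner, mul_comm]
  rfl

end B6
end OSX

namespace OSX
open Filter Topology
open scoped TensorProduct InnerProduct
section B7
variable {E H₁ H₂ K₁ K₂ T₁ T₂ : Type*}
  [NormedAddCommGroup E] [InnerProductSpace ℂ E] [CompleteSpace E]
  [NormedAddCommGroup H₁] [InnerProductSpace ℂ H₁] [CompleteSpace H₁]
  [NormedAddCommGroup H₂] [InnerProductSpace ℂ H₂] [CompleteSpace H₂]
  [NormedAddCommGroup K₁] [InnerProductSpace ℂ K₁] [CompleteSpace K₁]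
  [NormedAddCommGroup K₂] [InnerProductSpace ℂ K₂] [CompleteSpace K₂]
  [NormedAddCommGroup T₁] [InnerProductSpace ℂ T₁] [CompleteSpace T₁]
  [NormedAddCommGroup T₂] [InnerProductSpace ℂ T₂] [CompleteSpace T₂]
  {t₁ : H₁ → K₁ → T₁} {t₂ : H₂ → K₂ → T₂}
  (ht₁ : IsTensorEmbedding t₁) (ht₂ : IsTensorEmbedding t₂)
  {B : Set ((H₁ →L[ℂ] H₁) × (H₂ →L[ℂ] H₂))}
  {i₁ : H₁ →L[ℂ] E} {i₂ : H₂ →L[ℂ] E}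

theorem exists_emb (H₁ H₂ : Type*) [NormedAddCommGroup H₁] [InnerProductSpace ℂ H₁] [CompleteSpace H₁]
    [NormedAddCommGroup H₂] [InnerProductSpace ℂ H₂] [CompleteSpace H₂] :
    ∃ (i₁ : H₁ →L[ℂ] WithLp 2 (H₁ × H₂)) (i₂ : H₂ →L[ℂ] WithLp 2 (H₁ × H₂)), EmbPair i₁ i₂ := by
  let i₁ : H₁ →L[ℂ] WithLp 2 (H₁ × H₂) :=
    ((WithLp.prodContinuousLinearEquiv 2 ℂ H₁ H₂).symm : (H₁ × H₂) →L[ℂ] _) ∘L ContinuousLinearMap.inl ℂ H₁ H₂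
  let i₂ : H₂ →L[ℂ] WithLp 2 (H₁ × H₂) :=
    ((WithLp.prodContinuousLinearEquiv 2 ℂ H₁ H₂).symm : (H₁ × H₂) →L[ℂ] _) ∘L ContinuousLinearMap.inr ℂ H₁ H₂
  have a1 : i₁† = WithLp.fstL 2 ℂ H₁ H₂ := by
    symm
    rw [ContinuousLinearMap.eq_adjoint_iff]
    intro z x
    simp [i₁, WithLp.prod_inner_apply]
  have a2 : i₂† = WithLp.sndL 2 ℂ H₁ H₂ := by
    symm
    rw [ContinuousLinearMap.eq_adjoint_iff]
    intro z x
    simp [i₂, WithLp.prod_inner_apply]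
  refine ⟨i₁, i₂, ?_, ?_, ?_, ?_⟩
  · rw [a1]; ext x; simp [i₁]
  · rw [a2]; ext x; simp [i₂]
  · rw [a1]; ext x; simp [i₂]
  · rw [a1, a2]
    refine ContinuousLinearMap.ext fun z => WithLp.ofLp_injective 2 ?_
    simp [i₁, i₂]
    rfl

def YY (B : Set ((H₁ →L[ℂ] H₁) × (H₂ →L[ℂ] H₂))) (L : Set (K₁ →L[ℂ] K₂)) : Set (T₁ →L[ℂ] T₂) :=
  {Y | (∀ c ∈ B, amp ht₂ c.2 ∘L Y = Y ∘L amp ht₁ c.1) ∧ ∀ x y, sl ht₁ ht₂ x y Y ∈ L}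

theorem sr_mem_Nn {Y : T₁ →L[ℂ] T₂} (hY : ∀ c ∈ B, amp ht₂ c.2 ∘L Y = Y ∘L amp ht₁ c.1) (k k') :
    sr ht₁ ht₂ k k' Y ∈ Nn B := by
  intro c hc
  have h1 := sr_amp ht₁ ht₂ k k' Y 1 c.2
  have h2 := sr_amp ht₁ ht₂ k k' Y c.1 1
  rw [amp_one] at h1 h2
  simp only [ContinuousLinearMap.one_def, ContinuousLinearMap.comp_id, ContinuousLinearMap.id_comp] at h1 h2
  rw [← h1, ← h2, hY c hc]

theorem YY_right (hB : BoolFam B) {L : Set (K₁ →L[ℂ] K₂)} {Y : T₁ →L[ℂ] T₂} (hY : Y ∈ YY ht₁ ht₂ B L)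
    {u : H₁ →L[ℂ] H₁} (hu : ∀ c ∈ B, Commute u c.1) : Y ∘L amp ht₁ u ∈ YY ht₁ ht₂ B L := by
  refine ⟨fun c hc => ?_, fun x y => ?_⟩
  · rw [← ContinuousLinearMap.comp_assoc, hY.1 c hc, ContinuousLinearMap.comp_assoc, ContinuousLinearMap.comp_assoc]
    change Y ∘L (amp ht₁ c.1 * amp ht₁ u) = Y ∘L (amp ht₁ u * amp ht₁ c.1)
    rw [← amp_mul, ← amp_mul, (hu c hc).eq]
  · have : sl ht₁ ht₂ x y (Y ∘L amp ht₁ u) = sl ht₁ ht₂ (u x) y Y := by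
      ext k
      refine ext_inner_left ℂ fun k' => ?_
      rw [sl_inner, sl_inner, ContinuousLinearMap.comp_apply, amp_apply]
    rw [this]; exact hY.2 _ _

theorem YY_left (hB : BoolFam B) {L : Set (K₁ →L[ℂ] K₂)} {Y : T₁ →L[ℂ] T₂} (hY : Y ∈ YY ht₁ ht₂ B L)
    {u : H₂ →L[ℂ] H₂} (hu : ∀ c ∈ B, Commute u c.2) : amp ht₂ u ∘L Y ∈ YY ht₁ ht₂ B L := by
  refine ⟨fun c hc => ?_, fun x y => ?_⟩
  · rw [ContinuousLinearMap.comp_assoc, ← hY.1 c hc, ← ContinuousLinearMap.comp_assoc, ← ContinuousLinearMap.comp_assoc]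
    change (amp ht₂ c.2 * amp ht₂ u) ∘L Y = (amp ht₂ u * amp ht₂ c.2) ∘L Y
    rw [← amp_mul, ← amp_mul, (hu c hc).eq]
  · have : sl ht₁ ht₂ x y (amp ht₂ u ∘L Y) = sl ht₁ ht₂ x ((u†) y) Y := by
      ext k
      refine ext_inner_left ℂ fun k' => ?_
      rw [sl_inner, sl_inner, ContinuousLinearMap.comp_apply, ← ContinuousLinearMap.adjoint_inner_left,
        amp_star, amp_apply]
    rw [this]; exact hY.2 _ _

theorem fub1 (hi : EmbPair i₁ i₂) (hB : BoolFam B) {L : Submodule ℂ (K₁ →L[ℂ] K₂)} {Y : T₁ →L[ℂ] T₂}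
    (hY : Y ∈ YY ht₁ ht₂ B L) (x : H₁) (y : H₂) :
    amp ht₂ (i₂† ∘L (cyc B i₁ i₂ x y).starProjection ∘L i₂) ∘L Y ∘L
      amp ht₁ (i₁† ∘L (cyc B i₁ i₂ x y).starProjection ∘L i₁) ∈ wT (t₁ := t₁) (t₂ := t₂) (Nn B) L := by
  classical
  set R := (cyc B i₁ i₂ x y).starProjection with hR
  have hRR : ∀ z, R (R z) = R z := fun z => by
    rw [hR]; exact Submodule.starProjection_eq_self_iff.2 (Submodule.starProjection_apply_mem _ _)
  have hRa : R† = R := ContinuousLinearMap.isSelfAdjoint_iff'.1 (isSelfAdjoint_starProjection _)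
  have hRn : ‖R‖ ≤ 1 := Submodule.starProjection_norm_le _
  have hRc : ∀ c ∈ B, ∀ z, R (eE i₁ i₂ c z) = eE i₁ i₂ c (R z) := fun c hc z =>
    DFunLike.congr_fun (cyc_comm hi hB x y hc) z
  set S : H₁ →L[ℂ] H₂ := i₂† ∘L R ∘L i₁ with hSd
  have e1 : ∀ c (u : H₁), eE i₁ i₂ c (i₁ u) = i₁ (c.1 u) := fun c u => by simp [eE, hi.a11, hi.a21]
  have hS : S ∈ Nn B := by
    intro c hc
    ext u
    simp only [hSd, ContinuousLinearMap.comp_apply]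
    rw [← eE_i₂ hi c, ← hRc c hc, e1]
  have iso1 : ∀ u, ‖i₁ u‖ = ‖u‖ := fun u => norm_eq_of_inner (by
    rw [← ContinuousLinearMap.adjoint_inner_right, hi.a11])
  have iso2 : ∀ u, ‖i₂ u‖ = ‖u‖ := fun u => norm_eq_of_inner (by
    rw [← ContinuousLinearMap.adjoint_inner_right, hi.a22])
  have ni1 : ‖i₁‖ ≤ 1 := ContinuousLinearMap.opNorm_le_bound _ zero_le_one fun u => by rw [iso1, one_mul]
  have ni2 : ‖i₂†‖ ≤ 1 := by
    rw [LinearIsometryEquiv.norm_map]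
    exact ContinuousLinearMap.opNorm_le_bound _ zero_le_one fun u => by rw [iso2, one_mul]
  have hS1 : ‖S‖ ≤ 1 := by
    refine (ContinuousLinearMap.opNorm_comp_le _ _).trans (mul_le_one₀ ni2 (norm_nonneg _) ?_)
    exact (ContinuousLinearMap.opNorm_comp_le _ _).trans (mul_le_one₀ hRn (norm_nonneg _) ni1)
  have hp := fun s : Finset B => hB.part (s.map (Function.Embedding.subtype (· ∈ B))) (by
    intro c hc
    obtain ⟨d, _, rfl⟩ := Finset.mem_map.1 hc
    exact d.2)
  choose J inst a ha hs hc using hp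
  have conv : ∀ T ∈ Nn B, WkT (atTop : Filter (Finset B)) (fun s => R ∘L OE i₁ i₂ (a s) T x y ∘L R)
      (R ∘L (i₂ ∘L T ∘L i₁†) ∘L R) := by
    intro T hT
    have hd := dense_cyc (cyc B i₁ i₂ x y) rfl
    refine tendsto_wot_of_dense (C := ‖T‖) (Eventually.of_forall fun s => ?_) hd hd ?_
    · refine (ContinuousLinearMap.opNorm_comp_le _ _).trans ((mul_le_of_le_one_left (norm_nonneg _) hRn).trans ?_)
      refine (ContinuousLinearMap.opNorm_comp_le _ _).trans ((mul_le_of_le_one_right (norm_nonneg _) hRn).trans ?_)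
      exact OE_bd hi hB (ha s) (hs s) T x y
    · intro u hu v hv
      have h0 : ∀ z ∈ (cyc B i₁ i₂ x y)ᗮ, R z = 0 := fun z hz => by
        rw [hR]; exact (Submodule.starProjection_apply_eq_zero_iff _).2 hz
      have hswap : ∀ (A : E →L[ℂ] E), (⟪v, (R ∘L A ∘L R) u⟫ : ℂ) = ⟪R v, A (R u)⟫ := fun A => by
        rw [ContinuousLinearMap.comp_apply, ← ContinuousLinearMap.adjoint_inner_left, hRa]; rfl
      simp only [hswap]
      rcases hu with hu | hu
      · rcases hv with hv | hv
        · obtain ⟨c, hcB, rfl⟩ := hu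
          obtain ⟨d, hdB, rfl⟩ := hv
          have hfix : ∀ c ∈ B, R (eE i₁ i₂ c (i₁ x + i₂ y)) = eE i₁ i₂ c (i₁ x + i₂ y) := fun c hc => by
            rw [hR]; exact Submodule.starProjection_eq_self_iff.2 (cyc_mem x y hc)
          simp only [hfix c hcB, hfix d hdB]
          refine tendsto_const_nhds.congr' ?_
          filter_upwards [eventually_ge_atTop ({⟨c, hcB⟩, ⟨d, hdB⟩} : Finset B)] with s hsge
          refine (OE_eq hi hB (ha s) (hs s) hT x y hcB hdB (hc s c ?_) (hc s d ?_)).symm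
          · exact Finset.mem_map.2 ⟨⟨c, hcB⟩, hsge (by simp), rfl⟩
          · exact Finset.mem_map.2 ⟨⟨d, hdB⟩, hsge (by simp), rfl⟩
        · simp only [h0 v hv, inner_zero_left]; exact tendsto_const_nhds
      · simp only [h0 u hu, map_zero, inner_zero_right]; exact tendsto_const_nhds
  have hZ : WkT (atTop : Filter (Finset B)) (fun s => ZZ ht₁ ht₂ (a s) S Y x y)
      (amp ht₂ (i₂† ∘L R ∘L i₂) ∘L Y ∘L amp ht₁ (i₁† ∘L R ∘L i₁)) := by
    refine tendsto_wot_of_dense (C := ‖Y‖) (Eventually.of_forall fun s => ?_) ht₁.2.2.2.2.2 ht₂.2.2.2.2.2 ?_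
    · exact ZZ_bd ht₁ ht₂ hB (ha s) (hs s) hS hS1 Y x y
    · rintro _ ⟨w, k, rfl⟩ _ ⟨w', k', rfl⟩
      have h := (conv _ (sr_mem_Nn ht₁ ht₂ hY.1 k k')).wot (i₁ w) (i₂ w')
      rw [← sr_inner ht₁ ht₂, sr_amp]
      refine (h.congr fun s => ?_).trans (le_of_eq ?_)
      · rw [ZZ_inner]
        simp only [OE, ContinuousLinearMap.comp_apply, ContinuousLinearMap.sum_apply, map_sum, inner_sum,
          ContinuousLinearMap.smul_apply, map_smul, inner_smul_right]
        refine Finset.sum_congr rfl fun j _ => ?_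
        congr 1
        rw [hRc _ (ha s j), hRR, ← ContinuousLinearMap.adjoint_inner_right i₂, eE_i₂ hi]
        rfl
      · congr 1
        rw [ContinuousLinearMap.comp_apply, ← ContinuousLinearMap.adjoint_inner_right i₂]
        rfl
  refine (wkcl_closed _).mem_of hZ (Eventually.of_forall fun s => ?_)
  refine Submodule.sum_mem _ fun j _ => ?_
  refine tens_mem_wT ht₁ ht₂ ?_ (L.smul_mem _ (hY.2 _ _))
  intro c hcB
  have h := congrArg Prod.snd (hB.comm c hcB _ (ha s j))
  change c.2 ∘L ((a s j).2 ∘L S) = ((a s j).2 ∘L S) ∘L c.1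
  have h2 : ((a s j).2 ∘L S) ∘L c.1 = ((a s j).2 * c.2) ∘L S := by
    rw [ContinuousLinearMap.comp_assoc, ← hS c hcB]; rfl
  rw [h2]
  exact congrArg (fun A : H₂ →L[ℂ] H₂ => A ∘L S) h

end B7
end OSX

namespace OSX
open Filter Topology
open scoped TensorProduct InnerProduct
section B8
variable {E H H₁ H₂ K₁ K₂ T₁ T₂ : Type*}
  [NormedAddCommGroup E] [InnerProductSpace ℂ E] [CompleteSpace E]
  [NormedAddCommGroup H] [InnerProductSpace ℂ H] [CompleteSpace H]
  [NormedAddCommGroup H₁] [InnerProductSpace ℂ H₁] [CompleteSpace H₁]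
  [NormedAddCommGroup H₂] [InnerProductSpace ℂ H₂] [CompleteSpace H₂]
  [NormedAddCommGroup K₁] [InnerProductSpace ℂ K₁] [CompleteSpace K₁]
  [NormedAddCommGroup K₂] [InnerProductSpace ℂ K₂] [CompleteSpace K₂]
  [NormedAddCommGroup T₁] [InnerProductSpace ℂ T₁] [CompleteSpace T₁]
  [NormedAddCommGroup T₂] [InnerProductSpace ℂ T₂] [CompleteSpace T₂]
  {t₁ : H₁ → K₁ → T₁} {t₂ : H₂ → K₂ → T₂}
  (ht₁ : IsTensorEmbedding t₁) (ht₂ : IsTensorEmbedding t₂)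
  {B : Set ((H₁ →L[ℂ] H₁) × (H₂ →L[ℂ] H₂))}

theorem cp_inner (i : H →L[ℂ] E) (K : Submodule ℂ E) [CompleteSpace K] (z : H) :
    (⟪z, (i† ∘L K.starProjection ∘L i) z⟫ : ℂ).re = ‖K.starProjection (i z)‖ ^ 2 := by
  rw [ContinuousLinearMap.comp_apply, ContinuousLinearMap.adjoint_inner_right, ContinuousLinearMap.comp_apply]
  have h : (⟪i z, K.starProjection (i z)⟫ : ℂ) = ⟪K.starProjection (i z), K.starProjection (i z)⟫ := by
    rw [← sub_eq_zero, ← inner_sub_left]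
    exact Submodule.inner_left_of_mem_orthogonal (Submodule.starProjection_apply_mem _ _)
      (Submodule.sub_starProjection_mem_orthogonal _)
  rw [h, inner_self_eq_norm_sq_to_K]
  norm_cast

theorem cp_ker (i : H →L[ℂ] E) (K : Submodule ℂ E) [CompleteSpace K] (z : H) :
    (i† ∘L K.starProjection ∘L i) z = 0 ↔ i z ∈ Kᗮ := by
  rw [← Submodule.starProjection_apply_eq_zero_iff]
  constructor
  · intro h
    have := cp_inner i K z
    rw [h, inner_zero_right] at this
    simpa using this.symm
  · intro h
    simp [h]

theorem cp_norm (i : H →L[ℂ] E) (hi : i† ∘L i = 1) (K : Submodule ℂ E) [CompleteSpace K] :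
    ‖1 - i† ∘L K.starProjection ∘L i‖ ≤ 1 := by
  have h : 1 - i† ∘L K.starProjection ∘L i = i† ∘L (1 - K.starProjection) ∘L i := by
    rw [← hi]; ext z; simp
  have ni : ‖i‖ ≤ 1 := ContinuousLinearMap.opNorm_le_bound _ zero_le_one fun u => by
    rw [one_mul]
    refine (norm_eq_of_inner ?_).le
    rw [← ContinuousLinearMap.adjoint_inner_right, ← ContinuousLinearMap.comp_apply, hi]; rfl
  have h2 : ‖(1 : E →L[ℂ] E) - K.starProjection‖ ≤ 1 := by
    have : (1 : E →L[ℂ] E) - K.starProjection = Kᗮ.starProjection := by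
      rw [sub_eq_iff_eq_add, add_comm]; exact K.id_eq_sum_starProjection_self_orthogonalComplement
    rw [this]; exact Submodule.starProjection_norm_le _
  rw [h]
  refine (ContinuousLinearMap.opNorm_comp_le _ _).trans (mul_le_one₀ ?_ (norm_nonneg _) ?_)
  · rwa [LinearIsometryEquiv.norm_map]
  exact (ContinuousLinearMap.opNorm_comp_le _ _).trans (mul_le_one₀ h2 (norm_nonneg _) ni)

theorem amp_lim {f : ℕ → H₁ →L[ℂ] H₁} {F : H₁ →L[ℂ] H₁} {C : ℝ} (hC : ∀ n, ‖f n‖ ≤ C)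
    (hf : ∀ x, Tendsto (fun n => f n x) atTop (𝓝 (F x))) :
    WkT atTop (fun n => amp ht₁ (f n)) (amp ht₁ F) := by
  refine tendsto_wot_of_dense (C := C) (Eventually.of_forall fun n => (amp_norm_le ht₁ _).trans (hC n))
    ht₁.2.2.2.2.2 ht₁.2.2.2.2.2 ?_
  rintro _ ⟨w, k, rfl⟩ _ ⟨w', k', rfl⟩
  simp only [amp_apply, t_inner ht₁]
  exact (tendsto_const_nhds.inner (hf w)).mul_const _

structure Fam (h : ℕ → H →L[ℂ] H) (p : H →L[ℂ] H) : Prop where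
  hn : ∀ k, ‖1 - h k‖ ≤ 1
  hpos : ∀ k z, 0 ≤ (⟪z, h k z⟫ : ℂ).re
  hker : ∀ k z, (⟪z, h k z⟫ : ℂ).re = 0 → h k z = 0
  hp : IsSelfAdjoint p
  hpp : p * p = p
  hk : ∀ z, p z = 0 ↔ ∀ k, h k z = 0

theorem left_erg (hB : BoolFam B) {L : Set (K₁ →L[ℂ] K₂)} {Z : Submodule ℂ (T₁ →L[ℂ] T₂)}
    (hZ : WkClosed (Z : Set (T₁ →L[ℂ] T₂))) (h₀ : H₁ →L[ℂ] H₁) (h : ℕ → H₂ →L[ℂ] H₂)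
    (comm : ∀ k, ∀ c ∈ B, Commute (h k) c.2)
    (hI : ∀ k, ∀ Y ∈ YY ht₁ ht₂ B L, amp ht₂ (h k) ∘L Y ∘L amp ht₁ h₀ ∈ Z)
    {p : H₂ →L[ℂ] H₂} (hf : Fam h p) : ∀ Y ∈ YY ht₁ ht₂ B L, amp ht₂ p ∘L Y ∘L amp ht₁ h₀ ∈ Z := by
  let I : Submodule ℂ (H₂ →L[ℂ] H₂) :=
    { carrier := {s | ∀ Y ∈ YY ht₁ ht₂ B L, amp ht₂ s ∘L Y ∘L amp ht₁ h₀ ∈ Z}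
      zero_mem' := fun Y _ => by
        rw [amp_zero, ContinuousLinearMap.zero_comp]; exact Z.zero_mem
      add_mem' := fun ha hb Y hY => by
        rw [amp_add, ContinuousLinearMap.add_comp]; exact Z.add_mem (ha Y hY) (hb Y hY)
      smul_mem' := fun c s hs Y hY => by
        rw [amp_smul, ContinuousLinearMap.smul_comp]; exact Z.smul_mem _ (hs Y hY) }
  refine ergS I ?_ h hI hf.hn hf.hpos hf.hker ?_ hf.hp hf.hpp hf.hk
  · intro f F C hC hfl hfI Y hY
    have := (amp_lim ht₂ hC hfl).comp (1 : T₂ →L[ℂ] T₂) (Y ∘L amp ht₁ h₀)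
    simp only [ContinuousLinearMap.one_def, ContinuousLinearMap.id_comp] at this
    exact hZ.mem_of this (Eventually.of_forall fun n => hfI n Y hY)
  · intro u s hs hd hus Y hY
    have h1 : u * s = s * u := hus
    have := hs _ (YY_left ht₁ ht₂ hB hY (u := u) fun c hc => hd _ fun k => comm k c hc)
    rw [h1, amp_mul, ContinuousLinearMap.mul_def, ContinuousLinearMap.comp_assoc]
    rwa [ContinuousLinearMap.comp_assoc] at this

theorem right_erg (hB : BoolFam B) {L : Set (K₁ →L[ℂ] K₂)} {Z : Submodule ℂ (T₁ →L[ℂ] T₂)}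
    (hZ : WkClosed (Z : Set (T₁ →L[ℂ] T₂))) (g₀ : H₂ →L[ℂ] H₂) (h : ℕ → H₁ →L[ℂ] H₁)
    (comm : ∀ k, ∀ c ∈ B, Commute (h k) c.1)
    (hI : ∀ k, ∀ Y ∈ YY ht₁ ht₂ B L, amp ht₂ g₀ ∘L Y ∘L amp ht₁ (h k) ∈ Z)
    {p : H₁ →L[ℂ] H₁} (hf : Fam h p) : ∀ Y ∈ YY ht₁ ht₂ B L, amp ht₂ g₀ ∘L Y ∘L amp ht₁ p ∈ Z := by
  let I : Submodule ℂ (H₁ →L[ℂ] H₁) :=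
    { carrier := {s | ∀ Y ∈ YY ht₁ ht₂ B L, amp ht₂ g₀ ∘L Y ∘L amp ht₁ s ∈ Z}
      zero_mem' := fun Y _ => by
        rw [amp_zero, ContinuousLinearMap.comp_zero, ContinuousLinearMap.comp_zero]; exact Z.zero_mem
      add_mem' := fun ha hb Y hY => by
        rw [amp_add, ContinuousLinearMap.comp_add, ContinuousLinearMap.comp_add]; exact Z.add_mem (ha Y hY) (hb Y hY)
      smul_mem' := fun c s hs Y hY => by
        rw [amp_smul, ContinuousLinearMap.comp_smul, ContinuousLinearMap.comp_smul]; exact Z.smul_mem _ (hs Y hY) }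
  refine ergS I ?_ h hI hf.hn hf.hpos hf.hker ?_ hf.hp hf.hpp hf.hk
  · intro f F C hC hfl hfI Y hY
    have := (amp_lim ht₁ hC hfl).comp (amp ht₂ g₀ ∘L Y) (1 : T₁ →L[ℂ] T₁)
    simp only [ContinuousLinearMap.one_def, ContinuousLinearMap.comp_id, ContinuousLinearMap.comp_assoc] at this
    exact hZ.mem_of this (Eventually.of_forall fun n => hfI n Y hY)
  · intro u s hs hd hus Y hY
    have := hs _ (YY_right ht₁ ht₂ hB hY (u := u) fun c hc => hd _ fun k => comm k c hc)
    rw [amp_mul, ContinuousLinearMap.mul_def]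
    rwa [ContinuousLinearMap.comp_assoc] at this

theorem fub2 [TopologicalSpace.SeparableSpace H₁] [TopologicalSpace.SeparableSpace H₂]
    (hB : BoolFam B) {L : Submodule ℂ (K₁ →L[ℂ] K₂)} {Y : T₁ →L[ℂ] T₂}
    (hY : Y ∈ YY ht₁ ht₂ B L) : Y ∈ wT (t₁ := t₁) (t₂ := t₂) (Nn B) L := by
  obtain ⟨i₁, i₂, hi⟩ := exists_emb H₁ H₂
  set Z := wT (t₁ := t₁) (t₂ := t₂) (Nn B) L with hZd
  have hZ : WkClosed (Z : Set (T₁ →L[ℂ] T₂)) := wkcl_closed _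
  let h : H₁ → H₂ → H₁ →L[ℂ] H₁ := fun x y => i₁† ∘L (cyc B i₁ i₂ x y).starProjection ∘L i₁
  let g : H₁ → H₂ → H₂ →L[ℂ] H₂ := fun x y => i₂† ∘L (cyc B i₁ i₂ x y).starProjection ∘L i₂
  have e1 : ∀ c (u : H₁), eE i₁ i₂ c (i₁ u) = i₁ (c.1 u) := fun c u => by simp [eE, hi.a11, hi.a21]
  have e2 : ∀ c (u : H₂), eE i₁ i₂ c (i₂ u) = i₂ (c.2 u) := fun c u => by simp [eE, hi.a22, hi.a12]
  have hch : ∀ x y, ∀ c ∈ B, Commute (h x y) c.1 := fun x y c hc => by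
    ext z
    have := DFunLike.congr_fun (cyc_comm hi hB x y hc) (i₁ z)
    simp only [ContinuousLinearMap.comp_apply, e1] at this
    simp only [h, ContinuousLinearMap.mul_apply, ContinuousLinearMap.comp_apply]
    rw [this, eE_i₁ hi]
  have hcg : ∀ x y, ∀ c ∈ B, Commute (g x y) c.2 := fun x y c hc => by
    ext z
    have := DFunLike.congr_fun (cyc_comm hi hB x y hc) (i₂ z)
    simp only [ContinuousLinearMap.comp_apply, e2] at this
    simp only [g, ContinuousLinearMap.mul_apply, ContinuousLinearMap.comp_apply]
    rw [this, eE_i₂ hi]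
  have orth : ∀ x y z, z ∈ (cyc B i₁ i₂ x y)ᗮ ↔ ∀ c ∈ B, (⟪c.1 x, (i₁†) z⟫ : ℂ) + ⟪c.2 y, (i₂†) z⟫ = 0 := by
    intro x y z
    have hin : ∀ c, (⟪eE i₁ i₂ c (i₁ x + i₂ y), z⟫ : ℂ) = ⟪c.1 x, (i₁†) z⟫ + ⟪c.2 y, (i₂†) z⟫ := fun c => by
      rw [map_add, e1, e2, inner_add_left, ContinuousLinearMap.adjoint_inner_right, ContinuousLinearMap.adjoint_inner_right]
    rw [cyc, Submodule.orthogonal_closure, Submodule.mem_orthogonal]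
    constructor
    · intro h c hc
      rw [← hin]; exact h _ (Submodule.subset_span ⟨c, hc, rfl⟩)
    · intro h u hu
      induction hu using Submodule.span_induction with
      | mem u hu => obtain ⟨c, hc, rfl⟩ := hu; exact (hin c).trans (h c hc)
      | zero => simp
      | add a b _ _ ha hb => rw [inner_add_left, ha, hb, add_zero]
      | smul a b _ hb => rw [inner_smul_left, hb, mul_zero]
  have kh : ∀ x y z, h x y z = 0 ↔ ∀ c ∈ B, (⟪c.1 x, z⟫ : ℂ) = 0 := fun x y z => by
    rw [cp_ker, orth]; simp [hi.a11, hi.a21]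
  have kg : ∀ x y z, g x y z = 0 ↔ ∀ c ∈ B, (⟪c.2 y, z⟫ : ℂ) = 0 := fun x y z => by
    rw [cp_ker, orth]; simp [hi.a22, hi.a12]
  have ph : ∀ x y z, 0 ≤ (⟪z, h x y z⟫ : ℂ).re := fun x y z => by rw [cp_inner]; positivity
  have pg : ∀ x y z, 0 ≤ (⟪z, g x y z⟫ : ℂ).re := fun x y z => by rw [cp_inner]; positivity
  have kkh : ∀ x y z, (⟪z, h x y z⟫ : ℂ).re = 0 → h x y z = 0 := fun x y z hz => by
    rw [cp_inner] at hz
    rw [cp_ker, ← Submodule.starProjection_apply_eq_zero_iff]; simpa using hz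
  have kkg : ∀ x y z, (⟪z, g x y z⟫ : ℂ).re = 0 → g x y z = 0 := fun x y z hz => by
    rw [cp_inner] at hz
    rw [cp_ker, ← Submodule.starProjection_apply_eq_zero_iff]; simpa using hz
  let Ky : H₂ → Submodule ℂ H₂ := fun y => (Submodule.span ℂ ((fun c => c.2 y) '' B)).topologicalClosure
  haveI : ∀ y, CompleteSpace (Ky y) := fun y => (Submodule.isClosed_topologicalClosure _).completeSpace_coe
  let R : H₂ → H₂ →L[ℂ] H₂ := fun y => (Ky y).starProjection
  have kR : ∀ y z, R y z = 0 ↔ ∀ c ∈ B, (⟪c.2 y, z⟫ : ℂ) = 0 := by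
    intro y z
    rw [Submodule.starProjection_apply_eq_zero_iff, Submodule.orthogonal_closure, Submodule.mem_orthogonal]
    constructor
    · intro h c hc
      exact h _ (Submodule.subset_span ⟨c, hc, rfl⟩)
    · intro h u hu
      induction hu using Submodule.span_induction with
      | mem u hu => obtain ⟨c, hc, rfl⟩ := hu; exact h c hc
      | zero => simp
      | add a b _ _ ha hb => rw [inner_add_left, ha, hb, add_zero]
      | smul a b _ hb => rw [inner_smul_left, hb, mul_zero]
  have hRi : ∀ y, R y * R y = R y := fun y => by
    ext z; exact Submodule.starProjection_eq_self_iff.2 (Submodule.starProjection_apply_mem _ _)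
  have hcR : ∀ y, ∀ c ∈ B, Commute (R y) c.2 := by
    intro y c hc
    have inv : ∀ z ∈ Ky y, c.2 z ∈ Ky y := by
      have : Ky y ≤ (Ky y).comap (c.2 : H₂ →ₗ[ℂ] H₂) := by
        refine Submodule.topologicalClosure_minimal _ ?_
          ((Submodule.isClosed_topologicalClosure _).preimage c.2.continuous)
        rw [Submodule.span_le]
        rintro _ ⟨d, hd, rfl⟩
        exact Submodule.le_topologicalClosure _ (Submodule.subset_span ⟨c * d, hB.mul c hc d hd, rfl⟩)
      exact this
    exact proj_intertw (K := Ky y) (K' := Ky y) c.2 inv (by rw [hB.sa₂ c hc]; exact inv)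
  have cR : ∀ (y : H₂), R y = (1 : H₂ →L[ℂ] H₂)† ∘L (Ky y).starProjection ∘L (1 : H₂ →L[ℂ] H₂) := fun y => by
    have : (1 : H₂ →L[ℂ] H₂)† = 1 := star_one _
    rw [this]; rfl
  have one1 : (1 : H₂ →L[ℂ] H₂)† ∘L (1 : H₂ →L[ℂ] H₂) = 1 := by
    have : (1 : H₂ →L[ℂ] H₂)† = 1 := star_one _
    rw [this]; rfl
  have hB1 : (1 : (H₁ →L[ℂ] H₁) × (H₂ →L[ℂ] H₂)) ∈ B := hB.one
  have sA : ∀ x y, ∀ Y ∈ YY ht₁ ht₂ B L, amp ht₂ (R y) ∘L Y ∘L amp ht₁ (h x y) ∈ Z := by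
    intro x y
    refine left_erg ht₁ ht₂ hB hZ _ (fun _ => g x y) (fun _ => hcg x y)
      (fun _ Y hY => fub1 ht₁ ht₂ hi hB hY x y) ⟨fun _ => cp_norm _ hi.h22 _, fun _ => pg x y, fun _ => kkg x y,
        isSelfAdjoint_starProjection _, hRi y, fun z => ?_⟩
    rw [kR, forall_const, kg]
  have sB : ∀ y, ∀ Y ∈ YY ht₁ ht₂ B L, amp ht₂ (R y) ∘L Y ∘L amp ht₁ 1 ∈ Z := by
    intro y
    refine right_erg ht₁ ht₂ hB hZ _ (fun k => h (TopologicalSpace.denseSeq H₁ k) y) (fun k => hch _ y)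
      (fun k => sA _ y) ⟨fun _ => cp_norm _ hi.h11 _, fun _ => ph _ y, fun _ => kkh _ y,
        IsSelfAdjoint.one _, one_mul 1, fun z => ?_⟩
    constructor
    · intro hz k
      have : z = 0 := hz
      rw [this, map_zero]
    · intro hz
      have : ∀ x ∈ Set.range (TopologicalSpace.denseSeq H₁), (⟪x, z⟫ : ℂ) = 0 := by
        rintro _ ⟨k, rfl⟩
        exact (kh _ y z).1 (hz k) 1 hB1
      exact (TopologicalSpace.denseRange_denseSeq H₁).eq_zero_of_inner_right ℂ fun k => this _ ⟨k, rfl⟩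
  have sC : ∀ Y ∈ YY ht₁ ht₂ B L, amp ht₂ 1 ∘L Y ∘L amp ht₁ 1 ∈ Z := by
    refine left_erg ht₁ ht₂ hB hZ _ (fun k => R (TopologicalSpace.denseSeq H₂ k)) (fun k => hcR _)
      (fun k => sB _) ⟨fun k => ?_, fun k z => ?_, fun k z hz => ?_,
        IsSelfAdjoint.one _, one_mul 1, fun z => ?_⟩
    · rw [cR]; exact cp_norm _ one1 _
    · rw [cR, cp_inner]; positivity
    · rw [cR, cp_inner] at hz
      simpa using hz
    constructor
    · intro hz k
      have : z = 0 := hz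
      rw [this, map_zero]
    · intro hz
      have : ∀ x ∈ Set.range (TopologicalSpace.denseSeq H₂), (⟪x, z⟫ : ℂ) = 0 := by
        rintro _ ⟨k, rfl⟩
        exact (kR _ z).1 (hz k) 1 hB1
      exact (TopologicalSpace.denseRange_denseSeq H₂).eq_zero_of_inner_right ℂ fun k => this _ ⟨k, rfl⟩
  have := sC Y hY
  rwa [amp_one, amp_one] at this

end B8
end OSX

namespace OSX
open Filter Topology
open scoped TensorProduct InnerProduct
section B9
variable {H H₁ H₂ K₁ K₂ T₁ T₂ : Type*}
  [NormedAddCommGroup H] [InnerProductSpace ℂ H] [CompleteSpace H]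
  [NormedAddCommGroup H₁] [InnerProductSpace ℂ H₁] [CompleteSpace H₁]
  [NormedAddCommGroup H₂] [InnerProductSpace ℂ H₂] [CompleteSpace H₂]
  [NormedAddCommGroup K₁] [InnerProductSpace ℂ K₁] [CompleteSpace K₁]
  [NormedAddCommGroup K₂] [InnerProductSpace ℂ K₂] [CompleteSpace K₂]
  [NormedAddCommGroup T₁] [InnerProductSpace ℂ T₁] [CompleteSpace T₁]
  [NormedAddCommGroup T₂] [InnerProductSpace ℂ T₂] [CompleteSpace T₂]
  {t₁ : H₁ → K₁ → T₁} {t₂ : H₂ → K₂ → T₂}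
  (ht₁ : IsTensorEmbedding t₁) (ht₂ : IsTensorEmbedding t₂)

/-- set of projection pairs in `D₁ × D₂` -/
def PPs (D₁ : StarSubalgebra ℂ (H₁ →L[ℂ] H₁)) (D₂ : StarSubalgebra ℂ (H₂ →L[ℂ] H₂)) :
    Set ((H₁ →L[ℂ] H₁) × (H₂ →L[ℂ] H₂)) :=
  {c | c.1 ∈ D₁ ∧ c.2 ∈ D₂ ∧ (c.1)† = c.1 ∧ (c.2)† = c.2 ∧ c * c = c}

theorem masa_comm {D : StarSubalgebra ℂ (H →L[ℂ] H)} (hD : IsMasa D) {a b : H →L[ℂ] H} (ha : a ∈ D) (hb : b ∈ D) :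
    a * b = b * a := hD.1 a ha b hb

theorem masa_mem {D : StarSubalgebra ℂ (H →L[ℂ] H)} (hD : IsMasa D) {p : H →L[ℂ] H} (hp : p† = p)
    (hc : ∀ a ∈ D, a * p = p * a) : p ∈ D := by
  have hs : ∀ a ∈ (D : Set (H →L[ℂ] H)) ∪ {p}, ∀ b ∈ (D : Set (H →L[ℂ] H)) ∪ {p}, a * b = b * a := by
    rintro a (ha | rfl) b (hb | rfl)
    · exact masa_comm hD ha hb
    · exact hc a ha
    · exact (hc b hb).symm
    · rfl
  have hss : ∀ a ∈ (D : Set (H →L[ℂ] H)) ∪ {p}, ∀ b ∈ (D : Set (H →L[ℂ] H)) ∪ {p}, a * star b = star b * a := by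
    intro a ha b hb
    refine hs a ha _ ?_
    rcases hb with hb | rfl
    · exact Or.inl (star_mem hb)
    · exact Or.inr hp
  let E := StarAlgebra.adjoin ℂ ((D : Set (H →L[ℂ] H)) ∪ {p})
  have hE : E = D := by
    refine hD.2 E ?_ ?_
    · letI := StarAlgebra.adjoinCommRingOfComm ℂ hs hss
      intro a ha b hb
      exact congrArg Subtype.val (mul_comm (⟨a, ha⟩ : E) ⟨b, hb⟩)
    · intro a ha
      exact StarAlgebra.subset_adjoin ℂ _ (Or.inl ha)
  rw [← hE]
  exact StarAlgebra.subset_adjoin ℂ _ (Or.inr rfl)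

theorem fub3 [TopologicalSpace.SeparableSpace H₁] [TopologicalSpace.SeparableSpace H₂]
    {D₁ : StarSubalgebra ℂ (H₁ →L[ℂ] H₁)} {D₂ : StarSubalgebra ℂ (H₂ →L[ℂ] H₂)}
    (hD₁ : IsMasa D₁) (hD₂ : IsMasa D₂)
    {S : Set ((H₁ →L[ℂ] H₁) × (H₂ →L[ℂ] H₂))} (hS : S ⊆ PPs D₁ D₂)
    {L : Submodule ℂ (K₁ →L[ℂ] K₂)} {Y : T₁ →L[ℂ] T₂}
    (hY : ∀ c ∈ S, amp ht₂ c.2 ∘L Y = Y ∘L amp ht₁ c.1) (hYL : ∀ x y, sl ht₁ ht₂ x y Y ∈ L) :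
    Y ∈ wT (t₁ := t₁) (t₂ := t₂) (Nn S) L := by
  let B : Set ((H₁ →L[ℂ] H₁) × (H₂ →L[ℂ] H₂)) := {c | c ∈ PPs D₁ D₂ ∧ ∀ T ∈ Nn S, c.2 ∘L T = T ∘L c.1}
  have hSB : S ⊆ B := fun c hc => ⟨hS hc, fun T hT => hT c hc⟩
  have cm : ∀ c ∈ B, ∀ d ∈ B, c * d = d * c := fun c hc d hd =>
    Prod.ext (masa_comm hD₁ hc.1.1 hd.1.1) (masa_comm hD₂ hc.1.2.1 hd.1.2.1)
  have hB : BoolFam B := by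
    refine ⟨⟨⟨one_mem _, one_mem _, star_one _, star_one _, one_mul 1⟩, fun T hT => rfl⟩, ?_, ?_, cm,
      fun c hc => hc.1.2.2.2.2, fun c hc => hc.1.2.2.1, fun c hc => hc.1.2.2.2.1⟩
    · rintro c ⟨⟨h1, h2, h3, h4, h5⟩, h6⟩
      refine ⟨⟨sub_mem (one_mem _) h1, sub_mem (one_mem _) h2, ?_, ?_, ?_⟩, fun T hT => ?_⟩
      · change star (1 - c.1) = 1 - c.1
        rw [star_sub, star_one]; congr 1
      · change star (1 - c.2) = 1 - c.2
        rw [star_sub, star_one]; congr 1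
      · rw [mul_sub, mul_one, sub_mul, one_mul, h5]; simp
      · change (1 - c.2) ∘L T = T ∘L (1 - c.1)
        rw [ContinuousLinearMap.sub_comp, ContinuousLinearMap.comp_sub, h6 T hT]; rfl
    · rintro c hc d hd
      have hcd := cm c hc d hd
      obtain ⟨⟨h1, h2, h3, h4, h5⟩, h6⟩ := hc
      obtain ⟨⟨g1, g2, g3, g4, g5⟩, g6⟩ := hd
      refine ⟨⟨mul_mem h1 g1, mul_mem h2 g2, ?_, ?_, ?_⟩, fun T hT => ?_⟩
      · change star (c.1 * d.1) = c.1 * d.1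
        rw [star_mul]
        have a : star c.1 = c.1 := h3
        have b : star d.1 = d.1 := g3
        rw [a, b]; exact (congrArg Prod.fst hcd).symm
      · change star (c.2 * d.2) = c.2 * d.2
        rw [star_mul]
        have a : star c.2 = c.2 := h4
        have b : star d.2 = d.2 := g4
        rw [a, b]; exact (congrArg Prod.snd hcd).symm
      · rw [mul_assoc, ← mul_assoc d c d, ← hcd, mul_assoc c d d, g5, ← mul_assoc, h5]
      · change (c.2 ∘L d.2) ∘L T = T ∘L (c.1 ∘L d.1)
        rw [ContinuousLinearMap.comp_assoc, g6 T hT, ← ContinuousLinearMap.comp_assoc, h6 T hT,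
          ContinuousLinearMap.comp_assoc]
  have hNn : Nn B ⊆ Nn S := fun T hT c hc => hT c (hSB hc)
  refine wT_mono hNn subset_rfl (fub2 ht₁ ht₂ hB (L := L) ⟨fun c hc => ?_, hYL⟩)
  refine ext_sr ht₁ ht₂ fun k k' => ?_
  have h1 := sr_amp ht₁ ht₂ k k' Y 1 c.2
  have h2 := sr_amp ht₁ ht₂ k k' Y c.1 1
  rw [amp_one] at h1 h2
  simp only [ContinuousLinearMap.one_def, ContinuousLinearMap.comp_id, ContinuousLinearMap.id_comp] at h1 h2
  rw [h1, h2]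
  exact hc.2 _ (sr_mem_Nn ht₁ ht₂ hY k k')

/-- diagonal compression -/
def phi (c : (H₁ →L[ℂ] H₁) × (H₂ →L[ℂ] H₂)) (X : H₁ →L[ℂ] H₂) : H₁ →L[ℂ] H₂ :=
  c.2 ∘L X ∘L c.1 + (1 - c.2) ∘L X ∘L (1 - c.1)

theorem refl_norm {q : H →L[ℂ] H} (h1 : q† = q) (h2 : q * q = q) : ‖(2 : ℂ) • q - 1‖ ≤ 1 := by
  have h : star ((2 : ℂ) • q - 1) * ((2 : ℂ) • q - 1) = 1 := by
    have h1' : star q = q := h1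
    have h2' : star (2 : ℂ) = 2 := by simp
    rw [star_sub, star_smul, star_one, h1', h2', mul_sub, sub_mul, sub_mul, smul_mul_smul_comm, h2]
    rw [mul_one, mul_one, one_mul]
    module
  have h3 := CStarRing.norm_star_mul_self (x := (2 : ℂ) • q - 1)
  rw [h] at h3
  have h4 : ‖(1 : H →L[ℂ] H)‖ ≤ 1 := ContinuousLinearMap.norm_id_le
  nlinarith [norm_nonneg ((2 : ℂ) • q - 1)]

theorem phi_norm {c : (H₁ →L[ℂ] H₁) × (H₂ →L[ℂ] H₂)} (h1 : (c.1)† = c.1) (h2 : (c.2)† = c.2) (h3 : c * c = c)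
    (X : H₁ →L[ℂ] H₂) : ‖phi c X‖ ≤ ‖X‖ := by
  have e : phi c X = (1 / 2 : ℂ) • (X + ((2 : ℂ) • c.2 - 1) ∘L X ∘L ((2 : ℂ) • c.1 - 1)) := by
    ext x
    simp [phi]
    module
  have n1 := refl_norm h1 (congrArg Prod.fst h3)
  have n2 := refl_norm h2 (congrArg Prod.snd h3)
  rw [e, norm_smul]
  have : ‖((2 : ℂ) • c.2 - 1) ∘L X ∘L ((2 : ℂ) • c.1 - 1)‖ ≤ ‖X‖ := by
    refine (ContinuousLinearMap.opNorm_comp_le _ _).trans ((mul_le_of_le_one_left (norm_nonneg _) n2).trans ?_)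
    exact (ContinuousLinearMap.opNorm_comp_le _ _).trans (mul_le_of_le_one_right (norm_nonneg _) n1)
  have h5 := norm_add_le X (((2 : ℂ) • c.2 - 1) ∘L X ∘L ((2 : ℂ) • c.1 - 1))
  have : ‖(1 / 2 : ℂ)‖ = 1 / 2 := by simp
  rw [this]
  linarith

theorem exists_fix {B : Set ((H₁ →L[ℂ] H₁) × (H₂ →L[ℂ] H₂))}
    (hB : ∀ c ∈ B, (c.1)† = c.1 ∧ (c.2)† = c.2 ∧ c * c = c) (hcm : ∀ c ∈ B, ∀ d ∈ B, c * d = d * c)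
    {G : Set (H₁ →L[ℂ] H₂)} (hG : WkClosed G) (hGs : ∀ X ∈ G, ∀ c ∈ B, phi c X ∈ G)
    {Z : Submodule ℂ (H₁ →L[ℂ] H₂)} (hZ : WkClosed (Z : Set (H₁ →L[ℂ] H₂)))
    (hd : ∀ X ∈ G, ∀ c ∈ B, X - phi c X ∈ Z) {X : H₁ →L[ℂ] H₂} (hX : X ∈ G) :
    ∃ Y ∈ G, X - Y ∈ Z ∧ ∀ c ∈ B, c.2 ∘L Y = Y ∘L c.1 := by
  classical
  have fin : ∀ s : Finset B, ∃ Y ∈ G, X - Y ∈ Z ∧ ‖Y‖ ≤ ‖X‖ ∧ ∀ c ∈ s, c.1.2 ∘L Y = Y ∘L c.1.1 := by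
    intro s
    induction s using Finset.induction_on with
    | empty => exact ⟨X, hX, by simp, le_rfl, by simp⟩
    | insert d s hds ih =>
      obtain ⟨Y, h1, h2, h3, h4⟩ := ih
      obtain ⟨d, hdB⟩ := d
      obtain ⟨p1, p2, p3⟩ := hB d hdB
      refine ⟨phi d Y, hGs Y h1 d hdB, ?_, (phi_norm p1 p2 p3 Y).trans h3, ?_⟩
      · have := Z.add_mem h2 (hd Y h1 d hdB)
        rwa [sub_add_sub_cancel] at this
      · intro c hc
        rw [Finset.mem_insert] at hc
        rcases hc with rfl | hc
        · have i1 : ∀ x, d.1 (d.1 x) = d.1 x := fun x => DFunLike.congr_fun (congrArg Prod.fst p3) x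
          have i2 : ∀ x, d.2 (d.2 x) = d.2 x := fun x => DFunLike.congr_fun (congrArg Prod.snd p3) x
          ext x
          simp [phi, i1, i2]
        · have c1 : ∀ x, c.1.1 (d.1 x) = d.1 (c.1.1 x) := fun x =>
            DFunLike.congr_fun (congrArg Prod.fst (hcm c.1 c.2 d hdB)) x
          have c2 : ∀ x, c.1.2 (d.2 x) = d.2 (c.1.2 x) := fun x =>
            DFunLike.congr_fun (congrArg Prod.snd (hcm c.1 c.2 d hdB)) x
          have c3 : ∀ x, c.1.2 (Y x) = Y (c.1.1 x) := fun x => DFunLike.congr_fun (h4 c hc) x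
          ext x
          simp [phi, c1, c2, c3]
  choose f f1 f2 f3 f4 using fin
  obtain ⟨Y, -, hY⟩ := exists_ultra_lim (Ultrafilter.of (atTop : Filter (Finset B))) f (norm_nonneg X) f3
  refine ⟨Y, hG.mem_of hY (Eventually.of_forall f1), hZ.mem_of ((WkT.const _ X).sub hY) (Eventually.of_forall f2),
    fun c hc => ?_⟩
  have hl := (hY.comp c.2 (1 : H₁ →L[ℂ] H₁)).sub (hY.comp (1 : H₂ →L[ℂ] H₂) c.1)
  have := wkClosed_singleton_zero.mem_of hl ?_
  · exact sub_eq_zero.1 this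
  · have := (eventually_ge_atTop ({⟨c, hc⟩} : Finset B)).filter_mono (Ultrafilter.of_le (atTop : Filter (Finset B)))
    filter_upwards [this] with s hs
    exact sub_eq_zero.2 (f4 s ⟨c, hc⟩ (hs (by simp)))

end B9
end OSX

namespace OSX
open Filter Topology
open scoped TensorProduct InnerProduct
section B10
variable {H₁ H₂ K₁ K₂ T₁ T₂ : Type*}
  [NormedAddCommGroup H₁] [InnerProductSpace ℂ H₁] [CompleteSpace H₁]
  [NormedAddCommGroup H₂] [InnerProductSpace ℂ H₂] [CompleteSpace H₂]
  [NormedAddCommGroup K₁] [InnerProductSpace ℂ K₁] [CompleteSpace K₁]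
  [NormedAddCommGroup K₂] [InnerProductSpace ℂ K₂] [CompleteSpace K₂]
  [NormedAddCommGroup T₁] [InnerProductSpace ℂ T₁] [CompleteSpace T₁]
  [NormedAddCommGroup T₂] [InnerProductSpace ℂ T₂] [CompleteSpace T₂]
  {t₁ : H₁ → K₁ → T₁} {t₂ : H₂ → K₂ → T₂}
  (ht₁ : IsTensorEmbedding t₁) (ht₂ : IsTensorEmbedding t₂)
  (D₁ : StarSubalgebra ℂ (H₁ →L[ℂ] H₁)) (D₂ : StarSubalgebra ℂ (H₂ →L[ℂ] H₂))

/-- stability under compression -/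
def Stab (A : Submodule ℂ (T₁ →L[ℂ] T₂)) : Prop :=
  ∀ P ∈ D₁, ∀ Q ∈ D₂, ∀ a ∈ A, amp ht₂ Q ∘L a ∘L amp ht₁ P ∈ A

structure Good (E : Submodule ℂ (T₁ →L[ℂ] T₂)) (S : Set ((H₁ →L[ℂ] H₁) × (H₂ →L[ℂ] H₂)))
    (A : Submodule ℂ (T₁ →L[ℂ] T₂)) (U : Submodule ℂ (K₁ →L[ℂ] K₂))
    (todo : List (Set ((H₁ →L[ℂ] H₁) × (H₂ →L[ℂ] H₂)))) : Prop where
  stab : Stab ht₁ ht₂ D₁ D₂ A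
  cl : WkClosed (U : Set (K₁ →L[ℂ] K₂))
  pp : ∀ C ∈ todo, C ⊆ PPs D₁ D₂
  tri : ∀ C ∈ todo, ∀ c ∈ C, ∀ a ∈ A, amp ht₂ (1 - c.2) ∘L a ∘L amp ht₁ c.1 = 0
  fin : ∀ S', S ⊆ S' → S' ⊆ PPs D₁ D₂ →
    (∀ C ∈ todo, C ⊆ S' ∨ ∃ c ∈ C, ((1 : H₁ →L[ℂ] H₁), c.2) ∈ S' ∧ (c.1, (0 : H₂ →L[ℂ] H₂)) ∈ S') →
    wT (t₁ := t₁) (t₂ := t₂) (Nn S') U ≤ E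
  slc : ∀ a ∈ A, ∀ x y, sl ht₁ ht₂ x y a ∈ U

variable {D₁ D₂} {E : Submodule ℂ (T₁ →L[ℂ] T₂)} {S S' : Set ((H₁ →L[ℂ] H₁) × (H₂ →L[ℂ] H₂))}
    {A A' : Submodule ℂ (T₁ →L[ℂ] T₂)} {U U' : Submodule ℂ (K₁ →L[ℂ] K₂)}
    {todo : List (Set ((H₁ →L[ℂ] H₁) × (H₂ →L[ℂ] H₂)))} {C : Set ((H₁ →L[ℂ] H₁) × (H₂ →L[ℂ] H₂))}

theorem Good.mono (h : Good ht₁ ht₂ D₁ D₂ E S A U todo) (hS : S ⊆ S') : Good ht₁ ht₂ D₁ D₂ E S' A U todo :=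
  ⟨h.stab, h.cl, h.pp, h.tri, fun S'' h1 => h.fin S'' (hS.trans h1), h.slc⟩

theorem Good.tail (h : Good ht₁ ht₂ D₁ D₂ E S A U (C :: todo)) (hS : S ⊆ S')
    (hC : C ⊆ S' ∨ ∃ c ∈ C, ((1 : H₁ →L[ℂ] H₁), c.2) ∈ S' ∧ (c.1, (0 : H₂ →L[ℂ] H₂)) ∈ S') :
    Good ht₁ ht₂ D₁ D₂ E S' A U todo :=
  ⟨h.stab, h.cl, fun C hC => h.pp C (List.mem_cons_of_mem _ hC), fun C hC => h.tri C (List.mem_cons_of_mem _ hC),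
    fun S'' h1 h2 h3 => h.fin S'' (hS.trans h1) h2 (by
      intro C' hC'
      rcases List.mem_cons.1 hC' with rfl | hC'
      · rcases hC with hC | ⟨c, hc, h4, h5⟩
        · exact Or.inl (hC.trans h1)
        · exact Or.inr ⟨c, hc, h1 h4, h1 h5⟩
      · exact h3 C' hC'), h.slc⟩

theorem Stab.sup (h : Stab ht₁ ht₂ D₁ D₂ A) (h' : Stab ht₁ ht₂ D₁ D₂ A') : Stab ht₁ ht₂ D₁ D₂ (A ⊔ A') := by
  intro P hP Q hQ a ha
  obtain ⟨b, hb, c, hc, rfl⟩ := Submodule.mem_sup.1 ha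
  rw [ContinuousLinearMap.add_comp, ContinuousLinearMap.comp_add]
  exact Submodule.mem_sup.2 ⟨_, h P hP Q hQ b hb, _, h' P hP Q hQ c hc, rfl⟩

theorem Stab.wkcl (h : Stab ht₁ ht₂ D₁ D₂ A) : Stab ht₁ ht₂ D₁ D₂ (wkcl A) := by
  intro P hP Q hQ a ha
  exact (wkC_comp (amp ht₂ Q) (amp ht₁ P)).mem_closure (S := A)
    (fun X hX => le_wkcl A (h P hP Q hQ X hX)) (wkcl_closed A) ha

theorem Good.merge (hE : WkClosed (E : Set (T₁ →L[ℂ] T₂))) (h : Good ht₁ ht₂ D₁ D₂ E S A U [])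
    (h' : Good ht₁ ht₂ D₁ D₂ E S A' U' []) : Good ht₁ ht₂ D₁ D₂ E S (A ⊔ A') (wkcl (U ⊔ U')) [] := by
  refine ⟨h.stab.sup _ _ h'.stab, wkcl_closed _, by simp, by simp, fun S' h1 h2 _ => ?_, ?_⟩
  · refine wT_le ht₁ ht₂ hE (wT_wkcl ht₁ ht₂ hE ?_)
    intro T hT R hR
    obtain ⟨R1, hR1, R2, hR2, rfl⟩ := Submodule.mem_sup.1 hR
    rw [tens_add_right]
    exact E.add_mem (h.fin S' h1 h2 (by simp) (tens_mem_wT ht₁ ht₂ hT hR1))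
      (h'.fin S' h1 h2 (by simp) (tens_mem_wT ht₁ ht₂ hT hR2))
  · intro a ha x y
    obtain ⟨b, hb, c, hc, rfl⟩ := Submodule.mem_sup.1 ha
    have : sl ht₁ ht₂ x y (b + c) = sl ht₁ ht₂ x y b + sl ht₁ ht₂ x y c := by
      simp [sl]
    rw [this]
    exact le_wkcl _ (Submodule.mem_sup.2 ⟨_, h.slc b hb x y, _, h'.slc c hc x y, rfl⟩)

def sumA (l : List (Submodule ℂ (T₁ →L[ℂ] T₂) × Submodule ℂ (K₁ →L[ℂ] K₂) ×
    List (Set ((H₁ →L[ℂ] H₁) × (H₂ →L[ℂ] H₂))))) : Submodule ℂ (T₁ →L[ℂ] T₂) :=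
  l.foldr (fun t s => t.1 ⊔ s) ⊥

def Itw (S : Set ((H₁ →L[ℂ] H₁) × (H₂ →L[ℂ] H₂))) : Set (T₁ →L[ℂ] T₂) :=
  {X | ∀ c ∈ S, amp ht₂ c.2 ∘L X = X ∘L amp ht₁ c.1}

theorem Itw_closed : WkClosed (Itw ht₁ ht₂ S) := by
  apply wkClosed_of
  intro F X h1 h2 h3 c hc
  have hl := (h3.comp (amp ht₂ c.2) (1 : T₁ →L[ℂ] T₁)).sub (h3.comp (1 : T₂ →L[ℂ] T₂) (amp ht₁ c.1))
  have := wkClosed_singleton_zero.mem_of hl (by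
    filter_upwards [h2] with Y hY
    exact sub_eq_zero.2 (hY c hc))
  exact sub_eq_zero.1 this

theorem Itw_comp {P : H₁ →L[ℂ] H₁} {Q : H₂ →L[ℂ] H₂} (hP : ∀ c ∈ S, c.1 * P = P * c.1)
    (hQ : ∀ c ∈ S, c.2 * Q = Q * c.2) {X : T₁ →L[ℂ] T₂} (hX : X ∈ Itw ht₁ ht₂ S) :
    amp ht₂ Q ∘L X ∘L amp ht₁ P ∈ Itw ht₁ ht₂ S := by
  intro c hc
  have h1 : ∀ z, amp ht₁ c.1 (amp ht₁ P z) = amp ht₁ P (amp ht₁ c.1 z) := fun z =>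
    DFunLike.congr_fun ((amp_mul ht₁ _ _).symm.trans ((congrArg (amp ht₁) (hP c hc)).trans (amp_mul ht₁ _ _))) z
  have h2 : ∀ z, amp ht₂ c.2 (amp ht₂ Q z) = amp ht₂ Q (amp ht₂ c.2 z) := fun z =>
    DFunLike.congr_fun ((amp_mul ht₂ _ _).symm.trans ((congrArg (amp ht₂) (hQ c hc)).trans (amp_mul ht₂ _ _))) z
  have h3 : ∀ z, amp ht₂ c.2 (X z) = X (amp ht₁ c.1 z) := fun z => DFunLike.congr_fun (hX c hc) z
  refine ContinuousLinearMap.ext fun z => ?_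
  simp only [ContinuousLinearMap.comp_apply]
  rw [h2, h3, h1]

theorem Itw_add {X Y : T₁ →L[ℂ] T₂} (hX : X ∈ Itw ht₁ ht₂ S) (hY : Y ∈ Itw ht₁ ht₂ S) : X + Y ∈ Itw ht₁ ht₂ S := by
  intro c hc
  rw [ContinuousLinearMap.comp_add, ContinuousLinearMap.add_comp, hX c hc, hY c hc]

theorem phi_amp (c : (H₁ →L[ℂ] H₁) × (H₂ →L[ℂ] H₂)) (X : T₁ →L[ℂ] T₂) :
    phi (amp ht₁ c.1, amp ht₂ c.2) X = amp ht₂ c.2 ∘L X ∘L amp ht₁ c.1 +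
      amp ht₂ (1 - c.2) ∘L X ∘L amp ht₁ (1 - c.1) := by
  rw [amp_sub, amp_sub, amp_one, amp_one]; rfl

theorem sub_phi_amp (c : (H₁ →L[ℂ] H₁) × (H₂ →L[ℂ] H₂)) (X : T₁ →L[ℂ] T₂) :
    X - phi (amp ht₁ c.1, amp ht₂ c.2) X = amp ht₂ c.2 ∘L X ∘L amp ht₁ (1 - c.1) +
      amp ht₂ (1 - c.2) ∘L X ∘L amp ht₁ c.1 := by
  rw [amp_sub, amp_sub, amp_one, amp_one]
  refine ContinuousLinearMap.ext fun z => ?_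
  simp [phi]
  abel

theorem amp_fix (hD₁ : IsMasa D₁) (hD₂ : IsMasa D₂) (hC : C ⊆ PPs D₁ D₂)
    {G : Set (T₁ →L[ℂ] T₂)} (hG : WkClosed G)
    (hGs : ∀ X ∈ G, ∀ c ∈ C, phi (amp ht₁ c.1, amp ht₂ c.2) X ∈ G)
    {Z : Submodule ℂ (T₁ →L[ℂ] T₂)} (hZ : WkClosed (Z : Set (T₁ →L[ℂ] T₂)))
    (hd : ∀ X ∈ G, ∀ c ∈ C, X - phi (amp ht₁ c.1, amp ht₂ c.2) X ∈ Z) {X : T₁ →L[ℂ] T₂} (hX : X ∈ G) :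
    ∃ Y ∈ G, X - Y ∈ Z ∧ Y ∈ Itw ht₁ ht₂ C := by
  let f : (H₁ →L[ℂ] H₁) × (H₂ →L[ℂ] H₂) → (T₁ →L[ℂ] T₁) × (T₂ →L[ℂ] T₂) := fun c => (amp ht₁ c.1, amp ht₂ c.2)
  suffices h : ∃ Y ∈ G, X - Y ∈ Z ∧ ∀ c ∈ f '' C, c.2 ∘L Y = Y ∘L c.1 by
    obtain ⟨Y, h1, h2, h3⟩ := h
    exact ⟨Y, h1, h2, fun c hc => h3 (f c) (mem_image_of_mem f hc)⟩
  refine exists_fix ?_ ?_ hG ?_ hZ ?_ hX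
  · rintro _ ⟨c, hc, rfl⟩
    obtain ⟨-, -, a3, a4, a5⟩ := hC hc
    refine ⟨?_, ?_, Prod.ext ?_ ?_⟩
    · exact (amp_star ht₁ _).trans (congrArg _ a3)
    · exact (amp_star ht₂ _).trans (congrArg _ a4)
    · exact (amp_mul ht₁ _ _).symm.trans (congrArg _ (congrArg Prod.fst a5))
    · exact (amp_mul ht₂ _ _).symm.trans (congrArg _ (congrArg Prod.snd a5))
  · rintro _ ⟨c, hc, rfl⟩ _ ⟨d, hd, rfl⟩
    refine Prod.ext ?_ ?_
    · exact (amp_mul ht₁ _ _).symm.trans ((congrArg _ (masa_comm hD₁ (hC hc).1 (hC hd).1)).trans (amp_mul ht₁ _ _))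
    · exact (amp_mul ht₂ _ _).symm.trans ((congrArg _ (masa_comm hD₂ (hC hc).2.1 (hC hd).2.1)).trans (amp_mul ht₂ _ _))
  · rintro X hX _ ⟨c, hc, rfl⟩
    exact hGs X hX c hc
  · rintro X hX _ ⟨c, hc, rfl⟩
    exact hd X hX c hc

theorem Stab.sumA {l : List (Submodule ℂ (T₁ →L[ℂ] T₂) × Submodule ℂ (K₁ →L[ℂ] K₂) ×
    List (Set ((H₁ →L[ℂ] H₁) × (H₂ →L[ℂ] H₂))))} (h : ∀ t ∈ l, Stab ht₁ ht₂ D₁ D₂ t.1) :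
    Stab ht₁ ht₂ D₁ D₂ (sumA l) := by
  induction l with
  | nil =>
    intro P hP Q hQ a ha
    have : a = 0 := ha
    rw [this]; simp
  | cons t l ih =>
    exact Stab.sup _ _ (h t (by simp)) (ih fun t ht => h t (List.mem_cons_of_mem _ ht))

theorem recur [TopologicalSpace.SeparableSpace H₁] [TopologicalSpace.SeparableSpace H₂]
    (hD₁ : IsMasa D₁) (hD₂ : IsMasa D₂) (hE : WkClosed (E : Set (T₁ →L[ℂ] T₂)))
    (l : List (Submodule ℂ (T₁ →L[ℂ] T₂) × Submodule ℂ (K₁ →L[ℂ] K₂) ×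
      List (Set ((H₁ →L[ℂ] H₁) × (H₂ →L[ℂ] H₂))))) :
    ∀ S ⊆ PPs D₁ D₂, ∀ A U, Good ht₁ ht₂ D₁ D₂ E S A U [] →
    (∀ t ∈ l, Good ht₁ ht₂ D₁ D₂ E S t.1 t.2.1 t.2.2) → ∀ X ∈ Itw ht₁ ht₂ S, X ∈ wkcl (A ⊔ sumA l) → X ∈ E := by
  induction l with
  | nil =>
    intro S hS A U hA _ X hX hXA
    have hXA : X ∈ wkcl A := by simpa [sumA] using hXA
    refine hA.fin S subset_rfl hS (by simp) (fub3 ht₁ ht₂ hD₁ hD₂ hS hX fun x y => ?_)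
    exact (sl_wkC ht₁ ht₂ x y).mem_closure (S := A) (fun a ha => hA.slc a ha x y) hA.cl hXA
  | cons t l ih =>
    obtain ⟨A', U', todo⟩ := t
    induction todo with
    | nil =>
      intro S hS A U hA hl X hX hXA
      refine ih S hS (A ⊔ A') (wkcl (U ⊔ U')) (hA.merge ht₁ ht₂ hE (hl _ List.mem_cons_self))
        (fun t ht => hl t (List.mem_cons_of_mem _ ht)) X hX ?_
      rw [sup_assoc]; exact hXA
    | cons C todo ih2 =>
      intro S hS A U hA hl X hX hXA
      have hh : Good ht₁ ht₂ D₁ D₂ E S A' U' (C :: todo) := hl _ List.mem_cons_self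
      have hl' : ∀ t ∈ l, Good ht₁ ht₂ D₁ D₂ E S t.1 t.2.1 t.2.2 := fun t ht => hl t (List.mem_cons_of_mem _ ht)
      have hC : C ⊆ PPs D₁ D₂ := hh.pp C List.mem_cons_self
      set F := A ⊔ sumA ((A', U', C :: todo) :: l) with hF
      have hstl : Stab ht₁ ht₂ D₁ D₂ (sumA l) := Stab.sumA _ _ fun t ht => (hl' t ht).stab
      have hst : Stab ht₁ ht₂ D₁ D₂ (wkcl F) :=
        Stab.wkcl _ _ (Stab.sup _ _ hA.stab (Stab.sup _ _ hh.stab hstl))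
      have step : ∀ S', S ⊆ S' → S' ⊆ PPs D₁ D₂ →
          (C ⊆ S' ∨ ∃ c ∈ C, ((1 : H₁ →L[ℂ] H₁), c.2) ∈ S' ∧ (c.1, (0 : H₂ →L[ℂ] H₂)) ∈ S') →
          ∀ X ∈ Itw ht₁ ht₂ S', X ∈ wkcl F → X ∈ E := by
        intro S' h1 h2 h3 X hX hXF
        refine ih2 S' h2 A U (hA.mono ht₁ ht₂ h1) (fun t ht => ?_) X hX hXF
        rcases List.mem_cons.1 ht with rfl | ht
        · exact hh.tail ht₁ ht₂ h1 h3
        · exact (hl' t ht).mono ht₁ ht₂ h1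
      have m1 : ∀ c ∈ C, 1 - c.1 ∈ D₁ := fun c hc => sub_mem (one_mem _) (hC hc).1
      have m2 : ∀ c ∈ C, 1 - c.2 ∈ D₂ := fun c hc => sub_mem (one_mem _) (hC hc).2.1
      have ic : ∀ P ∈ D₁, ∀ Q ∈ D₂, ∀ X ∈ Itw ht₁ ht₂ S, amp ht₂ Q ∘L X ∘L amp ht₁ P ∈ Itw ht₁ ht₂ S :=
        fun P hP Q hQ X hX => Itw_comp _ _ (fun d hd => masa_comm hD₁ (hS hd).1 hP)
          (fun d hd => masa_comm hD₂ (hS hd).2.1 hQ) hX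
      refine Exists.elim (amp_fix ht₁ ht₂ hD₁ hD₂ hC (G := Itw ht₁ ht₂ S ∩ wkcl F)
        ((Itw_closed ht₁ ht₂).inter (wkcl_closed F)) ?_ hE ?_ ⟨hX, hXA⟩) ?_
      · rintro X ⟨hX1, hX2⟩ c hc
        rw [phi_amp]
        exact ⟨Itw_add _ _ (ic _ (hC hc).1 _ (hC hc).2.1 X hX1) (ic _ (m1 c hc) _ (m2 c hc) X hX1),
          (wkcl F).add_mem (hst _ (hC hc).1 _ (hC hc).2.1 X hX2) (hst _ (m1 c hc) _ (m2 c hc) X hX2)⟩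
      on_goal 2 =>
        rintro Y ⟨⟨hY1, hY2⟩, hYE, hYC⟩
        have : Y ∈ E := by
          refine step (S ∪ C) subset_union_left (union_subset hS hC) (Or.inl subset_union_right) Y ?_ hY2
          rintro c (hc | hc)
          · exact hY1 c hc
          · exact hYC c hc
        have := E.add_mem hYE this
        rwa [sub_add_cancel] at this
      · rintro X ⟨hX1, hX2⟩ c hc
        rw [sub_phi_amp]
        obtain ⟨q1, q2, q3, q4, q5⟩ := hC hc
        have q51 : c.1 * c.1 = c.1 := congrArg Prod.fst q5
        have q52 : c.2 * c.2 = c.2 := congrArg Prod.snd q5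
        refine E.add_mem ?_ ?_
        · refine step (S ∪ {((1 : H₁ →L[ℂ] H₁), c.2), (c.1, (0 : H₂ →L[ℂ] H₂))}) subset_union_left ?_
            (Or.inr ⟨c, hc, Or.inr (by simp), Or.inr (by simp)⟩) _ ?_ (hst _ (m1 c hc) _ q2 X hX2)
          · refine union_subset hS ?_
            rintro d (rfl | rfl)
            · exact ⟨one_mem _, q2, star_one _, q4, Prod.ext (one_mul 1) q52⟩
            · exact ⟨q1, zero_mem _, q3, star_zero _, Prod.ext q51 (mul_zero 0)⟩
          · have k1 := ic _ (m1 c hc) _ q2 X hX1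
            rintro d (hd | rfl | rfl)
            · exact k1 d hd
            · change amp ht₂ c.2 ∘L (amp ht₂ c.2 ∘L X ∘L amp ht₁ (1 - c.1)) =
                (amp ht₂ c.2 ∘L X ∘L amp ht₁ (1 - c.1)) ∘L amp ht₁ 1
              rw [← ContinuousLinearMap.comp_assoc, ← ContinuousLinearMap.mul_def, ← amp_mul, q52, amp_one]
              exact (ContinuousLinearMap.comp_id _).symm
            · change amp ht₂ 0 ∘L (amp ht₂ c.2 ∘L X ∘L amp ht₁ (1 - c.1)) =
                (amp ht₂ c.2 ∘L X ∘L amp ht₁ (1 - c.1)) ∘L amp ht₁ c.1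
              have : (1 - c.1) * c.1 = 0 := by rw [sub_mul, one_mul, q51, sub_self]
              rw [amp_zero, ContinuousLinearMap.zero_comp, ContinuousLinearMap.comp_assoc, ContinuousLinearMap.comp_assoc,
                ← ContinuousLinearMap.mul_def, ← amp_mul, this, amp_zero, ContinuousLinearMap.comp_zero,
                ContinuousLinearMap.comp_zero]
        · refine ih S hS A U hA hl' _ (ic _ q1 _ (m2 c hc) X hX1) ?_
          refine (wkC_comp (amp ht₂ (1 - c.2)) (amp ht₁ c.1)).mem_closure (S := F) (fun a ha => ?_) (wkcl_closed _) hX2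
          have ha : a ∈ A ⊔ (A' ⊔ sumA l) := ha
          obtain ⟨a1, ha1, b, hb, rfl⟩ := Submodule.mem_sup.1 ha
          obtain ⟨a2, ha2, a3, ha3, rfl⟩ := Submodule.mem_sup.1 hb
          refine le_wkcl _ (Submodule.mem_sup.2 ⟨_, hA.stab _ q1 _ (m2 c hc) a1 ha1, _, hstl _ q1 _ (m2 c hc) a3 ha3, ?_⟩)
          have := hh.tri C List.mem_cons_self c hc a2 ha2
          simp only [ContinuousLinearMap.add_comp, ContinuousLinearMap.comp_add, this, zero_add]

end B10
end OSX

namespace OSX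
open Filter Topology
open scoped TensorProduct InnerProduct
section B11
variable {H₁ H₂ K₁ K₂ T₁ T₂ : Type*}
  [NormedAddCommGroup H₁] [InnerProductSpace ℂ H₁] [CompleteSpace H₁]
  [NormedAddCommGroup H₂] [InnerProductSpace ℂ H₂] [CompleteSpace H₂]
  [NormedAddCommGroup K₁] [InnerProductSpace ℂ K₁] [CompleteSpace K₁]
  [NormedAddCommGroup K₂] [InnerProductSpace ℂ K₂] [CompleteSpace K₂]
  [NormedAddCommGroup T₁] [InnerProductSpace ℂ T₁] [CompleteSpace T₁]
  [NormedAddCommGroup T₂] [InnerProductSpace ℂ T₂] [CompleteSpace T₂]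
  {t₁ : H₁ → K₁ → T₁} {t₂ : H₂ → K₂ → T₂}
  (ht₁ : IsTensorEmbedding t₁) (ht₂ : IsTensorEmbedding t₂)
  (D₁ : StarSubalgebra ℂ (H₁ →L[ℂ] H₁)) (D₂ : StarSubalgebra ℂ (H₂ →L[ℂ] H₂))

structure ChainOK (V : Set (H₁ →L[ℂ] H₂)) (C : Set ((H₁ →L[ℂ] H₁) × (H₂ →L[ℂ] H₂))) : Prop where
  pp : C ⊆ PPs D₁ D₂
  tri : ∀ T ∈ V, ∀ c ∈ C, (1 - c.2) ∘L T ∘L c.1 = 0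
  cor : ∀ c ∈ C, ∀ T : H₁ →L[ℂ] H₂, c.2 ∘L T = T → T ∘L c.1 = 0 → T ∈ V
  dia : Nn C ⊆ V

/-- intertwined pairs -/
def BM (M : Set (H₁ →L[ℂ] H₂)) : Set ((H₁ →L[ℂ] H₁) × (H₂ →L[ℂ] H₂)) :=
  {c | c ∈ PPs D₁ D₂ ∧ ∀ S ∈ M, c.2 ∘L S = S ∘L c.1}

variable {D₁ D₂}

theorem le_sumA {l : List (Submodule ℂ (T₁ →L[ℂ] T₂) × Submodule ℂ (K₁ →L[ℂ] K₂) ×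
    List (Set ((H₁ →L[ℂ] H₁) × (H₂ →L[ℂ] H₂))))} {t} (h : t ∈ l) : t.1 ≤ sumA l := by
  induction l with
  | nil => simp at h
  | cons s l ih =>
    rcases List.mem_cons.1 h with rfl | h
    · exact le_sup_left
    · exact (ih h).trans le_sup_right

theorem wT_stab {V : Set (H₁ →L[ℂ] H₂)} (hV : IsMasaBimodule D₁ D₂ V) (U : Set (K₁ →L[ℂ] K₂)) :
    Stab ht₁ ht₂ D₁ D₂ (wT (t₁ := t₁) (t₂ := t₂) V U) := fun P hP Q hQ _ ha =>
  amp_mem ht₁ ht₂ (fun S hS => hV.2 S hS P hP Q hQ) ha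

theorem wT_kill {V : Set (H₁ →L[ℂ] H₂)} {P : H₁ →L[ℂ] H₁} {Q : H₂ →L[ℂ] H₂} (h : ∀ S ∈ V, Q ∘L S ∘L P = 0)
    {U : Set (K₁ →L[ℂ] K₂)} {a : T₁ →L[ℂ] T₂} (ha : a ∈ wT (t₁ := t₁) (t₂ := t₂) V U) :
    amp ht₂ Q ∘L a ∘L amp ht₁ P = 0 := by
  have h1 := amp_mem ht₁ ht₂ (V' := {0}) (fun S hS => h S hS) ha
  have h2 : wT (t₁ := t₁) (t₂ := t₂) ({0} : Set (H₁ →L[ℂ] H₂)) U ≤ ⊥ := by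
    refine wT_le ht₁ ht₂ (by simpa using wkClosed_singleton_zero) ?_
    rintro S rfl R hR
    have := tens_smul_left ht₁ ht₂ (0 : ℂ) (0 : H₁ →L[ℂ] H₂) R
    rw [zero_smul, zero_smul] at this
    exact this
  exact h2 h1

theorem good_term {V : Set (H₁ →L[ℂ] H₂)} (hV : IsMasaBimodule D₁ D₂ V) {k : ℕ} {Vs : Fin k → Set (H₁ →L[ℂ] H₂)}
    {Cs : Fin k → Set ((H₁ →L[ℂ] H₁) × (H₂ →L[ℂ] H₂))} (hVs : V = ⋂ j, Vs j)
    (hC : ∀ j, ChainOK D₁ D₂ (Vs j) (Cs j)) {U : Submodule ℂ (K₁ →L[ℂ] K₂)} (hU : WkClosed (U : Set (K₁ →L[ℂ] K₂)))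
    {E : Submodule ℂ (T₁ →L[ℂ] T₂)} {S : Set ((H₁ →L[ℂ] H₁) × (H₂ →L[ℂ] H₂))}
    (hE : wT (t₁ := t₁) (t₂ := t₂) (Nn S ∩ V) U ≤ E) :
    Good ht₁ ht₂ D₁ D₂ E S (wT (t₁ := t₁) (t₂ := t₂) V U) U (List.ofFn Cs) := by
  refine ⟨wT_stab ht₁ ht₂ hV _, hU, ?_, ?_, ?_, fun a ha x y => sl_mem ht₁ ht₂ hU ha x y⟩
  · intro C h
    obtain ⟨j, rfl⟩ := (List.mem_ofFn' Cs C).1 h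
    exact (hC j).pp
  · intro C h c hc a ha
    obtain ⟨j, rfl⟩ := (List.mem_ofFn' Cs C).1 h
    refine wT_kill ht₁ ht₂ (fun T hT => (hC j).tri T ?_ c hc) ha
    rw [hVs] at hT
    exact mem_iInter.1 hT j
  · intro S' h1 h2 h3
    refine (wT_mono ?_ subset_rfl).trans hE
    intro T hT
    refine ⟨fun c hc => hT c (h1 hc), ?_⟩
    rw [hVs, mem_iInter]
    intro j
    rcases h3 (Cs j) ((List.mem_ofFn' Cs _).2 ⟨j, rfl⟩) with h | ⟨c, hc, h4, h5⟩
    · exact (hC j).dia fun c hc => hT c (h hc)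
    · refine (hC j).cor c hc T ((hT _ h4).trans (ContinuousLinearMap.comp_id T)) ?_
      exact (hT _ h5).symm.trans (ContinuousLinearMap.zero_comp T)

theorem setSum_eq {r : ℕ} (A : Fin r → Submodule ℂ (T₁ →L[ℂ] T₂)) :
    (setSum fun j => (A j : Set (T₁ →L[ℂ] T₂))) = ((⨆ j, A j : Submodule ℂ (T₁ →L[ℂ] T₂)) : Set (T₁ →L[ℂ] T₂)) := by
  ext X
  constructor
  · rintro ⟨f, hf, rfl⟩
    exact Submodule.sum_mem _ fun j _ => Submodule.mem_iSup_of_mem j (hf j)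
  · intro hX
    refine Submodule.iSup_induction A (motive := fun X => X ∈ setSum fun j => (A j : Set (T₁ →L[ℂ] T₂))) hX ?_ ?_ ?_
    · intro i x hx
      refine ⟨Pi.single i x, fun j => ?_, by simp⟩
      by_cases h : j = i
      · subst h; simpa using hx
      · simp [Pi.single_eq_of_ne h]
    · exact ⟨0, fun j => (A j).zero_mem, by simp⟩
    · rintro _ _ ⟨f, hf, rfl⟩ ⟨g, hg, rfl⟩
      exact ⟨f + g, fun j => (A j).add_mem (hf j) (hg j), by simp [Finset.sum_add_distrib]⟩

theorem Stab.iSup {ι : Sort*} {A : ι → Submodule ℂ (T₁ →L[ℂ] T₂)} (h : ∀ j, Stab ht₁ ht₂ D₁ D₂ (A j)) :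
    Stab ht₁ ht₂ D₁ D₂ (⨆ j, A j) := by
  intro P hP Q hQ a ha
  refine Submodule.iSup_induction A (motive := fun X => amp ht₂ Q ∘L X ∘L amp ht₁ P ∈ ⨆ j, A j) ha ?_ ?_ ?_
  · intro i x hx
    exact Submodule.mem_iSup_of_mem i (h i P hP Q hQ x hx)
  · simp
  · intro x y hx hy
    rw [ContinuousLinearMap.add_comp, ContinuousLinearMap.comp_add]
    exact Submodule.add_mem _ hx hy

theorem iwc_inter {ι : Sort*} {Vs : ι → Set (H₁ →L[ℂ] H₂)} (h : ∀ j, IsMasaBimodule D₁ D₂ (Vs j)) :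
    IsMasaBimodule D₁ D₂ (⋂ j, Vs j) := by
  refine ⟨⟨?_, ?_⟩, ?_⟩
  · choose M hM using fun j => (h j).1.1
    exact ⟨⨅ j, M j, by simp [hM]⟩
  · exact WkClosed.iInter fun j => (h j).1.2
  · intro X hX A hA B hB
    rw [mem_iInter] at *
    exact fun j => (h j).2 X (hX j) A hA B hB

include ht₁ ht₂ in
theorem main [TopologicalSpace.SeparableSpace H₁] [TopologicalSpace.SeparableSpace H₂]
    (hD₁ : IsMasa D₁) (hD₂ : IsMasa D₂)
    (hch : ∀ V : Set (H₁ →L[ℂ] H₂), IsMasaBimodule D₁ D₂ V → IsNestBimodule V → ∃ C, ChainOK D₁ D₂ V C)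
    {r : ℕ} (Bs : Fin r → Set (H₁ →L[ℂ] H₂)) (hBs : ∀ i, HasFiniteWidth D₁ D₂ (Bs i))
    (U : Submodule ℂ (K₁ →L[ℂ] K₂)) (Us : Fin r → Submodule ℂ (K₁ →L[ℂ] K₂))
    (hU : WkClosed (U : Set (K₁ →L[ℂ] K₂))) (hUs : ∀ i, WkClosed (Us i : Set (K₁ →L[ℂ] K₂)))
    (M C : Set (H₁ →L[ℂ] H₂)) (hM : IsMasaBimodule D₁ D₂ M) (hMt : Nn (BM D₁ D₂ M) ⊆ M)
    (hC : HasFiniteWidth D₁ D₂ C) :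
    (wkcl (wT (t₁ := t₁) (t₂ := t₂) M U ⊔ ⨆ j, wT (t₁ := t₁) (t₂ := t₂) (Bs j) (Us j)) : Set (T₁ →L[ℂ] T₂)) ∩
      wkcl (wT (t₁ := t₁) (t₂ := t₂) C U ⊔ ⨆ j, wT (t₁ := t₁) (t₂ := t₂) (Bs j) (Us j)) =
    wkcl (wT (t₁ := t₁) (t₂ := t₂) (M ∩ C) U ⊔ ⨆ j, wT (t₁ := t₁) (t₂ := t₂) (Bs j) (Us j)) := by
  have mb : ∀ V, HasFiniteWidth D₁ D₂ V → IsMasaBimodule D₁ D₂ V := by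
    rintro V ⟨k, Vs, h1, rfl⟩
    exact iwc_inter fun j => (h1 j).1
  set W := ⨆ j, wT (t₁ := t₁) (t₂ := t₂) (Bs j) (Us j) with hW
  set E := wkcl (wT (t₁ := t₁) (t₂ := t₂) (M ∩ C) U ⊔ W) with hEd
  have hE : WkClosed (E : Set (T₁ →L[ℂ] T₂)) := wkcl_closed _
  have hWE : W ≤ E := le_sup_right.trans (le_wkcl _)
  have sW : Stab ht₁ ht₂ D₁ D₂ W := Stab.iSup _ _ fun j => wT_stab ht₁ ht₂ (mb _ (hBs j)) _
  have sM : Stab ht₁ ht₂ D₁ D₂ (wkcl (wT (t₁ := t₁) (t₂ := t₂) M U ⊔ W)) :=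
    Stab.wkcl _ _ (Stab.sup _ _ (wT_stab ht₁ ht₂ hM _) sW)
  have sC : Stab ht₁ ht₂ D₁ D₂ (wkcl (wT (t₁ := t₁) (t₂ := t₂) C U ⊔ W)) :=
    Stab.wkcl _ _ (Stab.sup _ _ (wT_stab ht₁ ht₂ (mb _ hC) _) sW)
  apply Subset.antisymm
  · rintro X ⟨hX1, hX2⟩
    have hBP : BM D₁ D₂ M ⊆ PPs D₁ D₂ := fun c hc => hc.1
    have key : ∃ Y ∈ (wkcl (wT (t₁ := t₁) (t₂ := t₂) M U ⊔ W) : Set (T₁ →L[ℂ] T₂)) ∩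
        wkcl (wT (t₁ := t₁) (t₂ := t₂) C U ⊔ W), X - Y ∈ E ∧ Y ∈ Itw ht₁ ht₂ (BM D₁ D₂ M) := by
      refine amp_fix ht₁ ht₂ hD₁ hD₂ hBP ((wkcl_closed _).inter (wkcl_closed _)) ?_ hE ?_ ⟨hX1, hX2⟩
      · rintro X ⟨h1, h2⟩ c hc
        obtain ⟨⟨q1, q2, q3, q4, q5⟩, -⟩ := hc
        have m1 : 1 - c.1 ∈ D₁ := sub_mem (one_mem _) q1
        have m2 : 1 - c.2 ∈ D₂ := sub_mem (one_mem _) q2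
        rw [phi_amp]
        exact ⟨Submodule.add_mem _ (sM _ q1 _ q2 X h1) (sM _ m1 _ m2 X h1),
          Submodule.add_mem _ (sC _ q1 _ q2 X h2) (sC _ m1 _ m2 X h2)⟩
      · rintro X ⟨h1, h2⟩ c hc
        obtain ⟨⟨q1, q2, q3, q4, q5⟩, q6⟩ := hc
        have m1 : 1 - c.1 ∈ D₁ := sub_mem (one_mem _) q1
        have m2 : 1 - c.2 ∈ D₂ := sub_mem (one_mem _) q2
        have q51 : c.1 * c.1 = c.1 := congrArg Prod.fst q5
        have q52 : c.2 * c.2 = c.2 := congrArg Prod.snd q5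
        rw [sub_phi_amp]
        have z1 : ∀ S ∈ M, c.2 ∘L S ∘L (1 - c.1) = 0 := fun S hS => by
          have : c.1 * (1 - c.1) = 0 := by rw [mul_sub, mul_one, q51, sub_self]
          rw [← ContinuousLinearMap.comp_assoc, q6 S hS, ContinuousLinearMap.comp_assoc, ← ContinuousLinearMap.mul_def,
            this, ContinuousLinearMap.comp_zero]
        have z2 : ∀ S ∈ M, (1 - c.2) ∘L S ∘L c.1 = 0 := fun S hS => by
          have : (1 - c.2) * c.2 = 0 := by rw [sub_mul, one_mul, q52, sub_self]
          rw [← q6 S hS, ← ContinuousLinearMap.comp_assoc, ← ContinuousLinearMap.mul_def,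
            this, ContinuousLinearMap.zero_comp]
        refine E.add_mem ?_ ?_
        · refine (wkC_comp (amp ht₂ c.2) (amp ht₁ (1 - c.1))).mem_closure (fun a ha => ?_) hE h1
          obtain ⟨a1, ha1, a2, ha2, rfl⟩ := Submodule.mem_sup.1 ha
          have := wT_kill ht₁ ht₂ z1 ha1
          simp only [ContinuousLinearMap.add_comp, ContinuousLinearMap.comp_add, this, zero_add]
          exact hWE (sW _ m1 _ q2 a2 ha2)
        · refine (wkC_comp (amp ht₂ (1 - c.2)) (amp ht₁ c.1)).mem_closure (fun a ha => ?_) hE h1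
          obtain ⟨a1, ha1, a2, ha2, rfl⟩ := Submodule.mem_sup.1 ha
          have := wT_kill ht₁ ht₂ z2 ha1
          simp only [ContinuousLinearMap.add_comp, ContinuousLinearMap.comp_add, this, zero_add]
          exact hWE (sW _ q1 _ m2 a2 ha2)
    obtain ⟨Y, ⟨-, hY2⟩, hXY, hYI⟩ := key
    have cho : ∀ V, HasFiniteWidth D₁ D₂ V → ∃ l : List (Set ((H₁ →L[ℂ] H₁) × (H₂ →L[ℂ] H₂))),
        ∀ U : Submodule ℂ (K₁ →L[ℂ] K₂), WkClosed (U : Set (K₁ →L[ℂ] K₂)) →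
        wT (t₁ := t₁) (t₂ := t₂) (M ∩ V) U ≤ E →
        Good ht₁ ht₂ D₁ D₂ E (BM D₁ D₂ M) (wT (t₁ := t₁) (t₂ := t₂) V U) U l := by
      intro V hV
      have hVb := mb V hV
      obtain ⟨k, Vs, h1, h2⟩ := hV
      choose Cs hCs using fun j => hch (Vs j) (h1 j).1 (h1 j).2
      exact ⟨List.ofFn Cs, fun U hU hUE => good_term ht₁ ht₂ hVb h2 hCs hU
        ((wT_mono (inter_subset_inter_left _ hMt) subset_rfl).trans hUE)⟩
    obtain ⟨lC, hlC⟩ := cho C hC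
    choose lB hlB using fun j => cho (Bs j) (hBs j)
    have hYE : Y ∈ E := by
      refine recur ht₁ ht₂ hD₁ hD₂ hE ((wT (t₁ := t₁) (t₂ := t₂) C U, U, lC) ::
        List.ofFn fun j => (wT (t₁ := t₁) (t₂ := t₂) (Bs j) (Us j), Us j, lB j)) (BM D₁ D₂ M) hBP ⊥ ⊥ ?_ ?_ Y hYI ?_
      · refine ⟨?_, by simpa using wkClosed_singleton_zero, by simp, by simp, fun S' _ _ _ => ?_, ?_⟩
        · intro P hP Q hQ a ha
          have : a = 0 := ha
          rw [this]; simp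
        · refine wT_le ht₁ ht₂ hE ?_
          intro S hS R hR
          have : R = 0 := hR
          have h0 := tens_smul_right ht₁ ht₂ (0 : ℂ) S (0 : K₁ →L[ℂ] K₂)
          rw [zero_smul, zero_smul] at h0
          rw [this, h0]; exact E.zero_mem
        · intro a ha x y
          have : a = 0 := ha
          rw [this]; simp [sl]
      · intro t ht
        rcases List.mem_cons.1 ht with rfl | ht
        · exact hlC U hU (le_sup_left.trans (le_wkcl _))
        · obtain ⟨j, rfl⟩ := (List.mem_ofFn' _ t).1 ht
          refine hlB j (Us j) (hUs j) ((wT_mono inter_subset_right subset_rfl).trans ?_)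
          exact (le_iSup (fun j => wT (t₁ := t₁) (t₂ := t₂) (Bs j) (Us j)) j).trans hWE
      · refine wkcl_mono ?_ hY2
        refine (sup_le ?_ (iSup_le fun j => ?_)).trans le_sup_right
        · exact le_sumA (t := (wT (t₁ := t₁) (t₂ := t₂) C U, U, lC)) List.mem_cons_self
        · exact le_sumA (t := (wT (t₁ := t₁) (t₂ := t₂) (Bs j) (Us j), Us j, lB j))
            (List.mem_cons_of_mem _ ((List.mem_ofFn' _ _).2 ⟨j, rfl⟩))
    have := E.add_mem hXY hYE
    rwa [sub_add_cancel] at this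
  · exact subset_inter (wkcl_mono (sup_le_sup_right (wT_mono inter_subset_left subset_rfl) _))
      (wkcl_mono (sup_le_sup_right (wT_mono inter_subset_right subset_rfl) _))

end B11
end OSX

namespace OSX
open Filter Topology
open scoped InnerProduct
open InnerProductSpace (rankOne rankOne_apply)
section B12
variable {H : Type*} [NormedAddCommGroup H] [InnerProductSpace ℂ H]

/-- partial construction up to `p` -/
def GG (J : Submodule ℂ (H →L[ℂ] H)) (x : H) (ε : ℝ) (p : Submodule ℂ H) : Prop :=
  ∃ A ∈ J, ∃ E : H →L[ℂ] H, ∃ n ∈ p, x - n ∈ pᗮ ∧ ∀ z,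
    ‖(⟪x, z⟫ : ℂ)‖ ^ 2 - ‖(⟪x - n, z⟫ : ℂ)‖ ^ 2 ≤ 2 * (⟪z, A z + E z⟫ : ℂ).re ∧
    ‖E z‖ ^ 2 ≤ ε * ‖n‖ ^ 2 * ‖z‖ ^ 2 ∧ ‖A z‖ ^ 2 ≤ ‖n‖ ^ 2 * ‖x‖ ^ 2 * ‖z‖ ^ 2 ∧ A z ∈ p ∧ E z ∈ p

theorem pyth {u v : H} (h : (⟪u, v⟫ : ℂ) = 0) : ‖u + v‖ ^ 2 = ‖u‖ ^ 2 + ‖v‖ ^ 2 := by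
  have := norm_add_sq_eq_norm_sq_add_norm_sq_of_inner_eq_zero u v h
  nlinarith

theorem inner_sq_le (u v : H) : ‖(⟪u, v⟫ : ℂ)‖ ^ 2 ≤ ‖u‖ ^ 2 * ‖v‖ ^ 2 := by
  rw [← mul_pow]
  exact pow_le_pow_left₀ (norm_nonneg _) (norm_inner_le_norm u v) 2

theorem GG.step {J : Submodule ℂ (H →L[ℂ] H)} {x : H} {ε : ℝ} {p p' : Submodule ℂ H} (hle : p ≤ p')
    {n n' l : H} (hn : n ∈ p) (hxn : x - n ∈ pᗮ) (hn' : n' ∈ p') (hxn' : x - n' ∈ p'ᗮ)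
    (h : GG J x ε p) (hl : ‖l - n‖ ^ 2 ≤ ε) (hlx : ‖x - l‖ ≤ ‖x‖) (hJ : rankOne ℂ (n' - n) (x - l) ∈ J) :
    GG J x ε p' := by
  obtain ⟨A, hA, E, m, hm, hxm, hh⟩ := h
  have hmn : m = n := by
    have h1 : m - n ∈ p := p.sub_mem hm hn
    have h2 : m - n ∈ pᗮ := by
      have := pᗮ.sub_mem hxn hxm
      simpa using this
    exact sub_eq_zero.1 (inner_self_eq_zero.1 (h2 _ h1))
  subst hmn
  have hd : n' - m ∈ pᗮ := by
    have := pᗮ.sub_mem hxm (Submodule.orthogonal_le hle hxn')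
    simpa using this
  refine ⟨A + rankOne ℂ (n' - m) (x - l), J.add_mem hA hJ, E + rankOne ℂ (n' - m) (l - m), n', hn', hxn', ?_⟩
  intro z
  obtain ⟨h1, h2, h3, h4, h5⟩ := hh z
  have hnn : ‖n'‖ ^ 2 = ‖m‖ ^ 2 + ‖n' - m‖ ^ 2 := by
    rw [← pyth (hd m hm)]; simp
  have hdp : n' - m ∈ p' := p'.sub_mem hn' (hle hn)
  simp only [ContinuousLinearMap.add_apply, rankOne_apply]
  refine ⟨?_, ?_, ?_, p'.add_mem (hle h4) (p'.smul_mem _ hdp), p'.add_mem (hle h5) (p'.smul_mem _ hdp)⟩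
  · have e1 : A z + (⟪x - l, z⟫ : ℂ) • (n' - m) + (E z + (⟪l - m, z⟫ : ℂ) • (n' - m)) =
        (A z + E z) + (⟪x - m, z⟫ : ℂ) • (n' - m) := by
      have : (⟪x - m, z⟫ : ℂ) = ⟪x - l, z⟫ + ⟪l - m, z⟫ := by rw [← inner_add_left, sub_add_sub_cancel]
      rw [this, add_smul]; abel
    rw [e1, inner_add_right, Complex.add_re, inner_smul_right]
    have e2 : (⟪x - n', z⟫ : ℂ) = ⟪x - m, z⟫ - ⟪n' - m, z⟫ := by rw [← inner_sub_left, sub_sub_sub_cancel_right]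
    have e3 : (⟪z, n' - m⟫ : ℂ) = (starRingEnd ℂ) ⟪n' - m, z⟫ := (inner_conj_symm _ _).symm
    rw [e2, e3]
    generalize (⟪x - m, z⟫ : ℂ) = s at *
    generalize (⟪n' - m, z⟫ : ℂ) = a at *
    simp only [Complex.sq_norm, Complex.normSq_apply, Complex.sub_re, Complex.sub_im, Complex.mul_re,
      Complex.conj_re, Complex.conj_im] at *
    nlinarith [mul_self_nonneg a.re, mul_self_nonneg a.im]
  · rw [pyth (by rw [inner_smul_right, hd _ h5, mul_zero]), hnn, norm_smul, mul_pow]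
    have := inner_sq_le (l - m) z
    have : ‖(⟪l - m, z⟫ : ℂ)‖ ^ 2 ≤ ε * ‖z‖ ^ 2 := this.trans (by gcongr)
    nlinarith [mul_le_mul_of_nonneg_right this (sq_nonneg ‖n' - m‖)]
  · rw [pyth (by rw [inner_smul_right, hd _ h4, mul_zero]), hnn, norm_smul, mul_pow]
    have := inner_sq_le (x - l) z
    have : ‖(⟪x - l, z⟫ : ℂ)‖ ^ 2 ≤ ‖x‖ ^ 2 * ‖z‖ ^ 2 := this.trans (by gcongr)
    nlinarith [mul_le_mul_of_nonneg_right this (sq_nonneg ‖n' - m‖)]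

/-- rank one hypothesis -/
def RkOne (N : Set (Submodule ℂ H)) (J : Submodule ℂ (H →L[ℂ] H)) : Prop :=
  ∀ p ∈ N, ∀ u ∈ p, ∀ y : H, (∀ q ∈ N, q < p → ∀ z ∈ q, (⟪y, z⟫ : ℂ) = 0) → rankOne ℂ u y ∈ J

theorem norm_sub_proj {x n : H} {p : Submodule ℂ H} (hn : n ∈ p) (hxn : x - n ∈ pᗮ) {y : H} (hy : y ∈ p) :
    ‖x - n‖ ≤ ‖x - y‖ := by
  have h : ‖x - y‖ ^ 2 = ‖n - y‖ ^ 2 + ‖x - n‖ ^ 2 := by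
    rw [← pyth (hxn _ (p.sub_mem hn hy))]; simp
  exact abs_le_of_sq_le_sq' (by nlinarith [sq_nonneg ‖n - y‖]) (norm_nonneg _) |>.2

theorem norm_sub_le' {x n : H} {p : Submodule ℂ H} (hn : n ∈ p) (hxn : x - n ∈ pᗮ) : ‖x - n‖ ≤ ‖x‖ := by
  simpa using norm_sub_proj hn hxn p.zero_mem

variable [CompleteSpace H]

theorem exP {p : Submodule ℂ H} (hp : IsClosed (p : Set H)) (x : H) : ∃ n ∈ p, x - n ∈ pᗮ := by
  haveI : CompleteSpace p := hp.completeSpace_coe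
  exact Submodule.HasOrthogonalProjection.exists_orthogonal x

theorem GG.top {N : Set (Submodule ℂ H)} (hN : IsNest N) {J : Submodule ℂ (H →L[ℂ] H)} (hJ : RkOne N J)
    (x : H) {ε : ℝ} (hε : 0 < ε) : GG J x ε ⊤ := by
  obtain ⟨hcl, hch, hsp⟩ := hN
  have hbot : (⊥ : Submodule ℂ H) ∈ N := by
    have := (hsp ∅ (empty_subset _)).2
    have h0 : (⊥ : Submodule ℂ H).topologicalClosure = ⊥ :=
      (isClosed_singleton (x := (0 : H))).submodule_topologicalClosure_eq
    simpa [h0] using this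
  have htop : (⊤ : Submodule ℂ H) ∈ N := by simpa using (hsp ∅ (empty_subset _)).1
  have hlt : ∀ p ∈ N, ∀ q ∈ N, ¬ p ≤ q → q < p := by
    intro p hp q hq h
    rcases hch.total hp hq with h' | h'
    · exact absurd h' h
    · exact lt_of_le_of_ne h' fun e => h (e ▸ le_rfl)
  -- soft step
  have soft : ∀ p ∈ N, ∀ q ∈ N, p ≤ q → ∀ n ∈ p, x - n ∈ pᗮ → ∀ m ∈ q, x - m ∈ qᗮ → ‖m - n‖ ^ 2 ≤ ε →
      GG J x ε p → GG J x ε q := by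
    intro p hp q hq hle n hn hxn m hm hxm hd h
    refine h.step hle hn hxn hm hxm hd (norm_sub_le' hm hxm) (hJ q hq _ (q.sub_mem hm (hle hn)) _ ?_)
    intro r hr hrq z hz
    exact (Submodule.mem_orthogonal' _ _).1 hxm z (hrq.le hz)
  set S : Set (Submodule ℂ H) := {p | p ∈ N ∧ GG J x ε p} with hS
  have hSN : S ⊆ N := fun p hp => hp.1
  have hb : (⊥ : Submodule ℂ H) ∈ S := by
    refine ⟨hbot, 0, J.zero_mem, 0, 0, Submodule.zero_mem _, by simp, fun z => ?_⟩
    simp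
  set m := (sSup S).topologicalClosure with hm
  have hmN : m ∈ N := (hsp S hSN).2
  have hmS : ∀ p ∈ S, p ≤ m := fun p hp => (le_sSup hp).trans (Submodule.le_topologicalClosure _)
  obtain ⟨b, hbm, hxb⟩ := exP (hcl m hmN) x
  have hGm : GG J x ε m := by
    have h1 : b ∈ closure ((sSup S : Submodule ℂ H) : Set H) := hbm
    obtain ⟨y, hy, hyb⟩ := Metric.mem_closure_iff.1 h1 (Real.sqrt ε) (Real.sqrt_pos.2 hε)
    rw [SetLike.mem_coe, Submodule.mem_sSup_of_directed ⟨_, hb⟩ ((hch.mono hSN).directedOn)] at hy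
    obtain ⟨p, hp, hyp⟩ := hy
    obtain ⟨n, hn, hxn⟩ := exP (hcl p (hSN hp)) x
    refine soft p (hSN hp) m hmN (hmS p hp) n hn hxn b hbm hxb ?_ hp.2
    have h2 : b - n ∈ pᗮ := by
      have := pᗮ.sub_mem hxn (Submodule.orthogonal_le (hmS p hp) hxb)
      simpa using this
    have h3 : ‖b - n‖ ≤ Real.sqrt ε := (norm_sub_proj hn h2 hyp).trans (by rw [← dist_eq_norm]; exact hyb.le)
    calc ‖b - n‖ ^ 2 ≤ Real.sqrt ε ^ 2 := by gcongr
      _ = ε := Real.sq_sqrt hε.le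
  by_contra htn
  have hmt : m ≠ ⊤ := fun h => htn (h ▸ hGm)
  set S' : Set (Submodule ℂ H) := {p | p ∈ N ∧ m < p} with hS'
  have hS'N : S' ⊆ N := fun p hp => hp.1
  have ht' : (⊤ : Submodule ℂ H) ∈ S' := ⟨htop, lt_top_iff_ne_top.2 hmt⟩
  have hno : ∀ p ∈ S', ¬ GG J x ε p := fun p hp h => absurd (hmS p ⟨hp.1, h⟩) (not_le_of_gt hp.2)
  set k := sInf S' with hk
  have hkN : k ∈ N := (hsp S' hS'N).1
  have hmk : m ≤ k := le_sInf fun p hp => hp.2.le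
  rcases hmk.lt_or_eq with hlt' | heq
  · refine hno k ⟨hkN, hlt'⟩ ?_
    obtain ⟨c, hck, hxc⟩ := exP (hcl k hkN) x
    refine hGm.step hmk hbm hxb hck hxc (l := b) (by simpa using hε.le) (norm_sub_le' hbm hxb)
      (hJ k hkN _ (k.sub_mem hck (hmk hbm)) _ ?_)
    intro r hr hrq z hz
    have hrm : r ≤ m := by
      by_contra hc
      have := sInf_le (show r ∈ S' from ⟨hr, hlt r hr m hmN hc⟩)
      exact absurd this (not_le_of_gt hrq)
    exact (Submodule.mem_orthogonal' _ _).1 hxb z (hrm hz)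
  · -- continuity from above
    have h1 : x - b ∈ closure ((⨆ p : S', (p : Submodule ℂ H)ᗮ : Submodule ℂ H) : Set H) := by
      have h2 : ((⨆ p : S', (p : Submodule ℂ H)ᗮ).topologicalClosure) = mᗮ := by
        rw [← Submodule.orthogonal_orthogonal_eq_closure, ← Submodule.iInf_orthogonal, heq, hk, sInf_eq_iInf']
        congr 1
        refine iInf_congr fun p => ?_
        rw [Submodule.orthogonal_orthogonal_eq_closure, (hcl p p.2.1).submodule_topologicalClosure_eq]
      have : x - b ∈ (⨆ p : S', (p : Submodule ℂ H)ᗮ).topologicalClosure := h2 ▸ hxb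
      exact this
    obtain ⟨y, hy, hyb⟩ := Metric.mem_closure_iff.1 h1 (Real.sqrt ε) (Real.sqrt_pos.2 hε)
    haveI : Nonempty S' := ⟨⟨_, ht'⟩⟩
    rw [SetLike.mem_coe, Submodule.mem_iSup_of_directed] at hy
    · obtain ⟨⟨p, hp⟩, hyp⟩ := hy
      obtain ⟨n, hn, hxn⟩ := exP (hcl p (hS'N hp)) x
      refine hno p hp (soft m hmN p (hS'N hp) hp.2.le b hbm hxb n hn hxn ?_ hGm)
      have h2 : (x - b) - (x - n) ∈ pᗮᗮ := by
        have : n - b ∈ p := p.sub_mem hn (hp.2.le hbm)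
        simpa using p.le_orthogonal_orthogonal this
      have h3 := norm_sub_proj hxn h2 hyp
      have h4 : ‖n - b‖ ≤ Real.sqrt ε := by
        calc ‖n - b‖ = ‖x - b - (x - n)‖ := by congr 1; abel
          _ ≤ ‖x - b - y‖ := h3
          _ ≤ _ := by rw [← dist_eq_norm]; exact hyb.le
      calc ‖n - b‖ ^ 2 ≤ Real.sqrt ε ^ 2 := by gcongr
        _ = ε := Real.sq_sqrt hε.le
    · rintro ⟨p, hp⟩ ⟨q, hq⟩
      rcases hch.total hp.1 hq.1 with h | h
      · exact ⟨⟨p, hp⟩, le_rfl, Submodule.orthogonal_le h⟩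
      · exact ⟨⟨q, hq⟩, Submodule.orthogonal_le h, le_rfl⟩

end B12
end OSX

namespace OSX
open Filter Topology
open scoped InnerProduct
open InnerProductSpace (rankOne rankOne_apply)
section B13
variable {H : Type*} [NormedAddCommGroup H] [InnerProductSpace ℂ H] [CompleteSpace H]

theorem exists_acc {N : Set (Submodule ℂ H)} (hN : IsNest N) {J : Submodule ℂ (H →L[ℂ] H)} (hJ : RkOne N J)
    (hJc : WkClosed (J : Set (H →L[ℂ] H))) (x : H) :
    ∃ A ∈ J, ∀ z, ‖(⟪x, z⟫ : ℂ)‖ ^ 2 ≤ 2 * (⟪z, A z⟫ : ℂ).re := by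
  have h := fun n : ℕ => GG.top hN hJ x (ε := (1 / ((n : ℝ) + 1)) ^ 2) (by positivity)
  choose A hA E n hn hxn hh using h
  have hnx : ∀ k, n k = x := fun k => by
    have := hxn k
    rw [Submodule.top_orthogonal_eq_bot, Submodule.mem_bot, sub_eq_zero] at this
    exact this.symm
  simp only [hnx, sub_self, inner_zero_left, norm_zero] at hh
  have hb : ∀ k, ‖A k‖ ≤ ‖x‖ ^ 2 := fun k => ContinuousLinearMap.opNorm_le_bound _ (by positivity) fun z => by
    refine (abs_le_of_sq_le_sq' ?_ (by positivity)).2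
    refine (hh k z).2.2.1.trans (le_of_eq (by ring))
  obtain ⟨X, -, hX⟩ := exists_ultra_lim (hyperfilter ℕ) A (by positivity) hb
  refine ⟨X, hJc.mem_of hX (Eventually.of_forall hA), fun z => ?_⟩
  have h1 := (Complex.continuous_re.tendsto _).comp (hX.wot z z)
  have h2 : Tendsto (fun k : ℕ => 2 * ((1 / ((k : ℝ) + 1)) * (‖x‖ * ‖z‖ * ‖z‖))) (hyperfilter ℕ) (𝓝 (2 * (0 * (‖x‖ * ‖z‖ * ‖z‖)))) := by
    have : Tendsto (fun k : ℕ => (1 / ((k : ℝ) + 1))) (hyperfilter ℕ) (𝓝 0) :=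
      tendsto_one_div_add_atTop_nhds_zero_nat.mono_left
        (by rw [← Nat.cofinite_eq_atTop]; exact hyperfilter_le_cofinite)
    exact (this.mul_const _).const_mul 2
  have h3 := (h1.const_mul 2).add h2
  simp only [zero_mul, mul_zero, add_zero] at h3
  refine ge_of_tendsto h3 (Eventually.of_forall fun k => ?_)
  obtain ⟨e1, e2, -⟩ := hh k z
  have e3 : ‖E k z‖ ≤ 1 / ((k : ℝ) + 1) * ‖x‖ * ‖z‖ := by
    refine (abs_le_of_sq_le_sq' ?_ (by positivity)).2
    refine e2.trans (le_of_eq (by ring))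
  have e4 : (⟪z, E k z⟫ : ℂ).re ≤ ‖z‖ * ‖E k z‖ := (Complex.re_le_norm _).trans (norm_inner_le_norm _ _)
  rw [inner_add_right, Complex.add_re] at e1
  have e5 : ‖z‖ * ‖E k z‖ ≤ 1 / ((k : ℝ) + 1) * (‖x‖ * ‖z‖ * ‖z‖) := by
    calc ‖z‖ * ‖E k z‖ ≤ ‖z‖ * (1 / ((k : ℝ) + 1) * ‖x‖ * ‖z‖) := by gcongr
      _ = _ := by ring
  simp only [Function.comp]
  norm_num at e1
  linarith

theorem exists_kill {N : Set (Submodule ℂ H)} (hN : IsNest N) {J : Submodule ℂ (H →L[ℂ] H)}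
    (hJc : WkClosed (J : Set (H →L[ℂ] H))) (hJa : ∀ A ∈ J, A ∈ nestAlg N)
    (hJr : ∀ A ∈ J, ∀ B ∈ nestAlg N, A * B ∈ J) {A : H →L[ℂ] H} (hA : A ∈ J)
    (hre : ∀ z, 0 ≤ (⟪z, A z⟫ : ℂ).re) :
    ∃ P : H →L[ℂ] H, ‖P‖ ≤ 1 ∧ 1 - P ∈ J ∧ ∀ x, (∀ z, (⟪z, A z⟫ : ℂ).re = 0 → (⟪x, z⟫ : ℂ) = 0) → P x = 0 := by
  set t : ℝ := 1 / (‖A‖ + 1) with ht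
  have ht0 : 0 < t := by positivity
  set A' : H →L[ℂ] H := (t : ℂ) • A with hA'
  have hA'J : A' ∈ J := J.smul_mem _ hA
  have hn : ‖-A'‖ < 1 := by
    rw [norm_neg, hA', norm_smul, Complex.norm_real, Real.norm_of_nonneg ht0.le, ht, one_div, inv_mul_lt_iff₀ (by positivity)]
    linarith
  have hre' : ∀ z, (⟪z, A' z⟫ : ℂ).re = t * (⟪z, A z⟫ : ℂ).re := fun z => by
    rw [hA', ContinuousLinearMap.smul_apply, inner_smul_right, Complex.re_ofReal_mul]
  set C : H →L[ℂ] H := ∑' k : ℕ, (-A') ^ k with hC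
  have hC1 : (1 + A') * C = 1 := by
    have := mul_neg_geom_series (-A') hn
    rwa [sub_neg_eq_add] at this
  have hC2 : C * (1 + A') = 1 := by
    have := geom_series_mul_neg (-A') hn
    rwa [sub_neg_eq_add] at this
  have hpow : ∀ (B : H →L[ℂ] H), B ∈ nestAlg N → ∀ k : ℕ, B ^ k ∈ nestAlg N := by
    intro B hB k
    induction k with
    | zero => intro p hp x hx; simpa using hx
    | succ k ih => intro p hp x hx; rw [pow_succ']; exact hB p hp _ (ih p hp x hx)
  have hCN : C ∈ nestAlg N := by
    intro p hp x hx
    have hs : HasSum (fun k : ℕ => ((-A') ^ k) x) (C x) :=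
      (ContinuousLinearMap.apply ℂ H x).hasSum (summable_geometric_of_norm_lt_one hn |>.hasSum)
    exact (hN.1 p hp).mem_of_tendsto hs (Eventually.of_forall fun F => p.sum_mem fun k _ =>
      hpow (-A') (fun q hq y hy => by simpa using q.neg_mem (hJa A' hA'J q hq y hy)) k p hp x hx)
  have hnx : ∀ z, ‖C z‖ ^ 2 + ‖z - C z‖ ^ 2 ≤ ‖z‖ ^ 2 := by
    intro z
    have h1 : C z + A' (C z) = z := by
      have := congrArg (fun B : H →L[ℂ] H => B z) hC1
      simpa using this
    have h2 : ‖z‖ ^ 2 = ‖C z‖ ^ 2 + 2 * (⟪C z, A' (C z)⟫ : ℂ).re + ‖A' (C z)‖ ^ 2 := by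
      conv_lhs => rw [← h1]
      exact norm_add_sq (𝕜 := ℂ) _ _
    have h3 : z - C z = A' (C z) := by rw [sub_eq_iff_eq_add', h1]
    rw [h3, h2, hre']
    nlinarith [mul_nonneg ht0.le (hre (C z))]
  have hCc : ‖C‖ ≤ 1 := ContinuousLinearMap.opNorm_le_bound _ zero_le_one fun z => by
    rw [one_mul]
    exact (abs_le_of_sq_le_sq' (by nlinarith [hnx z, sq_nonneg ‖z - C z‖]) (norm_nonneg _)).2
  have hCk : ∀ k : ℕ, ‖C ^ k‖ ≤ 1 := fun k => by
    induction k with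
    | zero => rw [pow_zero]; exact ContinuousLinearMap.norm_id_le
    | succ k ih => rw [pow_succ]; exact (norm_mul_le _ _).trans (mul_le_one₀ ih (norm_nonneg _) hCc)
  have hJk : ∀ k : ℕ, 1 - C ^ k ∈ J := fun k => by
    have h1 : 1 - C = A' * C := by rw [← hC1]; noncomm_ring
    induction k with
    | zero => simp
    | succ k ih =>
      have : 1 - C ^ (k + 1) = (1 - C ^ k) + A' * (C * C ^ k) := by
        rw [← mul_assoc, ← h1, pow_succ']; noncomm_ring
      rw [this]
      refine J.add_mem ih (hJr _ hA'J _ ?_)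
      rw [← pow_succ']
      exact hpow C hCN _
  obtain ⟨P, hP1, hP⟩ := exists_ultra_lim (hyperfilter ℕ) (fun k => C ^ k) zero_le_one hCk
  have hPC : ∀ z, P (z - C z) = 0 := by
    intro z
    have hanti : Antitone fun k : ℕ => ‖(C ^ k) z‖ ^ 2 := antitone_nat_of_succ_le fun k => by
      have := hnx ((C ^ k) z)
      rw [pow_succ' C, ContinuousLinearMap.mul_apply]
      nlinarith [sq_nonneg ‖(C ^ k) z - C ((C ^ k) z)‖]
    have hl := tendsto_atTop_ciInf hanti ⟨0, by rintro _ ⟨k, rfl⟩; positivity⟩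
    have hl2 := hl.sub (hl.comp (tendsto_add_atTop_nat 1))
    rw [sub_self] at hl2
    have hz : Tendsto (fun k : ℕ => ‖(C ^ k) (z - C z)‖ ^ 2) atTop (𝓝 0) := by
      refine squeeze_zero (fun k => by positivity) (fun k => ?_) hl2
      have := hnx ((C ^ k) z)
      have e : (C ^ k) (z - C z) = (C ^ k) z - C ((C ^ k) z) := by
        rw [map_sub, ← ContinuousLinearMap.mul_apply, ← ContinuousLinearMap.mul_apply, ← pow_succ, ← pow_succ']
      simp only [Function.comp]
      rw [e, pow_succ' C, ContinuousLinearMap.mul_apply]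
      linarith
    have hz2 : Tendsto (fun k : ℕ => (C ^ k) (z - C z)) atTop (𝓝 0) := by
      rw [tendsto_zero_iff_norm_tendsto_zero]
      have := (Real.continuous_sqrt.tendsto _).comp hz
      simpa [Function.comp_def, Real.sqrt_sq (norm_nonneg _)] using this
    refine ext_inner_left ℂ fun y => ?_
    refine tendsto_nhds_unique (hP.wot (z - C z) y) ?_
    have := (tendsto_const_nhds (x := y)).inner (𝕜 := ℂ) (hz2.mono_left
      (show (hyperfilter ℕ : Filter ℕ) ≤ atTop by rw [← Nat.cofinite_eq_atTop]; exact hyperfilter_le_cofinite))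
    exact this
  refine ⟨P, hP1, hJc.mem_of ((WkT.const _ 1).sub hP) (Eventually.of_forall hJk), fun x hx => ?_⟩
  have hPA : ∀ z, P (A' z) = 0 := fun z => by
    have h1 : C (z + A' z) = z := by
      have := congrArg (fun B : H →L[ℂ] H => B z) hC2
      simpa using this
    have := hPC (z + A' z)
    rwa [h1, add_sub_cancel_left] at this
  refine ext_inner_left ℂ fun v => ?_
  rw [inner_zero_right, ← ContinuousLinearMap.adjoint_inner_left, ← inner_conj_symm, hx, map_zero]
  have h1 : (⟪(P†) v, A' ((P†) v)⟫ : ℂ) = 0 := by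
    rw [ContinuousLinearMap.adjoint_inner_left, hPA, inner_zero_right]
  have h2 := hre' ((P†) v)
  rw [h1, Complex.zero_re, zero_eq_mul] at h2
  exact h2.resolve_left ht0.ne'

/-- Erdos density -/
theorem one_mem_J {N : Set (Submodule ℂ H)} (hN : IsNest N) {J : Submodule ℂ (H →L[ℂ] H)} (hJ : RkOne N J)
    (hJc : WkClosed (J : Set (H →L[ℂ] H))) (hJa : ∀ A ∈ J, A ∈ nestAlg N)
    (hJr : ∀ A ∈ J, ∀ B ∈ nestAlg N, A * B ∈ J) : 1 ∈ J := by
  classical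
  choose A hA hAx using exists_acc hN hJ hJc
  have key : ∀ F : Finset H, ∃ P : H →L[ℂ] H, ‖P‖ ≤ 1 ∧ 1 - P ∈ J ∧ ∀ x ∈ F, P x = 0 := by
    intro F
    have hs : ∀ z, (⟪z, (∑ x ∈ F, A x) z⟫ : ℂ).re = ∑ x ∈ F, (⟪z, A x z⟫ : ℂ).re := fun z => by
      rw [ContinuousLinearMap.sum_apply, inner_sum, Complex.re_sum]
    have hp : ∀ x z, 0 ≤ (⟪z, A x z⟫ : ℂ).re := fun x z => by nlinarith [hAx x z, sq_nonneg ‖(⟪x, z⟫ : ℂ)‖]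
    obtain ⟨P, h1, h2, h3⟩ := exists_kill hN hJc hJa hJr (J.sum_mem fun x (_ : x ∈ F) => hA x)
      (fun z => by rw [hs]; exact Finset.sum_nonneg fun x _ => hp x z)
    refine ⟨P, h1, h2, fun x hx => h3 x fun z hz => ?_⟩
    rw [hs, Finset.sum_eq_zero_iff_of_nonneg fun x _ => hp x z] at hz
    have := hAx x z
    rw [hz x hx, mul_zero] at this
    exact norm_eq_zero.1 (pow_eq_zero_iff two_ne_zero |>.1 (le_antisymm this (sq_nonneg _)))
  choose P h1 h2 h3 using key
  have hw : WkT (atTop : Filter (Finset H)) P 0 := by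
    refine wkT_of_bdd_wot (Eventually.of_forall h1) fun x y => ?_
    refine tendsto_const_nhds.congr' ?_
    filter_upwards [eventually_ge_atTop {x}] with F hF
    rw [h3 F x (by simpa using hF)]
    simp
  have := hJc.mem_of ((WkT.const _ 1).sub hw) (Eventually.of_forall h2)
  simpa using this

end B13
end OSX

namespace OSX
open Filter Topology
open scoped InnerProduct
open InnerProductSpace (rankOne rankOne_apply)
section B14
variable {H₁ H₂ : Type*}
  [NormedAddCommGroup H₁] [InnerProductSpace ℂ H₁] [CompleteSpace H₁]
  [NormedAddCommGroup H₂] [InnerProductSpace ℂ H₂] [CompleteSpace H₂]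
  {D₁ : StarSubalgebra ℂ (H₁ →L[ℂ] H₁)} {D₂ : StarSubalgebra ℂ (H₂ →L[ℂ] H₂)}

/-- closed span of `V p` -/
def phs (V : Set (H₁ →L[ℂ] H₂)) (p : Submodule ℂ H₁) : Submodule ℂ H₂ :=
  (Submodule.span ℂ {y | ∃ v ∈ V, ∃ w ∈ p, v w = y}).topologicalClosure

/-- preimage of `phs` -/
def pss (V : Set (H₁ →L[ℂ] H₂)) (p : Submodule ℂ H₁) : Submodule ℂ H₁ where
  carrier := {x | ∀ v ∈ V, v x ∈ phs V p}
  add_mem' := fun ha hb v hv => by rw [map_add]; exact add_mem (ha v hv) (hb v hv)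
  zero_mem' := fun v _ => by rw [map_zero]; exact zero_mem _
  smul_mem' := fun c x hx v hv => by rw [map_smul]; exact Submodule.smul_mem _ _ (hx v hv)

theorem phs_closed (V : Set (H₁ →L[ℂ] H₂)) (p : Submodule ℂ H₁) : IsClosed (phs V p : Set H₂) :=
  Submodule.isClosed_topologicalClosure _

theorem pss_closed (V : Set (H₁ →L[ℂ] H₂)) (p : Submodule ℂ H₁) : IsClosed (pss V p : Set H₁) := by
  have : (pss V p : Set H₁) = ⋂ v ∈ V, v ⁻¹' (phs V p : Set H₂) := by
    ext x; simp [pss]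
  rw [this]
  exact isClosed_biInter fun v _ => (phs_closed V p).preimage v.continuous

instance phs_proj (V : Set (H₁ →L[ℂ] H₂)) (p : Submodule ℂ H₁) : (phs V p).HasOrthogonalProjection := by
  haveI : CompleteSpace (phs V p) := (phs_closed V p).completeSpace_coe
  infer_instance

instance pss_proj (V : Set (H₁ →L[ℂ] H₂)) (p : Submodule ℂ H₁) : (pss V p).HasOrthogonalProjection := by
  haveI : CompleteSpace (pss V p) := (pss_closed V p).completeSpace_coe
  infer_instance

theorem phs_le {V : Set (H₁ →L[ℂ] H₂)} {p : Submodule ℂ H₁} {Z : Submodule ℂ H₂} (hZ : IsClosed (Z : Set H₂))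
    (h : ∀ v ∈ V, ∀ w ∈ p, v w ∈ Z) : phs V p ≤ Z :=
  Submodule.topologicalClosure_minimal _ (Submodule.span_le.2 (by rintro _ ⟨v, hv, w, hw, rfl⟩; exact h v hv w hw)) hZ

theorem mem_phs {V : Set (H₁ →L[ℂ] H₂)} {p : Submodule ℂ H₁} {v} (hv : v ∈ V) {w} (hw : w ∈ p) : v w ∈ phs V p :=
  Submodule.le_topologicalClosure _ (Submodule.subset_span ⟨v, hv, w, hw, rfl⟩)

theorem phs_mono {V : Set (H₁ →L[ℂ] H₂)} {p q : Submodule ℂ H₁} (h : p ≤ q) : phs V p ≤ phs V q :=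
  phs_le (phs_closed _ _) fun _ hv _ hw => mem_phs hv (h hw)

theorem le_pss (V : Set (H₁ →L[ℂ] H₂)) (p : Submodule ℂ H₁) : p ≤ pss V p := fun _ hx _ hv => mem_phs hv hx

theorem sp_adj {H : Type*} [NormedAddCommGroup H] [InnerProductSpace ℂ H] [CompleteSpace H] (K : Submodule ℂ H)
    [K.HasOrthogonalProjection] : (K.starProjection)† = K.starProjection :=
  (ContinuousLinearMap.isSelfAdjoint_iff').1 (isSelfAdjoint_starProjection K)

theorem sp_masa {H : Type*} [NormedAddCommGroup H] [InnerProductSpace ℂ H] [CompleteSpace H] {K : Submodule ℂ H}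
    [K.HasOrthogonalProjection] {D : StarSubalgebra ℂ (H →L[ℂ] H)} (hD : IsMasa D)
    (h : ∀ a ∈ D, ∀ x ∈ K, a x ∈ K) : K.starProjection ∈ D :=
  masa_mem hD (sp_adj K) fun a ha => (proj_intertw a (h a ha) (h _ (star_mem ha))).symm

/-- elements mapping each `p` to `phs V p` belong to `V` -/
theorem erdos_power {V : Set (H₁ →L[ℂ] H₂)} (hV : IsWkClosedSubspace V) {N : Set (Submodule ℂ H₁)} (hN : IsNest N)
    (hVN : ∀ X ∈ V, ∀ A ∈ nestAlg N, X ∘L A ∈ V) {T : H₁ →L[ℂ] H₂} (hT : ∀ p ∈ N, ∀ x ∈ p, T x ∈ phs V p) :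
    T ∈ V := by
  obtain ⟨⟨Vm, rfl⟩, hc⟩ := hV
  let J : Submodule ℂ (H₁ →L[ℂ] H₁) :=
    { carrier := {A | A ∈ nestAlg N ∧ T ∘L A ∈ Vm}
      add_mem' := fun {a b} ha hb => ⟨fun p hp x hx => p.add_mem (ha.1 p hp x hx) (hb.1 p hp x hx), by
        rw [ContinuousLinearMap.comp_add]; exact Vm.add_mem ha.2 hb.2⟩
      zero_mem' := ⟨fun p hp x hx => p.zero_mem, by rw [ContinuousLinearMap.comp_zero]; exact Vm.zero_mem⟩
      smul_mem' := fun c a ha => ⟨fun p hp x hx => p.smul_mem _ (ha.1 p hp x hx), by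
        rw [ContinuousLinearMap.comp_smul]; exact Vm.smul_mem _ ha.2⟩ }
  have hJ1 : RkOne N J := by
    intro p hp u hu y hy
    have halg : ∀ w ∈ p, rankOne ℂ w y ∈ nestAlg N := by
      intro w hw q hq z hz
      rw [rankOne_apply]
      by_cases h : p ≤ q
      · exact q.smul_mem _ (h hw)
      · have : q < p := by
          rcases hN.2.1.total hp hq with h' | h'
          · exact absurd h' h
          · exact lt_of_le_of_ne h' fun e => h (e ▸ le_rfl)
        rw [hy q hq this z hz, zero_smul]
        exact q.zero_mem
    refine ⟨halg u hu, ?_⟩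
    have hcomp : ∀ (S : H₁ →L[ℂ] H₂) w, S ∘L rankOne ℂ w y = rankOne ℂ (S w) y := fun S w => by
      ext z; simp [rankOne_apply]
    let Z : Submodule ℂ H₂ :=
      { carrier := {a | rankOne ℂ a y ∈ Vm}
        add_mem' := fun {a b} ha hb => by
          have : rankOne ℂ (a + b) y = rankOne ℂ a y + rankOne ℂ b y := by rw [map_add]; rfl
          rw [Set.mem_setOf_eq, this]; exact Vm.add_mem ha hb
        zero_mem' := by rw [Set.mem_setOf_eq, map_zero]; exact Vm.zero_mem
        smul_mem' := fun c a ha => by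
          have : rankOne ℂ (c • a) y = c • rankOne ℂ a y := by rw [map_smul]; rfl
          rw [Set.mem_setOf_eq, this]; exact Vm.smul_mem _ ha }
    have hZ : IsClosed (Z : Set H₂) := by
      refine isClosed_of_closure_subset fun a ha => ?_
      obtain ⟨s, hs, hsa⟩ := mem_closure_iff_seq_limit.1 ha
      have h1 : Tendsto (fun k => rankOne ℂ (s k) y) atTop (𝓝 (rankOne ℂ a y)) := by
        rw [tendsto_iff_norm_sub_tendsto_zero]
        have h2 : ∀ k, ‖rankOne ℂ (s k) y - rankOne ℂ a y‖ = ‖s k - a‖ * ‖y‖ := fun k => by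
          rw [← InnerProductSpace.norm_rankOne (𝕜 := ℂ) (s k - a) y, map_sub]; rfl
        simp only [h2]
        have := (tendsto_iff_norm_sub_tendsto_zero.1 hsa).mul_const ‖y‖
        rwa [zero_mul] at this
      exact hc.mem_of (wkT_of_norm h1) (Eventually.of_forall hs)
    have h3 : phs Vm p ≤ Z := phs_le hZ fun v hv w hw => by
      have := hVN v hv _ (halg w hw)
      rw [hcomp] at this
      exact this
    rw [hcomp]
    exact h3 (hT p hp u hu)
  have hJc : WkClosed (J : Set (H₁ →L[ℂ] H₁)) := by
    apply wkClosed_of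
    intro F X _ hF hX
    refine ⟨fun p hp x hx => ?_, ?_⟩
    · haveI : CompleteSpace p := (hN.1 p hp).completeSpace_coe
      rw [← Submodule.orthogonal_orthogonal p]
      intro y hy
      refine tendsto_nhds_unique (hX.wot x y) (tendsto_const_nhds.congr' ?_)
      filter_upwards [hF] with A hA
      exact ((Submodule.mem_orthogonal' _ _).1 hy _ (hA.1 p hp x hx)).symm
    · have := hX.comp T (1 : H₁ →L[ℂ] H₁)
      exact hc.mem_of (f := fun i => T ∘L i ∘L (1 : H₁ →L[ℂ] H₁)) this (by filter_upwards [hF] with A hA using hA.2)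
  have h1 := one_mem_J hN hJ1 hJc (fun A hA => hA.1) fun A hA B hB => by
    refine ⟨fun p hp x hx => hA.1 p hp _ (hB p hp x hx), ?_⟩
    rw [ContinuousLinearMap.mul_def, ← ContinuousLinearMap.comp_assoc]
    exact hVN _ hA.2 B hB
  exact h1.2

theorem exists_chain (hD₁ : IsMasa D₁) (hD₂ : IsMasa D₂) {V : Set (H₁ →L[ℂ] H₂)} (hV : IsMasaBimodule D₁ D₂ V)
    (hVn : IsNestBimodule V) : ∃ C, ChainOK D₁ D₂ V C := by
  obtain ⟨hVc, N, N₂, hN, hN₂, hb⟩ := hVn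
  have hVN : ∀ X ∈ V, ∀ A ∈ nestAlg N, X ∘L A ∈ V := fun X hX A hA => by
    have := hb X hX A hA 1 (fun p _ x hx => hx)
    exact this
  have i2 : ∀ p, ∀ a ∈ D₂, ∀ x ∈ phs V p, a x ∈ phs V p := by
    intro p a ha
    refine phs_le (Z := (phs V p).comap (a : H₂ →ₗ[ℂ] H₂)) ((phs_closed V p).preimage a.continuous) fun v hv w hw => ?_
    exact mem_phs (hV.2 v hv 1 (one_mem _) a ha) hw
  have i1 : ∀ p, ∀ a ∈ D₁, ∀ x ∈ pss V p, a x ∈ pss V p := fun p a ha x hx v hv =>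
    hx _ (hV.2 v hv a ha 1 (one_mem _))
  refine ⟨{c | ∃ p ∈ N, c = ((pss V p).starProjection, (phs V p).starProjection)}, ?_, ?_, ?_, ?_⟩
  · rintro _ ⟨p, hp, rfl⟩
    exact ⟨sp_masa hD₁ (i1 p), sp_masa hD₂ (i2 p), sp_adj _, sp_adj _,
      Prod.ext (Submodule.isIdempotentElem_starProjection _) (Submodule.isIdempotentElem_starProjection _)⟩
  · rintro T hT _ ⟨p, hp, rfl⟩
    ext x
    have h1 : T ((pss V p).starProjection x) ∈ phs V p :=
      (show _ ∈ pss V p from Submodule.starProjection_apply_mem _ x) T hT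
    simp [Submodule.starProjection_eq_self_iff.2 h1]
  · rintro _ ⟨p, hp, rfl⟩ T h1 h2
    refine erdos_power hVc hN hVN fun q hq x hx => ?_
    rcases hN.2.1.total hq hp with h | h
    · have h3 : T x = 0 := by
        have := congrArg (fun S : H₁ →L[ℂ] H₂ => S x) h2
        simpa [Submodule.starProjection_eq_self_iff.2 (le_pss V p (h hx))] using this
      rw [h3]; exact zero_mem _
    · have h3 : T x ∈ phs V p := by
        rw [← h1]; exact Submodule.starProjection_apply_mem _ _
      exact phs_mono h h3
  · intro T hT
    refine erdos_power hVc hN hVN fun q hq x hx => ?_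
    have h1 := congrArg (fun S : H₁ →L[ℂ] H₂ => S x) (hT _ ⟨q, hq, rfl⟩)
    simp only [ContinuousLinearMap.comp_apply, Submodule.starProjection_eq_self_iff.2 (le_pss V q hx)] at h1
    rw [← h1]
    exact Submodule.starProjection_apply_mem _ _

end B14
end OSX

namespace OSX
open Filter Topology
open scoped InnerProduct
section B15
variable {E : Type*} [NormedAddCommGroup E] [InnerProductSpace ℂ E] [CompleteSpace E]

theorem spec_step [Nontrivial E] {Z : Set (E →L[ℂ] E)} (hZ : ∀ X ∈ Z, X† ∈ Z) {c : E →L[ℂ] E} (hc : IsSelfAdjoint c)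
    (hcZ : ∀ X ∈ Z, Commute c X) {r : ℝ} (hr : ‖c‖ ≤ r) :
    ∃ P : E →L[ℂ] E, P† = P ∧ P * P = P ∧ (∀ X ∈ Z, P * X = X * P) ∧
      ‖c - ((r / 2 : ℝ) : ℂ) • ((2 : ℂ) • P - 1)‖ ≤ r / 2 := by
  have hr0 : 0 ≤ r := (norm_nonneg c).trans hr
  set f : ℝ → ℝ := fun t => max t 0 with hf
  set g : ℝ → ℝ := fun t => max (-t) 0 with hg
  have cf : Continuous f := by fun_prop
  have cg : Continuous g := by fun_prop
  set p := cfc f c with hp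
  set m := cfc g c with hm
  have h1 : p - m = c := by
    rw [hp, hm, ← cfc_sub f g c cf.continuousOn cg.continuousOn]
    conv_rhs => rw [← cfc_id ℝ c]
    refine cfc_congr fun t _ => ?_
    rcases le_total t 0 with h | h <;> simp [f, g, h]
  have h2 : p * m = 0 := by
    rw [hp, hm, ← cfc_mul f g c cf.continuousOn cg.continuousOn, ← cfc_zero ℝ c]
    refine cfc_congr fun t _ => ?_
    rcases le_total t 0 with h | h <;> simp [f, g, h]
  have h3 : ‖p + m - ((r / 2 : ℝ) : ℂ) • (1 : E →L[ℂ] E)‖ ≤ r / 2 := by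
    have e : p + m - ((r / 2 : ℝ) : ℂ) • (1 : E →L[ℂ] E) = cfc (fun t : ℝ => f t + g t - r / 2) c := by
      rw [cfc_sub (fun t => f t + g t) (fun _ => r / 2) c (by fun_prop) (by fun_prop),
        cfc_add c f g cf.continuousOn cg.continuousOn, cfc_const (r / 2) c, Algebra.algebraMap_eq_smul_one]
      rfl
    rw [e]
    refine norm_cfc_le (by positivity) fun t ht => ?_
    have h4 : |t| ≤ r := (spectrum.norm_le_norm_of_mem ht).trans hr
    have h5 : f t + g t = |t| := by
      rcases le_total t 0 with h | h <;> simp [f, g, h, abs_of_nonneg, abs_of_nonpos]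
    rw [h5, Real.norm_eq_abs, abs_le]
    constructor <;> linarith [abs_nonneg t]
  have sp : p† = p := cfc_predicate f c
  have sm : m† = m := cfc_predicate g c
  set K : Submodule ℂ E := (LinearMap.range (p : E →ₗ[ℂ] E)).topologicalClosure with hK
  have hKm : ∀ x, p x ∈ K := fun x => Submodule.le_topologicalClosure _ ⟨x, rfl⟩
  have hKle : ∀ X : E →L[ℂ] E, (∀ x, X (p x) ∈ K) → ∀ x ∈ K, X x ∈ K := fun X hX => by
    have : K ≤ K.comap (X : E →ₗ[ℂ] E) := Submodule.topologicalClosure_minimal _ (by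
      rintro _ ⟨x, rfl⟩; exact hX x) ((Submodule.isClosed_topologicalClosure _).preimage X.continuous)
    exact this
  have hcom : ∀ X, Commute c X → ∀ x ∈ K, X x ∈ K := fun X hX => hKle X fun x => by
    have := congrArg (fun Y : E →L[ℂ] E => Y x) (hX.cfc_real f).eq
    simp only [ContinuousLinearMap.mul_apply] at this
    rw [← this]; exact hKm _
  set P := K.starProjection with hP
  have Pp : P * p = p := by
    ext x; exact Submodule.starProjection_eq_self_iff.2 (hKm x)
  have Pm : P * m = 0 := by
    ext x
    refine (Submodule.starProjection_apply_eq_zero_iff _).2 ?_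
    rw [hK, Submodule.orthogonal_closure]
    rintro _ ⟨y, rfl⟩
    have : (⟪p y, m x⟫ : ℂ) = ⟪y, (p * m) x⟫ := by
      rw [ContinuousLinearMap.mul_apply, ← ContinuousLinearMap.adjoint_inner_left p, sp]
    rw [h2] at this
    simpa using this
  have PP : P * P = P := Submodule.isIdempotentElem_starProjection _
  have Pa : P† = P := sp_adj K
  refine ⟨P, Pa, PP, fun X hX => proj_intertw X (hcom X (hcZ X hX)) (hcom _ (hcZ _ (hZ X hX))), ?_⟩
  have e : c - ((r / 2 : ℝ) : ℂ) • ((2 : ℂ) • P - 1) =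
      ((2 : ℂ) • P - 1) * (p + m - ((r / 2 : ℝ) : ℂ) • (1 : E →L[ℂ] E)) := by
    have : ((2 : ℂ) • P - 1) * (p + m) = p - m := by
      rw [sub_mul, one_mul, smul_mul_assoc, mul_add, Pp, Pm, add_zero, two_smul]; abel
    rw [mul_sub, this, h1, mul_smul_comm, mul_one]
  rw [e]
  calc _ ≤ ‖(2 : ℂ) • P - 1‖ * ‖p + m - ((r / 2 : ℝ) : ℂ) • (1 : E →L[ℂ] E)‖ := norm_mul_le _ _
    _ ≤ 1 * (r / 2) := by gcongr; exact refl_norm Pa PP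
    _ = r / 2 := one_mul _

theorem spec_comm {Z : Set (E →L[ℂ] E)} (hZ : ∀ X ∈ Z, X† ∈ Z) {d : E →L[ℂ] E} (hd : d† = d)
    (hdZ : ∀ X ∈ Z, d * X = X * d) {Q : E →L[ℂ] E}
    (hQ : ∀ P : E →L[ℂ] E, P† = P → P * P = P → (∀ X ∈ Z, P * X = X * P) → Q * P = P * Q) : Q * d = d * Q := by
  rcases subsingleton_or_nontrivial E with hE | hE
  · ext x; exact Subsingleton.elim _ _
  have key : ∀ n : ℕ, ∃ c : E →L[ℂ] E, IsSelfAdjoint c ∧ (∀ X ∈ Z, Commute c X) ∧ ‖c‖ ≤ ‖d‖ / 2 ^ n ∧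
      Q * d - d * Q = Q * c - c * Q := by
    intro n
    induction n with
    | zero => exact ⟨d, hd, hdZ, by simp, rfl⟩
    | succ n ih =>
      obtain ⟨c, h1, h2, h3, h4⟩ := ih
      obtain ⟨P, p1, p2, p3, p4⟩ := spec_step hZ h1 h2 h3
      have p1' : IsSelfAdjoint P := p1
      refine ⟨_, ?_, fun X hX => ?_, p4.trans_eq (by rw [pow_succ]; ring), ?_⟩
      · refine h1.sub (IsSelfAdjoint.smul (Complex.conj_ofReal _) ((IsSelfAdjoint.smul (by simp [isSelfAdjoint_iff]) p1').sub (IsSelfAdjoint.one _)))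
      · exact (h2 X hX).sub_left (((Commute.smul_left (p3 X hX) _).sub_left (Commute.one_left _)).smul_left _)
      · have e : Commute Q (((‖d‖ / 2 ^ n / 2 : ℝ) : ℂ) • ((2 : ℂ) • P - 1)) :=
          ((Commute.smul_right (hQ P p1 p2 p3) _).sub_right (Commute.one_right _)).smul_right _
        rw [h4, mul_sub, sub_mul, e.eq]; abel
  have h0 : ‖Q * d - d * Q‖ = 0 := by
    have hl : Tendsto (fun n : ℕ => 2 * ‖Q‖ * (‖d‖ * (1 / 2) ^ n)) atTop (𝓝 (2 * ‖Q‖ * (‖d‖ * 0))) :=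
      ((tendsto_pow_atTop_nhds_zero_of_lt_one (by norm_num) (by norm_num)).const_mul _).const_mul _
    rw [mul_zero, mul_zero] at hl
    refine le_antisymm (ge_of_tendsto' hl fun n => ?_) (norm_nonneg _)
    obtain ⟨c, -, -, h3, h4⟩ := key n
    rw [h4]
    have h5 : ‖c‖ ≤ ‖d‖ * (1 / 2) ^ n := h3.trans_eq (by rw [one_div, inv_pow]; rfl)
    calc ‖Q * c - c * Q‖ ≤ ‖Q * c‖ + ‖c * Q‖ := norm_sub_le _ _
      _ ≤ ‖Q‖ * ‖c‖ + ‖c‖ * ‖Q‖ := add_le_add (norm_mul_le _ _) (norm_mul_le _ _)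
      _ = 2 * ‖Q‖ * ‖c‖ := by ring
      _ ≤ _ := by gcongr
  exact sub_eq_zero.1 (norm_eq_zero.1 h0)

end B15
end OSX

namespace OSX
open Filter Topology
open scoped InnerProduct
section B16
variable {H₁ H₂ : Type*}
  [NormedAddCommGroup H₁] [InnerProductSpace ℂ H₁] [CompleteSpace H₁]
  [NormedAddCommGroup H₂] [InnerProductSpace ℂ H₂] [CompleteSpace H₂]

theorem itw_of_nn {D₁ : StarSubalgebra ℂ (H₁ →L[ℂ] H₁)} {D₂ : StarSubalgebra ℂ (H₂ →L[ℂ] H₂)}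
    (hD₁ : IsMasa D₁) (hD₂ : IsMasa D₂) {M : Set (H₁ →L[ℂ] H₂)} {T : H₁ →L[ℂ] H₂}
    (hT : T ∈ Nn (BM D₁ D₂ M)) {a : H₁ →L[ℂ] H₁} {b : H₂ →L[ℂ] H₂} (ha : a ∈ D₁) (hb : b ∈ D₂)
    (ha' : a† = a) (hb' : b† = b) (h : ∀ S ∈ M, b ∘L S = S ∘L a) : b ∘L T = T ∘L a := by
  obtain ⟨i₁, i₂, hi⟩ := exists_emb H₁ H₂
  set d := eE i₁ i₂ (a, b) with hd
  have hdsa : d† = d := eE_sa ha' hb'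
  have d1 : ∀ x, d (i₁ x) = i₁ (a x) := fun x => by simp [hd, eE, hi.a11, hi.a21]
  have d2 : ∀ x, d (i₂ x) = i₂ (b x) := fun x => by simp [hd, eE, hi.a22, hi.a12]
  have j1 : ∀ z, (i₁†) (d z) = a ((i₁†) z) := eE_i₁ hi (a, b)
  have j2 : ∀ z, (i₂†) (d z) = b ((i₂†) z) := eE_i₂ hi (a, b)
  have key := spec_comm (Z := {X | d * X = X * d}) (d := d) (Q := i₂ ∘L T ∘L i₁†) ?_ hdsa (fun X hX => hX) ?_
  · ext x
    have := congrArg (fun Y : _ →L[ℂ] _ => (i₂†) (Y (i₁ x))) key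
    simp only [ContinuousLinearMap.mul_apply, ContinuousLinearMap.comp_apply, d1, d2, hi.a11, hi.a22] at this
    exact this.symm
  · intro X hX
    have := congrArg ContinuousLinearMap.adjoint (show d ∘L X = X ∘L d from hX)
    rw [ContinuousLinearMap.adjoint_comp, ContinuousLinearMap.adjoint_comp, hdsa] at this
    exact this.symm
  · intro P hP hPP hPZ
    have z1 : ∀ A ∈ D₁, ∀ z, P (i₁ (A ((i₁†) z))) = i₁ (A ((i₁†) (P z))) := fun A hA z => by
      refine DFunLike.congr_fun (hPZ (i₁ ∘L A ∘L i₁†) ?_) z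
      ext z
      have := DFunLike.congr_fun (masa_comm hD₁ ha hA) ((i₁†) z)
      simp only [ContinuousLinearMap.mul_apply] at this
      simp [d1, j1, this]
    have z2 : ∀ A ∈ D₂, ∀ z, P (i₂ (A ((i₂†) z))) = i₂ (A ((i₂†) (P z))) := fun A hA z => by
      refine DFunLike.congr_fun (hPZ (i₂ ∘L A ∘L i₂†) ?_) z
      ext z
      have := DFunLike.congr_fun (masa_comm hD₂ hb hA) ((i₂†) z)
      simp only [ContinuousLinearMap.mul_apply] at this
      simp [d2, j2, this]
    have z3 : ∀ S ∈ M, ∀ z, P (i₂ (S ((i₁†) z))) = i₂ (S ((i₁†) (P z))) := fun S hS z => by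
      refine DFunLike.congr_fun (hPZ (i₂ ∘L S ∘L i₁†) ?_) z
      ext z
      have := DFunLike.congr_fun (h S hS) ((i₁†) z)
      simp only [ContinuousLinearMap.comp_apply] at this
      simp [d2, j1, this]
    set p := i₁† ∘L P ∘L i₁ with hp
    set q := i₂† ∘L P ∘L i₂ with hq
    have P1 : ∀ x, P (i₁ x) = i₁ (p x) := fun x => by
      have := z1 1 (one_mem _) (i₁ x)
      simpa [hi.a11, hp] using this
    have P2 : ∀ x, P (i₂ x) = i₂ (q x) := fun x => by
      have := z2 1 (one_mem _) (i₂ x)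
      simpa [hi.a22, hq] using this
    have Q1 : ∀ z, (i₁†) (P z) = p ((i₁†) z) := fun z => by
      have := congrArg (i₁†) (z1 1 (one_mem _) z)
      rw [P1] at this
      simpa [hi.a11] using this.symm
    have c : (p, q) ∈ BM D₁ D₂ M := by
      have sp : p† = p := by simp [hp, ContinuousLinearMap.adjoint_comp, hP, ContinuousLinearMap.comp_assoc]
      have sq : q† = q := by simp [hq, ContinuousLinearMap.adjoint_comp, hP, ContinuousLinearMap.comp_assoc]
      have pp : ∀ z, P (P z) = P z := fun z => DFunLike.congr_fun hPP z
      refine ⟨⟨masa_mem hD₁ sp fun A hA => ?_, masa_mem hD₂ sq fun A hA => ?_, sp, sq, Prod.ext ?_ ?_⟩, fun S hS => ?_⟩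
      · ext x
        have := congrArg (i₁†) (z1 A hA (i₁ x))
        simpa [hi.a11, P1] using this.symm
      · ext x
        have := congrArg (i₂†) (z2 A hA (i₂ x))
        simpa [hi.a22, P2] using this.symm
      · ext x
        have := congrArg (i₁†) (pp (i₁ x))
        simpa [hi.a11, P1] using this
      · ext x
        have := congrArg (i₂†) (pp (i₂ x))
        simpa [hi.a22, P2] using this
      · ext x
        have := congrArg (i₂†) (z3 S hS (i₁ x))
        simpa [hi.a11, hi.a22, P1, P2] using this
    have hqT := hT _ c
    ext z
    have := DFunLike.congr_fun hqT ((i₁†) z)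
    simp only [ContinuousLinearMap.comp_apply] at this
    simp [P2, Q1, this]

end B16
end OSX

namespace OSX
open Filter Topology
open scoped InnerProduct
section B17
variable {H₁ H₂ H₃ : Type*}
  [NormedAddCommGroup H₁] [InnerProductSpace ℂ H₁] [CompleteSpace H₁]
  [NormedAddCommGroup H₂] [InnerProductSpace ℂ H₂] [CompleteSpace H₂]
  [NormedAddCommGroup H₃] [InnerProductSpace ℂ H₃] [CompleteSpace H₃] {κ : Type*}

abbrev Lk (κ : Type*) (H : Type*) [NormedAddCommGroup H] : Type _ := lp (fun _ : κ => H) 2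

def Am (κ : Type*) (S : H₁ →L[ℂ] H₂) : Lk κ H₁ →L[ℂ] Lk κ H₂ :=
  lp.mapCLM 2 (fun _ => S) (norm_nonneg S) (fun _ => le_rfl)

theorem Am_coe (S : H₁ →L[ℂ] H₂) (x : Lk κ H₁) (k : κ) : Am κ S x k = S (x k) := rfl

theorem Am_adj (S : H₁ →L[ℂ] H₂) : (Am κ S)† = Am κ (S†) := by
  symm
  rw [ContinuousLinearMap.eq_adjoint_iff]
  intro x y
  rw [lp.inner_eq_tsum, lp.inner_eq_tsum]
  refine tsum_congr fun k => ?_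
  rw [Am_coe, Am_coe, ContinuousLinearMap.adjoint_inner_left]

theorem Am_comp (S : H₂ →L[ℂ] H₃) (R : H₁ →L[ℂ] H₂) (x : Lk κ H₁) : Am κ S (Am κ R x) = Am κ (S ∘L R) x := rfl

open Classical in
def sn (H : Type*) [NormedAddCommGroup H] [InnerProductSpace ℂ H] (k : κ) : H →L[ℂ] Lk κ H :=
  lp.singleContinuousLinearMap ℂ (fun _ : κ => H) 2 k

theorem sn_adj (k : κ) (x : Lk κ H₁) : ((sn H₁ k)†) x = x k := by
  refine ext_inner_left ℂ fun v => ?_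
  classical
  rw [ContinuousLinearMap.adjoint_inner_right]
  have : sn H₁ k v = lp.single (E := fun _ : κ => H₁) 2 k v := by
    rw [sn, lp.singleContinuousLinearMap_apply]
  rw [this]
  exact lp.inner_single_left (𝕜 := ℂ) (G := fun _ : κ => H₁) k v x

theorem Am_sn (S : H₁ →L[ℂ] H₂) (k : κ) (x : H₁) : Am κ S (sn H₁ k x) = sn H₂ k (S x) := by
  classical
  refine lp.ext (funext fun j => ?_)
  rw [Am_coe]
  change S (Pi.single (M := fun _ : κ => H₁) k x j) = Pi.single (M := fun _ : κ => H₂) k (S x) j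
  rcases eq_or_ne j k with rfl | h
  · simp
  · simp [h]

def en (e : Lk κ H₁ →L[ℂ] Lk κ H₁) (m n : κ) : H₁ →L[ℂ] H₁ := (sn H₁ m)† ∘L e ∘L sn H₁ n

theorem en_adj {e : Lk κ H₁ →L[ℂ] Lk κ H₁} (he : e† = e) (m n : κ) : (en e m n)† = en e n m := by
  simp [en, ContinuousLinearMap.adjoint_comp, he, ContinuousLinearMap.comp_assoc]

theorem en_comm {e : Lk κ H₂ →L[ℂ] Lk κ H₂} {f : Lk κ H₁ →L[ℂ] Lk κ H₁} {S : H₁ →L[ℂ] H₂} :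
    (∀ m n, en e m n ∘L S = S ∘L en f m n) ↔ e ∘L Am κ S = Am κ S ∘L f := by
  constructor
  · intro h
    classical
    refine lp.ext_continuousLinearMap (by simp) fun n => ?_
    ext x : 1
    refine lp.ext (funext fun m => ?_)
    have := DFunLike.congr_fun (h m n) x
    simp only [en, ContinuousLinearMap.comp_apply, sn_adj] at this
    rw [← Am_sn] at this
    exact this
  · intro h m n
    ext x
    have := congrArg (fun y : Lk κ H₂ => y m) (DFunLike.congr_fun h (sn H₁ n x))
    simp only [en, ContinuousLinearMap.comp_apply, sn_adj]
    simp only [ContinuousLinearMap.comp_apply, Am_sn] at this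
    exact this

def cl (ξ : Lk κ H₁) (𝒮 : Set (H₁ →L[ℂ] H₂)) : Submodule ℂ (Lk κ H₂) :=
  (Submodule.span ℂ ((fun S => Am κ S ξ) '' 𝒮)).topologicalClosure

instance (ξ : Lk κ H₁) (𝒮 : Set (H₁ →L[ℂ] H₂)) : CompleteSpace (cl ξ 𝒮) :=
  (Submodule.isClosed_topologicalClosure _).completeSpace_coe

theorem cl_map {ξ : Lk κ H₁} {𝒮 : Set (H₁ →L[ℂ] H₂)} {𝒮' : Set (H₁ →L[ℂ] H₃)} (X : H₂ →L[ℂ] H₃)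
    (h : ∀ S ∈ 𝒮, X ∘L S ∈ 𝒮') : ∀ x ∈ cl ξ 𝒮, Am κ X x ∈ cl ξ 𝒮' := by
  have : cl ξ 𝒮 ≤ (cl ξ 𝒮').comap (Am κ X : Lk κ H₂ →ₗ[ℂ] Lk κ H₃) := by
    refine Submodule.topologicalClosure_minimal _ ?_ ((Submodule.isClosed_topologicalClosure _).preimage (Am κ X).continuous)
    rw [Submodule.span_le]
    rintro _ ⟨S, hS, rfl⟩
    exact Submodule.le_topologicalClosure _ (Submodule.subset_span ⟨_, h S hS, rfl⟩)
  exact this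

theorem en_mem {D : StarSubalgebra ℂ (H₁ →L[ℂ] H₁)} (hD : IsMasa D) {e : Lk κ H₁ →L[ℂ] Lk κ H₁} (he : e† = e)
    (h : ∀ A ∈ D, e ∘L Am κ A = Am κ A ∘L e) (m n : κ) :
    en e m n + en e n m ∈ D ∧ Complex.I • (en e m n - en e n m) ∈ D ∧
    (en e m n + en e n m)† = en e m n + en e n m ∧
    (Complex.I • (en e m n - en e n m))† = Complex.I • (en e m n - en e n m) := by
  have h1 : (en e m n + en e n m)† = en e m n + en e n m := by
    rw [map_add, en_adj he, en_adj he, add_comm]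
  have h2 : (Complex.I • (en e m n - en e n m))† = Complex.I • (en e m n - en e n m) := by
    rw [map_smulₛₗ, map_sub, en_adj he, en_adj he, Complex.conj_I, neg_smul, ← smul_neg, neg_sub]
  have h3 : ∀ A ∈ D, ∀ m n, A * en e m n = en e m n * A := fun A hA m n => (en_comm.2 (h A hA) m n).symm
  refine ⟨masa_mem hD h1 fun A hA => ?_, masa_mem hD h2 fun A hA => ?_, h1, h2⟩
  · rw [mul_add, add_mul, h3 A hA, h3 A hA]
  · rw [mul_smul_comm, smul_mul_assoc, mul_sub, sub_mul, h3 A hA, h3 A hA]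

variable {D₁ : StarSubalgebra ℂ (H₁ →L[ℂ] H₁)} {D₂ : StarSubalgebra ℂ (H₂ →L[ℂ] H₂)}

theorem approx (hD₁ : IsMasa D₁) (hD₂ : IsMasa D₂) {M : Set (H₁ →L[ℂ] H₂)} (hM : IsMasaBimodule D₁ D₂ M)
    (hMt : IsTernary M) {T : H₁ →L[ℂ] H₂} (hT : T ∈ Nn (BM D₁ D₂ M)) (ξ : Lk κ H₁) {ε : ℝ} (hε : 0 < ε) :
    ∃ S ∈ M, ‖Am κ (S - T) ξ‖ < ε := by
  have hl : ∀ S ∈ M, ∀ B ∈ D₂, B ∘L S ∈ M := fun S hS B hB => hM.2 S hS 1 (one_mem _) B hB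
  have hr : ∀ S ∈ M, ∀ A ∈ D₁, S ∘L A ∈ M := fun S hS A hA => hM.2 S hS A hA 1 (one_mem _)
  set 𝒜 : Set (H₁ →L[ℂ] H₁) := {A | A ∈ D₁ ∨ ∃ S ∈ M, ∃ R ∈ M, A = S† ∘L R} with h𝒜
  set e := (cl ξ M).starProjection with he
  set f := (cl ξ 𝒜).starProjection with hf
  have i1 : ∀ S ∈ M, e ∘L Am κ S = Am κ S ∘L f := fun S hS => by
    refine proj_intertw _ (cl_map S ?_) ?_
    · rintro A (hA | ⟨R, hR, R', hR', rfl⟩)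
      · exact hr S hS A hA
      · exact hMt S hS R hR R' hR'
    · rw [Am_adj]
      exact cl_map _ fun R hR => Or.inr ⟨S, hS, R, hR, rfl⟩
  have i2 : ∀ B ∈ D₂, e ∘L Am κ B = Am κ B ∘L e := fun B hB => by
    refine proj_intertw _ (cl_map B fun S hS => hl S hS B hB) ?_
    rw [Am_adj]
    exact cl_map _ fun S hS => hl S hS _ (star_mem hB)
  have i3' : ∀ A ∈ D₁, ∀ A' ∈ 𝒜, A ∘L A' ∈ 𝒜 := by
    rintro A hA A' (hA' | ⟨S, hS, R, hR, rfl⟩)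
    · exact Or.inl (mul_mem hA hA')
    · refine Or.inr ⟨S ∘L (A†), hr S hS _ (star_mem hA), R, hR, ?_⟩
      rw [ContinuousLinearMap.adjoint_comp, ContinuousLinearMap.adjoint_adjoint]; rfl
  have i3 : ∀ A ∈ D₁, f ∘L Am κ A = Am κ A ∘L f := fun A hA => by
    refine proj_intertw _ (cl_map A (i3' A hA)) ?_
    rw [Am_adj]
    exact cl_map _ (i3' _ (star_mem hA))
  have eT : e ∘L Am κ T = Am κ T ∘L f := by
    rw [← en_comm]
    intro m n
    obtain ⟨a1, a2, a3, a4⟩ := en_mem hD₁ (sp_adj _) i3 m n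
    obtain ⟨b1, b2, b3, b4⟩ := en_mem hD₂ (sp_adj _) i2 m n
    have k : ∀ S ∈ M, ∀ m n, en e m n ∘L S = S ∘L en f m n := fun S hS => en_comm.2 (i1 S hS)
    have c1 := itw_of_nn hD₁ hD₂ hT a1 b1 a3 b3 fun S hS => by
      rw [ContinuousLinearMap.add_comp, ContinuousLinearMap.comp_add, k S hS, k S hS]
    have c2 := itw_of_nn hD₁ hD₂ hT a2 b2 a4 b4 fun S hS => by
      rw [ContinuousLinearMap.smul_comp, ContinuousLinearMap.comp_smul, ContinuousLinearMap.sub_comp,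
        ContinuousLinearMap.comp_sub, k S hS, k S hS]
    rw [ContinuousLinearMap.smul_comp, ContinuousLinearMap.comp_smul, ContinuousLinearMap.sub_comp,
      ContinuousLinearMap.comp_sub] at c2
    rw [ContinuousLinearMap.add_comp, ContinuousLinearMap.comp_add] at c1
    have c3 := smul_right_injective _ Complex.I_ne_zero c2
    have c4 := congrArg₂ (· + ·) c1 c3
    simp only [add_add_sub_cancel, ← two_smul ℂ] at c4
    exact smul_right_injective _ two_ne_zero c4
  have fx : f ξ = ξ := Submodule.starProjection_eq_self_iff.2
    (Submodule.le_topologicalClosure _ (Submodule.subset_span ⟨1, Or.inl (one_mem _), rfl⟩))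
  have hm : Am κ T ξ ∈ cl ξ M := by
    have := DFunLike.congr_fun eT ξ
    rw [ContinuousLinearMap.comp_apply, ContinuousLinearMap.comp_apply, fx] at this
    exact Submodule.starProjection_eq_self_iff.1 this
  obtain ⟨y, hy, hd⟩ := Metric.mem_closure_iff.1 hm ε hε
  have : ∃ S ∈ M, Am κ S ξ = y := by
    obtain ⟨⟨N, rfl⟩, -⟩ := hM.1
    refine Submodule.span_induction (p := fun y _ => ∃ S ∈ (N : Set (H₁ →L[ℂ] H₂)), Am κ S ξ = y) ?_ ?_ ?_ ?_ hy
    · rintro _ ⟨S, hS, rfl⟩; exact ⟨S, hS, rfl⟩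
    · exact ⟨0, N.zero_mem, rfl⟩
    · rintro _ _ - - ⟨S, hS, rfl⟩ ⟨R, hR, rfl⟩; exact ⟨S + R, N.add_mem hS hR, rfl⟩
    · rintro c _ - ⟨S, hS, rfl⟩; exact ⟨c • S, N.smul_mem c hS, rfl⟩
  obtain ⟨S, hS, rfl⟩ := this
  refine ⟨S, hS, ?_⟩
  rw [dist_comm, dist_eq_norm] at hd
  exact hd

theorem fl_est {J : Type*} {δ : ℝ} (hδ : 0 < δ) (x : Lk (J × ℕ) H₁) (i : J) {ξ : ℕ → H₁} {η : ℕ → H₂}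
    (hx : ∀ n, x (i, n) = ξ n) (hη : SqS η) {R : H₁ →L[ℂ] H₂} (hn : ‖Am (J × ℕ) R x‖ < δ) :
    ‖fl ξ η R‖ ≤ δ * (∑' n, ‖η n‖ ^ 2 + 1) := by
  have hs := lp.hasSum_norm (by simp) (Am (J × ℕ) R x)
  simp only [ENNReal.toReal_ofNat, Real.rpow_ofNat, Am_coe] at hs
  set g : J × ℕ → ℝ := fun j => ‖R (x j)‖ ^ 2 with hg
  have g0 : ∀ j, 0 ≤ g j := fun j => by positivity
  have inj : Function.Injective (fun n : ℕ => (i, n)) := fun a b h => congrArg Prod.snd h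
  have ge : (g ∘ fun n : ℕ => (i, n)) = fun n => ‖R (ξ n)‖ ^ 2 := funext fun n => by simp [hg, hx]
  have s1 := hs.summable.comp_injective inj
  have s2 := tsum_comp_le_tsum_of_inj hs.summable g0 inj
  rw [hs.tsum_eq] at s2
  rw [ge] at s1 s2

  have s2' := s2.trans (pow_le_pow_left₀ (norm_nonneg _) hn.le 2)
  have s3 : Summable fun n => ‖η n‖ ^ 2 := hη
  refine (tsum_of_norm_bounded ((s3.hasSum.mul_left δ).add (s1.hasSum.mul_left δ⁻¹)) fun n => ?_).trans ?_
  · refine (norm_inner_le_norm _ _).trans ?_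
    set a := ‖η n‖
    set b := ‖R (ξ n)‖
    have : δ * a ^ 2 + δ⁻¹ * b ^ 2 - a * b = δ * ((a - δ⁻¹ * b / 2) ^ 2 + 3 / 4 * (δ⁻¹ * b) ^ 2) := by
      field_simp; ring
    have h0 : 0 ≤ δ * ((a - δ⁻¹ * b / 2) ^ 2 + 3 / 4 * (δ⁻¹ * b) ^ 2) := by positivity
    linarith
  · rw [mul_add]
    have : δ⁻¹ * ∑' n, ‖R (ξ n)‖ ^ 2 ≤ δ⁻¹ * δ ^ 2 := mul_le_mul_of_nonneg_left s2' (by positivity)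
    have h2 : δ⁻¹ * δ ^ 2 = δ * 1 := by field_simp
    linarith

theorem nn_sub (hD₁ : IsMasa D₁) (hD₂ : IsMasa D₂) {M : Set (H₁ →L[ℂ] H₂)} (hM : IsMasaBimodule D₁ D₂ M)
    (hMt : IsTernary M) : Nn (BM D₁ D₂ M) ⊆ M := by
  classical
  intro T hT
  let I := {p : (ℕ → H₁) × (ℕ → H₂) // SqS p.1 ∧ SqS p.2}
  have key : ∀ q : Finset I × ℕ, ∃ S ∈ M, ∀ i ∈ q.1, ‖fl i.1.1 i.1.2 (S - T)‖ ≤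
      1 / ((q.2 : ℝ) + 1) * (∑' n, ‖i.1.2 n‖ ^ 2 + 1) := by
    rintro ⟨F, k⟩
    have hδ : (0 : ℝ) < 1 / ((k : ℝ) + 1) := by positivity
    set δ := 1 / ((k : ℝ) + 1) with hδd
    have hmem : Memℓp (fun j : F × ℕ => j.1.1.1.1 j.2) 2 := by
      refine memℓp_gen ?_
      simp only [ENNReal.toReal_ofNat, Real.rpow_ofNat]
      rw [summable_prod_of_nonneg fun _ => by positivity]
      exact ⟨fun i => i.1.2.1, (hasSum_fintype _).summable⟩
    obtain ⟨x, hx⟩ : ∃ x : Lk (F × ℕ) H₁, ∀ j, x j = j.1.1.1.1 j.2 := ⟨⟨_, hmem⟩, fun _ => rfl⟩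
    obtain ⟨S, hS, hn⟩ := approx hD₁ hD₂ hM hMt hT x hδ
    refine ⟨S, hS, fun i hi => ?_⟩
    exact fl_est hδ x (⟨i, hi⟩ : F) (fun n => hx _) i.2.2 hn
  choose S hS hb using key
  refine hM.1.2.mem_of (l := atTop) (f := S) (fun ξ η hξ hη => ?_) (Eventually.of_forall hS)
  have hlim : Tendsto (fun q : Finset I × ℕ => 1 / ((q.2 : ℝ) + 1) * (∑' n, ‖η n‖ ^ 2 + 1)) atTop (𝓝 0) := by
    have : Tendsto (fun q : Finset I × ℕ => q.2) atTop atTop := by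
      rw [← prod_atTop_atTop_eq]; exact tendsto_snd
    simpa using (tendsto_one_div_add_atTop_nhds_zero_nat.comp this).mul_const (∑' n, ‖η n‖ ^ 2 + 1)
  rw [tendsto_iff_norm_sub_tendsto_zero]
  refine squeeze_zero' (Eventually.of_forall fun _ => norm_nonneg _) ?_ hlim
  filter_upwards [eventually_ge_atTop (({⟨(ξ, η), hξ, hη⟩} : Finset I), 0)] with q hq
  have h1 := hb q ⟨(ξ, η), hξ, hη⟩ (hq.1 (Finset.mem_singleton_self _))
  have h2 : fl ξ η (S q - T) + fl ξ η T = fl ξ η (S q) := by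
    rw [← fl_add hξ hη, sub_add_cancel]
  rw [← h2, add_sub_cancel_right]
  exact h1

end B17
end OSX

/-- Proposition `delta`. -/
theorem statement9
    {H₁ H₂ K₁ K₂ T₁ T₂ : Type*}
    [NormedAddCommGroup H₁] [InnerProductSpace ℂ H₁] [CompleteSpace H₁]
    [NormedAddCommGroup H₂] [InnerProductSpace ℂ H₂] [CompleteSpace H₂]
    [NormedAddCommGroup K₁] [InnerProductSpace ℂ K₁] [CompleteSpace K₁]
    [NormedAddCommGroup K₂] [InnerProductSpace ℂ K₂] [CompleteSpace K₂]
    [NormedAddCommGroup T₁] [InnerProductSpace ℂ T₁] [CompleteSpace T₁]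
    [NormedAddCommGroup T₂] [InnerProductSpace ℂ T₂] [CompleteSpace T₂]
    [TopologicalSpace.SeparableSpace H₁] [TopologicalSpace.SeparableSpace H₂]
    (D₁ : StarSubalgebra ℂ (H₁ →L[ℂ] H₁)) (D₂ : StarSubalgebra ℂ (H₂ →L[ℂ] H₂))
    (hD₁ : IsMasa D₁) (hD₂ : IsMasa D₂)
    {r : ℕ} (Bs : Fin r → Set (H₁ →L[ℂ] H₂))
    (hBs : ∀ i, HasFiniteWidth D₁ D₂ (Bs i))
    (U : Set (K₁ →L[ℂ] K₂)) (Us : Fin r → Set (K₁ →L[ℂ] K₂))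
    (hU : IsWkClosedSubspace U) (hUs : ∀ i, IsWkClosedSubspace (Us i))
    (t₁ : H₁ → K₁ → T₁) (t₂ : H₂ → K₂ → T₂)
    (ht₁ : IsTensorEmbedding t₁) (ht₂ : IsTensorEmbedding t₂)
    (M C : Set (H₁ →L[ℂ] H₂))
    (hM : IsMasaBimodule D₁ D₂ M) (hMter : IsTernary M)
    (hC : HasFiniteWidth D₁ D₂ C) :
    wkClosure (wTensor t₁ t₂ M U + setSum fun j => wTensor t₁ t₂ (Bs j) (Us j)) ∩
      wkClosure (wTensor t₁ t₂ C U + setSum fun j => wTensor t₁ t₂ (Bs j) (Us j)) =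
    wkClosure (wTensor t₁ t₂ (M ∩ C) U +
      setSum fun j => wTensor t₁ t₂ (Bs j) (Us j)) := by
  obtain ⟨⟨U', rfl⟩, hU'⟩ := hU
  choose Us' hUs' using fun i => (hUs i).1
  obtain rfl : (fun i => (Us' i : Set (K₁ →L[ℂ] K₂))) = Us := funext hUs'
  have e : ∀ V : Set (H₁ →L[ℂ] H₂), wkClosure (wTensor t₁ t₂ V U' +
      setSum fun j => wTensor t₁ t₂ (Bs j) (Us' j)) =
      (OSX.wkcl (OSX.wT (t₁ := t₁) (t₂ := t₂) V U' ⊔ ⨆ j, OSX.wT (t₁ := t₁) (t₂ := t₂) (Bs j) (Us' j)) :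
        Set (T₁ →L[ℂ] T₂)) := fun V => by
    have h := OSX.setSum_eq fun j => OSX.wT (t₁ := t₁) (t₂ := t₂) (Bs j) (Us' j : Set (K₁ →L[ℂ] K₂))
    change _ = wkClosure _
    rw [Submodule.coe_sup, ← h]
    rfl
  simp only [e]
  exact OSX.main ht₁ ht₂ hD₁ hD₂ (fun V h1 h2 => OSX.exists_chain hD₁ hD₂ h1 h2) Bs hBs U' Us' hU'
    (fun i => (hUs i).2) M C hM (OSX.nn_sub hD₁ hD₂ hM hMter) hC
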